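/- arXiv:1407.8303 — 3 statements merged into one kernel-verified Lean document; each statement's English description precedes it below -/
import Mathlib

section
/- Let s > 0, and let k ∈ ℕ be the integer with s ∈ [k−1, k). Let α ∈ ℝ, β > −1, and n ∈ ℕ. Then for every x ∈ (−1, 1), D_−^s[ (1+·)^{β+s} P_n^{(α−s, β+s)} ](x) = [Γ(n+β+s+1)/Γ(n+β+1)] · (1+x)^{β} · P_n^{(α,β)}(x). -/
open MeasureTheory Filter Finset

/-- Jacobi polynomial with real parameters. -/
noncomputable def jacobiP (a b : ℝ) (n : ℕ) (x : ℝ) : ℝ :=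
  ∑ j ∈ Finset.range (n + 1),
    ((ascPochhammer ℝ j).eval ((n : ℝ) + a + b + 1) / (Nat.factorial j : ℝ)) *
      ((ascPochhammer ℝ (n - j)).eval (a + (j : ℝ) + 1) / (Nat.factorial (n - j) : ℝ)) *
      ((x - 1) / 2) ^ j

/-- Right Riemann-Liouville fractional integral on (-1,1). -/
noncomputable def Iplus (ρ : ℝ) (v : ℝ → ℝ) (x : ℝ) : ℝ :=
  (1 / Real.Gamma ρ) * ∫ y in x..1, (y - x) ^ (ρ - 1) * v y

/-- Left Riemann-Liouville fractional integral on (-1,1). -/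
noncomputable def Iminus (ρ : ℝ) (v : ℝ → ℝ) (x : ℝ) : ℝ :=
  (1 / Real.Gamma ρ) * ∫ y in (-1 : ℝ)..x, (x - y) ^ (ρ - 1) * v y

/-- Right Riemann-Liouville fractional derivative of order `s ∈ [k-1,k)`. -/
noncomputable def Dplus (s : ℝ) (k : ℕ) (v : ℝ → ℝ) (x : ℝ) : ℝ :=
  (-1 : ℝ) ^ k * iteratedDeriv k (Iplus ((k : ℝ) - s) v) x

/-- Left Riemann-Liouville fractional derivative of order `s ∈ [k-1,k)`. -/
noncomputable def Dminus (s : ℝ) (k : ℕ) (v : ℝ → ℝ) (x : ℝ) : ℝ :=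
  iteratedDeriv k (Iminus ((k : ℝ) - s) v) x

lemma choose_eq_asc (r : ℝ) (m : ℕ) :
    Ring.choose r m = (ascPochhammer ℝ m).eval (r - m + 1) / (Nat.factorial m : ℝ) := by
  rw [Ring.choose_eq_smul, Polynomial.descPochhammer_smeval_eq_ascPochhammer,
    Polynomial.ascPochhammer_smeval_cast, Polynomial.ascPochhammer_smeval_eq_eval, smul_eq_mul]
  ring

lemma asc_neg (r : ℝ) (m : ℕ) :
    (ascPochhammer ℝ m).eval (-r) = (-1) ^ m * (ascPochhammer ℝ m).eval (r - m + 1) := by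
  rw [ascPochhammer_eval_neg_eq_descPochhammer, descPochhammer_eval_eq_ascPochhammer]

lemma vand (c d : ℝ) (M : ℕ) :
    ∑ m ∈ Finset.range (M + 1),
      ((ascPochhammer ℝ m).eval c / (Nat.factorial m : ℝ)) * (-1) ^ m *
      ((ascPochhammer ℝ (M - m)).eval (d + m) / (Nat.factorial (M - m) : ℝ)) =
    (ascPochhammer ℝ M).eval (d - c) / (Nat.factorial M : ℝ) := by
  have h := Ring.add_choose_eq (r := -c) (s := d + M - 1) M (Commute.all _ _)
  rw [Finset.Nat.sum_antidiagonal_eq_sum_range_succ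
    (fun i j => Ring.choose (-c) i * Ring.choose (d + M - 1) j)] at h
  rw [choose_eq_asc] at h
  rw [show d - c = -c + (d + M - 1) - M + 1 by ring, h]
  refine Finset.sum_congr rfl fun m hm => ?_
  have hm' : m ≤ M := by simpa [Nat.lt_succ_iff] using hm
  rw [choose_eq_asc, choose_eq_asc, Nat.cast_sub hm',
    show d + (M : ℝ) - 1 - (M - m) + 1 = d + m by ring,
    show -c - (m : ℝ) + 1 = -(c + m - 1) by ring, asc_neg,
    show c + (m : ℝ) - 1 - m + 1 = c by ring]
  ring

lemma asc_add (c : ℝ) (i m : ℕ) : (ascPochhammer ℝ (i + m)).eval c =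
    (ascPochhammer ℝ i).eval c * (ascPochhammer ℝ m).eval (c + i) := by
  rw [← ascPochhammer_mul]
  simp

lemma jacobi_symm (a b : ℝ) (n : ℕ) (x : ℝ) :
    jacobiP a b n x = ∑ i ∈ Finset.range (n + 1),
      ((ascPochhammer ℝ i).eval ((n : ℝ) + a + b + 1) / (Nat.factorial i : ℝ)) *
      ((-1) ^ (n - i) * (ascPochhammer ℝ (n - i)).eval (b + (i : ℝ) + 1)
        / (Nat.factorial (n - i) : ℝ)) *
      ((1 + x) / 2) ^ i := by
  unfold jacobiP
  have h1 : ∀ j : ℕ, ((x - 1) / 2) ^ j = ∑ i ∈ Finset.Ico 0 (j + 1),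
      ((1 + x) / 2) ^ i * (-1) ^ (j - i) * (j.choose i : ℝ) := by
    intro j
    rw [← Finset.range_eq_Ico, ← add_pow]
    congr 1; ring
  simp_rw [h1, Finset.mul_sum]
  rw [Finset.range_eq_Ico, ← Finset.sum_Ico_Ico_comm]
  refine Finset.sum_congr rfl fun i hi => ?_
  have hi' : i ≤ n := by simpa [Nat.lt_succ_iff] using hi
  obtain ⟨M, rfl⟩ := Nat.exists_eq_add_of_le hi'
  rw [Finset.sum_Ico_eq_sum_range]
  rw [show i + M + 1 - i = M + 1 by omega, show i + M - i = M by omega]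
  set c : ℝ := ((i + M : ℕ) : ℝ) + a + b + 1 with hc
  have h2 := vand (c + i) (a + i + 1) M
  have h3 : (a + i + 1) - (c + i) = -(b + i + M) := by rw [hc]; push_cast; ring
  rw [h3, asc_neg, show b + (i : ℝ) + M - M + 1 = b + i + 1 by ring] at h2
  rw [← h2, Finset.mul_sum, Finset.sum_mul]
  refine Finset.sum_congr rfl fun m hm => ?_
  have hm' : m ≤ M := by simpa [Nat.lt_succ_iff] using hm
  rw [asc_add, show i + M - (i + m) = M - m by omega, show i + m - i = m by omega,
    Nat.cast_choose ℝ (Nat.le_add_right i m), show i + m - i = m by omega,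
    show a + ((i + m : ℕ) : ℝ) + 1 = a + i + 1 + m by push_cast; ring]
  have := Nat.factorial_pos (i + m)
  have := Nat.factorial_pos i
  have := Nat.factorial_pos m
  have := Nat.factorial_pos (M - m)
  field_simp

lemma gamma_asc (z : ℝ) (hz : 0 < z) (m : ℕ) :
    Real.Gamma (z + m) = (ascPochhammer ℝ m).eval z * Real.Gamma z := by
  induction m with
  | zero => simp
  | succ m ih =>
    rw [ascPochhammer_succ_eval, Nat.cast_succ, ← add_assoc, Real.Gamma_add_one (by positivity), ih]
    ring

lemma frac_int (ρ γ x : ℝ) (hρ : 0 < ρ) (hγ : -1 < γ) (hx : -1 < x) :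
    ∫ y in (-1 : ℝ)..x, (x - y) ^ (ρ - 1) * (1 + y) ^ γ =
      Real.Gamma ρ * (Real.Gamma (γ + 1) * ((1 + x) ^ (γ + ρ) / Real.Gamma (γ + ρ + 1))) := by
  have ha : 0 < 1 + x := by linarith
  have h := Complex.betaIntegral_scaled ((γ + 1 : ℝ) : ℂ) (ρ : ℂ) ha
  have hG := Complex.Gamma_mul_Gamma_eq_betaIntegral (s := ((γ + 1 : ℝ) : ℂ)) (t := (ρ : ℂ))
    (by rw [Complex.ofReal_re]; linarith) (by simpa using hρ)
  have hg0 : Real.Gamma (γ + 1 + ρ) ≠ 0 := (Real.Gamma_pos_of_pos (by linarith)).ne'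
  have hB : Complex.betaIntegral ((γ + 1 : ℝ) : ℂ) (ρ : ℂ) =
      ((Real.Gamma (γ + 1) * Real.Gamma ρ / Real.Gamma (γ + 1 + ρ) : ℝ) : ℂ) := by
    rw [← Complex.ofReal_add, Complex.Gamma_ofReal, Complex.Gamma_ofReal, Complex.Gamma_ofReal] at hG
    rw [Complex.ofReal_div, Complex.ofReal_mul, eq_div_iff (by exact_mod_cast hg0), hG]
    ring
  have hL : ∫ y in (0:ℝ)..(1 + x), (y : ℂ) ^ (((γ + 1 : ℝ) : ℂ) - 1) *
      (((1 + x : ℝ) : ℂ) - y) ^ ((ρ : ℂ) - 1) =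
      ((∫ y in (0:ℝ)..(1 + x), y ^ γ * (1 + x - y) ^ (ρ - 1) : ℝ) : ℂ) := by
    rw [← intervalIntegral.integral_ofReal]
    refine intervalIntegral.integral_congr fun y hy => ?_
    rw [Set.uIcc_of_le ha.le] at hy
    rw [Complex.ofReal_mul, Complex.ofReal_cpow hy.1, Complex.ofReal_cpow (by linarith [hy.2])]
    push_cast
    congr 2
    ring
  rw [hL, hB, show ((γ + 1 : ℝ) : ℂ) + ρ - 1 = ((γ + ρ : ℝ) : ℂ) by push_cast; ring,
    ← Complex.ofReal_cpow ha.le, ← Complex.ofReal_mul] at h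
  have h' := Complex.ofReal_injective h
  have hs := intervalIntegral.integral_comp_add_left
    (fun y : ℝ => y ^ γ * (1 + x - y) ^ (ρ - 1)) (a := -1) (b := x) (1 : ℝ)
  rw [show (1 : ℝ) + -1 = 0 by ring, h'] at hs
  rw [show γ + ρ + 1 = γ + 1 + ρ by ring]
  calc _ = ∫ y in (-1 : ℝ)..x, (1 + y) ^ γ * (1 + x - (1 + y)) ^ (ρ - 1) := by
        congr 1 with y
        rw [show 1 + x - (1 + y) = x - y by ring, mul_comm]
    _ = _ := by rw [hs]; ring

lemma frac_intble (ρ γ x : ℝ) (hρ : 0 < ρ) (hγ : -1 < γ) (hx : -1 < x) :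
    IntervalIntegrable (fun y => (x - y) ^ (ρ - 1) * (1 + y) ^ γ) volume (-1) x := by
  by_contra h
  have h1 := frac_int ρ γ x hρ hγ hx
  rw [intervalIntegral.integral_undef h] at h1
  have := Real.Gamma_pos_of_pos hρ
  have := Real.Gamma_pos_of_pos (show 0 < γ + 1 by linarith)
  have := Real.Gamma_pos_of_pos (show 0 < γ + ρ + 1 by linarith)
  have : 0 < (1 + x) ^ (γ + ρ) := Real.rpow_pos_of_pos (by linarith) _
  have : 0 < Real.Gamma ρ * (Real.Gamma (γ + 1) * ((1 + x) ^ (γ + ρ) / Real.Gamma (γ + ρ + 1))) := by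
    positivity
  linarith

lemma iter_deriv_aux (S : Finset ℕ) (b c : ℕ → ℝ) (hb : ∀ j, -1 < b j) (k : ℕ) :
    ∀ F : ℝ → ℝ, (∀ x, -1 < x → F x = ∑ j ∈ S, c j *
      ((1 + x) ^ (b j + k) / Real.Gamma (b j + k + 1))) →
    ∀ x, -1 < x → iteratedDeriv k F x =
      ∑ j ∈ S, c j * ((1 + x) ^ (b j) / Real.Gamma (b j + 1)) := by
  induction k with
  | zero => intro F hF x hx; simpa using hF x hx
  | succ k ih =>
    intro F hF x hx
    rw [iteratedDeriv_succ']
    refine ih _ (fun z hz => ?_) x hx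
    have he : F =ᶠ[nhds z] fun x => ∑ j ∈ S, c j *
      ((1 + x) ^ (b j + (k + 1 : ℕ)) / Real.Gamma (b j + (k + 1 : ℕ) + 1)) := by
      filter_upwards [lt_mem_nhds hz] with y hy using hF y hy
    rw [he.deriv_eq]
    refine HasDerivAt.deriv ?_
    refine HasDerivAt.fun_sum fun j _ => ?_
    refine HasDerivAt.const_mul _ ?_
    have hpos : 0 < b j + k + 1 := by have := hb j; have : (0:ℝ) ≤ k := k.cast_nonneg; linarith
    have h1 : HasDerivAt (fun x : ℝ => (1 + x) ^ (b j + (k + 1 : ℕ)))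
        (1 * (b j + (k + 1 : ℕ)) * (1 + z) ^ (b j + (k + 1 : ℕ) - 1)) z :=
      ((hasDerivAt_id z).const_add 1).rpow_const (Or.inl (by simp; linarith))
    have h2 := h1.div_const (Real.Gamma (b j + (k + 1 : ℕ) + 1))
    convert h2 using 1
    have hg := Real.Gamma_pos_of_pos hpos
    rw [Nat.cast_succ, show b j + ((k : ℝ) + 1) + 1 = (b j + k + 1) + 1 by ring,
      Real.Gamma_add_one hpos.ne', show b j + ((k : ℝ) + 1) - 1 = b j + k by ring,
      show b j + ((k : ℝ) + 1) = b j + k + 1 by ring]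
    field_simp

/-- Lemma 2.6, left derivative formula. -/
theorem stmt5 (s : ℝ) (hs : 0 < s) (k : ℕ) (hk1 : (k : ℝ) - 1 ≤ s) (hk2 : s < k)
    (α β : ℝ) (hβ : -1 < β) (n : ℕ) :
    ∀ x ∈ Set.Ioo (-1 : ℝ) 1,
      Dminus s k (fun y => (1 + y) ^ (β + s) * jacobiP (α - s) (β + s) n y) x =
        Real.Gamma ((n : ℝ) + β + s + 1) / Real.Gamma ((n : ℝ) + β + 1) *
          ((1 + x) ^ β * jacobiP α β n x) := by
  intro x hx
  have hρ : 0 < (k : ℝ) - s := by linarith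
  set e : ℕ → ℝ := fun i =>
    ((ascPochhammer ℝ i).eval ((n : ℝ) + (α - s) + (β + s) + 1) / (Nat.factorial i : ℝ)) *
      ((-1) ^ (n - i) * (ascPochhammer ℝ (n - i)).eval (β + s + (i : ℝ) + 1)
        / (Nat.factorial (n - i) : ℝ)) / 2 ^ i with he
  have hb : ∀ j : ℕ, -1 < β + j := fun j => by
    have : (0:ℝ) ≤ j := j.cast_nonneg
    linarith
  unfold Dminus
  rw [iter_deriv_aux (Finset.range (n + 1)) (fun j => β + j)
    (fun j => e j * Real.Gamma (β + s + j + 1)) hb k _ ?_ x hx.1]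
  · rw [jacobi_symm, Finset.mul_sum, Finset.mul_sum]
    refine Finset.sum_congr rfl fun i hi => ?_
    have hi' : i ≤ n := by simpa [Nat.lt_succ_iff] using hi
    have hx1 : 0 < 1 + x := by linarith [hx.1]
    have hp1 : 0 < β + s + i + 1 := by linarith [hb i]
    have hp2 : 0 < β + i + 1 := by linarith [hb i]
    have g1 := gamma_asc (β + s + i + 1) hp1 (n - i)
    have g2 := gamma_asc (β + i + 1) hp2 (n - i)
    rw [Nat.cast_sub hi'] at g1 g2
    rw [show β + s + i + 1 + ((n : ℝ) - i) = n + β + s + 1 by ring] at g1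
    rw [show β + i + 1 + ((n : ℝ) - i) = n + β + 1 by ring] at g2
    have hn2 : 0 < Real.Gamma ((n : ℝ) + β + 1) :=
      Real.Gamma_pos_of_pos (by linarith [hb n])
    have hG2 := Real.Gamma_pos_of_pos hp2
    rw [g2] at hn2
    have hasc : (ascPochhammer ℝ (n - i)).eval (β + i + 1) ≠ 0 := by
      intro h0; rw [h0] at hn2; simp at hn2
    rw [g1, g2, Real.rpow_add hx1, Real.rpow_natCast, he, div_pow,
      show (n : ℝ) + (α - s) + (β + s) + 1 = n + α + β + 1 by ring]
    have := Nat.factorial_pos i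
    have := Nat.factorial_pos (n - i)
    field_simp
  · intro z hz
    unfold Iminus
    have hz1 : 0 < 1 + z := by linarith
    have hγ : ∀ i : ℕ, -1 < β + s + i := fun i => by linarith [hb i]
    have h1 : ∫ y in (-1 : ℝ)..z, (z - y) ^ ((k : ℝ) - s - 1) *
        ((1 + y) ^ (β + s) * jacobiP (α - s) (β + s) n y) =
        ∫ y in (-1 : ℝ)..z, ∑ i ∈ Finset.range (n + 1),
          e i * ((z - y) ^ ((k : ℝ) - s - 1) * (1 + y) ^ (β + s + i)) := by
      rw [intervalIntegral.integral_of_le hz.le, intervalIntegral.integral_of_le hz.le]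
      refine setIntegral_congr_fun measurableSet_Ioc fun y hy => ?_
      have hy1 : 0 < 1 + y := by linarith [hy.1]
      rw [jacobi_symm, Finset.mul_sum, Finset.mul_sum]
      refine Finset.sum_congr rfl fun i _ => ?_
      rw [Real.rpow_add hy1 (β + s) i, Real.rpow_natCast, he, div_pow]
      ring
    rw [h1, intervalIntegral.integral_finsetSum
      (fun i _ => (frac_intble _ _ _ hρ (hγ i) hz).const_mul _), Finset.mul_sum]
    refine Finset.sum_congr rfl fun i _ => ?_
    rw [intervalIntegral.integral_const_mul, frac_int _ _ _ hρ (hγ i) hz,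
      show β + s + i + ((k : ℝ) - s) = β + i + k by ring]
    have := Real.Gamma_pos_of_pos hρ
    field_simp
end

section
/- Let α > 0 and β ∈ ℝ with α + β > −1, and let l, n, n' ∈ ℕ with n ≥ l and n' ≥ l. Then ∫_{−1}^{1} D_+^{α+l}[^+J_n^{(−α,β)}](x) · D_+^{α+l}[^+J_{n'}^{(−α,β)}](x) · (1−x)^{l}(1+x)^{α+β+l} dx = h_{n,l}^{(α,β)} δ_{nn'}, where h_{n,l}^{(α,β)} = 2^{α+β+1} Γ(n+α+1)² Γ(n+α+β+l+1) / ((2n+α+β+1) · n! · (n−l)! · Γ(n+α+β+1)) and δ_{nn'} is the Kronecker delta. -/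
open MeasureTheory Filter Finset

/-- Right RL fractional derivative with the canonical `k = ⌊s⌋ + 1` (so `s ∈ [k-1,k)`
for any `s ≥ 0`). -/
noncomputable def DplusC (s : ℝ) (v : ℝ → ℝ) (x : ℝ) : ℝ :=
  Dplus s (⌊s⌋.toNat + 1) v x


lemma aux_beta (u v : ℝ) (hu : 0 < u) (hv : 0 < v) :
    IntervalIntegrable (fun t : ℝ => t ^ (u - 1) * (1 - t) ^ (v - 1)) volume 0 1 ∧
    ∫ t in (0:ℝ)..1, t ^ (u - 1) * (1 - t) ^ (v - 1)
      = Real.Gamma u * Real.Gamma v / Real.Gamma (u + v) := by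
  have hc := Complex.betaIntegral_convergent (u := (u : ℂ)) (v := (v : ℂ)) (by simpa) (by simpa)
  have hcongr : ∀ t ∈ Set.uIcc (0:ℝ) 1, (t : ℂ) ^ ((u : ℂ) - 1) * (1 - (t : ℂ)) ^ ((v : ℂ) - 1)
      = ((t ^ (u - 1) * (1 - t) ^ (v - 1) : ℝ) : ℂ) := by
    intro t ht
    rw [Set.uIcc_of_le zero_le_one] at ht
    push_cast
    rw [Complex.ofReal_cpow ht.1, Complex.ofReal_cpow (by linarith [ht.2])]
    push_cast
    rfl
  have hc2 : IntervalIntegrable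
      (fun t : ℝ => ((t ^ (u - 1) * (1 - t) ^ (v - 1) : ℝ) : ℂ)) volume 0 1 := by
    refine hc.congr ?_
    intro t ht
    exact hcongr t (Set.uIoc_subset_uIcc ht)
  constructor
  · exact ⟨by simpa [IntegrableOn] using hc2.1.re, by simp⟩
  · have h1 : Complex.betaIntegral u v
        = ((∫ t in (0:ℝ)..1, t ^ (u - 1) * (1 - t) ^ (v - 1) : ℝ) : ℂ) := by
      rw [Complex.betaIntegral, intervalIntegral.integral_congr hcongr,
        intervalIntegral.integral_ofReal]
    have h2 := ProbabilityTheory.beta_eq_betaIntegralReal u v hu hv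
    rw [h1, Complex.ofReal_re] at h2
    rw [← h2, ProbabilityTheory.beta]

lemma aux_gamma (a : ℝ) (ha : 0 < a) (j : ℕ) :
    Real.Gamma (a + j) = (ascPochhammer ℝ j).eval a * Real.Gamma a := by
  induction j with
  | zero => simp
  | succ j ih =>
    rw [ascPochhammer_succ_eval, Nat.cast_succ, ← add_assoc, Real.Gamma_add_one (by positivity), ih]
    ring

lemma aux_frac (ρ a x : ℝ) (hρ : 0 < ρ) (ha : -1 < a) (hx : x < 1) :
    IntervalIntegrable (fun y : ℝ => (y - x) ^ (ρ - 1) * (1 - y) ^ a) volume x 1 ∧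
    ∫ y in x..1, (y - x) ^ (ρ - 1) * (1 - y) ^ a
      = (1 - x) ^ (a + ρ) * (Real.Gamma ρ * Real.Gamma (a + 1) / Real.Gamma (a + 1 + ρ)) := by
  obtain ⟨h1, h2⟩ := aux_beta ρ (a + 1) hρ (by linarith)
  have hx0 : 0 < 1 - x := by linarith
  have key : ∀ t ∈ Set.uIcc (0:ℝ) 1,
      (((1 - x) * t + x) - x) ^ (ρ - 1) * (1 - ((1 - x) * t + x)) ^ a
        = (1 - x) ^ (a + ρ - 1) * (t ^ (ρ - 1) * (1 - t) ^ (a + 1 - 1)) := by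
    intro t ht
    rw [Set.uIcc_of_le zero_le_one] at ht
    rw [show (1 - x) * t + x - x = (1 - x) * t by ring,
      show 1 - ((1 - x) * t + x) = (1 - x) * (1 - t) by ring,
      Real.mul_rpow hx0.le ht.1, Real.mul_rpow hx0.le (by linarith [ht.2]),
      show a + ρ - 1 = (ρ - 1) + a by ring, Real.rpow_add hx0, add_sub_cancel_right]
    ring
  constructor
  · have h3 := (h1.const_mul ((1 - x) ^ (a + ρ - 1))).congr
      (fun t ht => (key t (Set.uIoc_subset_uIcc ht)).symm)
    have h4 := (h3.comp_mul_left (c := (1 - x)⁻¹)).comp_add_right (-x)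
    simp only [zero_div, one_div, inv_inv, sub_neg_eq_add, zero_add] at h4
    rw [sub_add_cancel] at h4
    refine h4.congr ?_
    intro y hy
    have : (1 - x) * ((1 - x)⁻¹ * (y + -x)) + x = y := by field_simp; ring
    simp only [this]
  · have h5 := intervalIntegral.integral_comp_mul_add (a := 0) (b := 1)
      (fun y : ℝ => (y - x) ^ (ρ - 1) * (1 - y) ^ a) hx0.ne' x
    rw [intervalIntegral.integral_congr key, intervalIntegral.integral_const_mul, h2] at h5
    simp only [mul_zero, zero_add, mul_one, sub_add_cancel, smul_eq_mul] at h5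
    rw [eq_inv_mul_iff_mul_eq₀ hx0.ne'] at h5
    rw [← h5, add_comm ρ (a+1), show a + ρ = (a + ρ - 1) + 1 by ring, Real.rpow_add_one hx0.ne']
    ring_nf

/-- finite difference of a low degree polynomial -/
lemma aux_fd (N : ℕ) (P : Polynomial ℝ) (hP : P.natDegree < N) :
    ∑ i ∈ Finset.range (N + 1), (-1 : ℝ) ^ i * (N.choose i) * P.eval (i : ℝ) = 0 := by
  have h := congrFun (Polynomial.fwdDiff_iter_eq_zero_of_degree_lt hP) 0
  rw [fwdDiff_iter_eq_sum_shift] at h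
  have h' : ∑ i ∈ Finset.range (N + 1), (-1 : ℝ) ^ i * (N.choose i) * P.eval (i : ℝ)
    = (-1) ^ N * ∑ k ∈ Finset.range (N + 1), ((-1 : ℤ) ^ (N - k) * (N.choose k : ℤ)) • P.eval (0 + k • (1:ℝ)) := by
    rw [Finset.mul_sum]
    refine Finset.sum_congr rfl fun i hi => ?_
    have hi : i ≤ N := by simpa [Nat.lt_succ_iff] using hi
    obtain ⟨d, rfl⟩ := Nat.exists_eq_add_of_le hi
    have : ((-1:ℝ) ^ d) * (-1) ^ d = 1 := by rw [← mul_pow]; simp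
    simp only [add_tsub_cancel_left, zsmul_eq_mul, nsmul_eq_mul, mul_one, zero_add]
    push_cast
    rw [pow_add]
    linear_combination (-(-1 : ℝ) ^ i * ((i + d).choose i) * P.eval (i : ℝ)) * this
  rw [h', h]
  simp

lemma aux_pochpos (n : ℕ) (a : ℝ) (ha : 0 < a) : (ascPochhammer ℝ n).eval a ≠ 0 :=
  (ascPochhammer_pos n a ha).ne'

lemma aux_pleft (n : ℕ) (a : ℝ) : (ascPochhammer ℝ (n+1)).eval a
    = a * (ascPochhammer ℝ n).eval (a + 1) := by
  rw [ascPochhammer_succ_left]; simp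

lemma aux_inv (N : ℕ) : ∀ (a : ℝ), 0 < a →
    ∑ i ∈ Finset.range (N + 1), (-1 : ℝ) ^ i * (N.choose i) * (1 / ((i : ℝ) + a))
      = (N.factorial : ℝ) / (ascPochhammer ℝ (N + 1)).eval a := by
  induction N with
  | zero => intro a ha; simp
  | succ N ih =>
    intro a ha
    have e : ∑ i ∈ Finset.range (N + 1 + 1),
        (-1 : ℝ) ^ i * ((N + 1).choose i) * (1 / ((i : ℝ) + a))
        = ∑ i ∈ Finset.range (N + 1), (-1 : ℝ) ^ i * (N.choose i) * (1 / ((i : ℝ) + a))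
        - ∑ i ∈ Finset.range (N + 1), (-1 : ℝ) ^ i * (N.choose i) * (1 / ((i : ℝ) + (a + 1))) := by
      rw [Finset.sum_range_succ' _ (N+1)]
      have e2 : ∑ i ∈ Finset.range (N + 1), (-1 : ℝ) ^ i * (N.choose i) * (1 / ((i : ℝ) + a))
        = ∑ i ∈ Finset.range (N + 1 + 1), (-1 : ℝ) ^ i * (N.choose i) * (1 / ((i : ℝ) + a)) := by
        rw [Finset.sum_range_succ _ (N+1)]; simp
      rw [e2, Finset.sum_range_succ' _ (N+1)]
      simp only [Nat.choose_succ_succ, Nat.choose_zero_right]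
      rw [add_sub_right_comm, ← Finset.sum_sub_distrib]
      congr 1
      refine Finset.sum_congr rfl fun i _ => ?_
      push_cast
      rw [pow_succ, add_right_comm, add_assoc (i:ℝ) a 1]
      ring
    rw [e, ih a ha, ih (a+1) (by linarith)]
    have h1 := aux_pochpos N (a+1) (by linarith)
    rw [aux_pleft (N+1) a, aux_pleft N a, ascPochhammer_succ_eval N (a+1), Nat.factorial_succ]
    have : a + 1 + N ≠ 0 := by positivity
    push_cast
    field_simp
    ring

lemma aux_rat (N : ℕ) (P : Polynomial ℝ) (hP : P.natDegree ≤ N) (a : ℝ) (ha : 0 < a) :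
    ∑ i ∈ Finset.range (N + 1), (-1 : ℝ) ^ i * (N.choose i) * (P.eval (i : ℝ) / ((i : ℝ) + a))
      = P.eval (-a) * ((N.factorial : ℝ) / (ascPochhammer ℝ (N + 1)).eval a) := by
  rcases Nat.eq_zero_or_pos N with rfl | hN
  · rw [Polynomial.eq_C_of_natDegree_le_zero hP]
    simp
    ring
  · set Q := P /ₘ (Polynomial.X - Polynomial.C (-a)) with hQ
    have hQd : Q.natDegree < N := by
      rw [hQ, Polynomial.natDegree_divByMonic _ (Polynomial.monic_X_sub_C _),
        Polynomial.natDegree_X_sub_C]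
      omega
    have hPQ : ∀ y, P.eval y = P.eval (-a) + (y + a) * Q.eval y := by
      intro y
      conv_lhs => rw [← Polynomial.modByMonic_add_div P (Polynomial.X - Polynomial.C (-a)),
        Polynomial.modByMonic_X_sub_C_eq_C_eval]
      simp [hQ]
    rw [← aux_inv N a ha, Finset.mul_sum, ← add_zero (∑ i ∈ Finset.range (N + 1), P.eval (-a) * _),
      ← aux_fd N Q hQd, ← Finset.sum_add_distrib]
    refine Finset.sum_congr rfl fun i _ => ?_
    have : (i : ℝ) + a ≠ 0 := by positivity
    rw [hPQ i]
    field_simp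

noncomputable def auxCoef (γ : ℝ) (l N i : ℕ) : ℝ :=
  (-1 : ℝ) ^ i * (ascPochhammer ℝ (i + l)).eval ((N : ℝ) + l + γ + 1) /
    (((i + l).factorial : ℝ) * ((N - i).factorial : ℝ) * (i.factorial : ℝ))

noncomputable def auxMom (γ : ℝ) (l N s : ℕ) : ℝ :=
  ∑ i ∈ Finset.range (N + 1), auxCoef γ l N i *
    (Real.Gamma ((i : ℝ) + s + l + 1) * Real.Gamma (γ + l + 1) /
      Real.Gamma ((i : ℝ) + s + l + 1 + (γ + l + 1)))

lemma aux_mom_eq (γ : ℝ) (hγ : -1 < γ) (l N s : ℕ) :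
    auxMom γ l N s = Real.Gamma (γ + l + 1) / (Real.Gamma ((N : ℝ) + l + γ + 1) * N.factorial) *
      ∑ i ∈ Finset.range (N + 1), (-1 : ℝ) ^ i * (N.choose i) *
        ((ascPochhammer ℝ s).eval ((i : ℝ) + ((l : ℝ) + 1)) *
          (Real.Gamma ((i : ℝ) + (N + γ + 2 * l + 1)) /
            Real.Gamma ((i : ℝ) + (s + γ + 2 * l + 2)))) := by
  rw [auxMom, Finset.mul_sum]
  refine Finset.sum_congr rfl fun i hi => ?_
  have hi : i ≤ N := by simpa [Nat.lt_succ_iff] using hi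
  have hN : (0:ℝ) < (N : ℝ) + l + γ + 1 := by
    have : (0:ℝ) ≤ (N : ℝ) + l := by positivity
    linarith
  have h1 := aux_gamma ((N : ℝ) + l + γ + 1) hN (i + l)
  have h2 := aux_gamma ((i : ℝ) + ((l : ℝ) + 1)) (by positivity) s
  have h3 : Real.Gamma ((i : ℝ) + ((l : ℝ) + 1)) = ((i + l).factorial : ℝ) := by
    rw [← Real.Gamma_nat_eq_factorial]; push_cast; ring_nf
  have h4 : ((N.choose i : ℕ) : ℝ) = N.factorial / (i.factorial * (N - i).factorial) :=
    Nat.cast_choose ℝ hi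
  have h5 := (Real.Gamma_pos_of_pos hN).ne'
  have e1 : (i : ℝ) + (N + γ + 2 * l + 1) = (N : ℝ) + l + γ + 1 + ((i + l : ℕ) : ℝ) := by
    push_cast; ring
  have e2 : (i : ℝ) + s + l + 1 = (i : ℝ) + ((l : ℝ) + 1) + s := by ring
  have e3 : (i : ℝ) + ((l : ℝ) + 1) + s + (γ + l + 1) = (i : ℝ) + (s + γ + 2 * l + 2) := by ring
  rw [e1, e2, e3, h1, h2, h3, h4, auxCoef]
  have f1 : ((i + l).factorial : ℝ) ≠ 0 := by positivity
  have f2 : (i.factorial : ℝ) ≠ 0 := by positivity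
  have f3 : ((N - i).factorial : ℝ) ≠ 0 := by positivity
  have f4 : (N.factorial : ℝ) ≠ 0 := by positivity
  field_simp

lemma aux_mom_lt (γ : ℝ) (hγ : -1 < γ) (l N s : ℕ) (hs : s < N) : auxMom γ l N s = 0 := by
  rw [aux_mom_eq γ hγ]
  obtain ⟨d, rfl⟩ := Nat.exists_eq_add_of_lt hs
  have h := aux_fd (s + d + 1) ((ascPochhammer ℝ s).comp (Polynomial.X + Polynomial.C ((l : ℝ) + 1)) *
    (ascPochhammer ℝ d).comp (Polynomial.X + Polynomial.C ((s : ℝ) + γ + 2 * l + 2))) (by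
      refine lt_of_le_of_lt Polynomial.natDegree_mul_le ?_
      rw [Polynomial.natDegree_comp, Polynomial.natDegree_comp, ascPochhammer_natDegree,
        ascPochhammer_natDegree, Polynomial.natDegree_X_add_C, Polynomial.natDegree_X_add_C]
      omega)
  convert mul_zero _
  rw [← h]
  refine Finset.sum_congr rfl fun i hi => ?_
  have hp : (0:ℝ) < (i : ℝ) + (s + γ + 2 * l + 2) := by
    have : (0:ℝ) ≤ (i : ℝ) + s + 2 * l := by positivity
    linarith
  have e : (i : ℝ) + (((s + d + 1 : ℕ) : ℝ) + γ + 2 * l + 1)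
    = (i : ℝ) + (s + γ + 2 * l + 2) + (d : ℝ) := by push_cast; ring
  rw [e, aux_gamma _ hp d]
  have := (Real.Gamma_pos_of_pos hp).ne'
  simp only [Polynomial.eval_mul, Polynomial.eval_comp, Polynomial.eval_add, Polynomial.eval_X,
    Polynomial.eval_C]
  rw [mul_div_cancel_right₀ _ this]

lemma aux_refl (N : ℕ) (c : ℝ) :
    (ascPochhammer ℝ N).eval (1 - N - c) = (-1) ^ N * (ascPochhammer ℝ N).eval c := by
  have h1 := ascPochhammer_eval_neg_eq_descPochhammer ℝ (c + N - 1) N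
  have h2 := descPochhammer_eval_eq_ascPochhammer ℝ (c + N - 1) N
  rw [show (1 : ℝ) - N - c = -(c + N - 1) by ring, h1, h2]
  congr 2
  ring

lemma aux_mom_eq_self (γ : ℝ) (hγ : -1 < γ) (l N : ℕ) :
    auxMom γ l N N = (-1) ^ N * Real.Gamma ((N : ℝ) + γ + 2 * l + 1) /
      Real.Gamma (2 * (N : ℝ) + γ + 2 * l + 2) := by
  rw [aux_mom_eq γ hγ]
  set a : ℝ := N + γ + 2 * l + 1 with ha
  have ha0 : 0 < a := by
    have : (0:ℝ) ≤ (N : ℝ) + 2 * l := by positivity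
    rw [ha]; linarith
  have hc0 : 0 < γ + l + 1 := by
    have : (0:ℝ) ≤ (l : ℝ) := by positivity
    linarith
  have h := aux_rat N ((ascPochhammer ℝ N).comp (Polynomial.X + Polynomial.C ((l : ℝ) + 1))) (by
      rw [Polynomial.natDegree_comp, ascPochhammer_natDegree, Polynomial.natDegree_X_add_C]
      omega) a ha0
  have hs : ∑ i ∈ Finset.range (N + 1), (-1 : ℝ) ^ i * (N.choose i) *
        ((ascPochhammer ℝ N).eval ((i : ℝ) + ((l : ℝ) + 1)) *
          (Real.Gamma ((i : ℝ) + a) / Real.Gamma ((i : ℝ) + (N + γ + 2 * l + 2))))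
      = ∑ i ∈ Finset.range (N + 1), (-1 : ℝ) ^ i * (N.choose i) *
        (((ascPochhammer ℝ N).comp (Polynomial.X + Polynomial.C ((l : ℝ) + 1))).eval (i : ℝ)
          / ((i : ℝ) + a)) := by
    refine Finset.sum_congr rfl fun i hi => ?_
    have hp : 0 < (i : ℝ) + a := by positivity
    rw [show (i : ℝ) + (N + γ + 2 * l + 2) = (i : ℝ) + a + 1 by rw [ha]; ring,
      Real.Gamma_add_one hp.ne']
    have := (Real.Gamma_pos_of_pos hp).ne'
    simp only [Polynomial.eval_comp, Polynomial.eval_add, Polynomial.eval_X, Polynomial.eval_C]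
    field_simp
  rw [hs, h]
  simp only [Polynomial.eval_comp, Polynomial.eval_add, Polynomial.eval_X, Polynomial.eval_C]
  rw [show -a + ((l : ℝ) + 1) = 1 - N - (γ + l + 1) by rw [ha]; ring, aux_refl]
  have g1 := aux_gamma (γ + l + 1) hc0 N
  have g2 := aux_gamma a ha0 (N + 1)
  rw [show (N : ℝ) + l + γ + 1 = γ + l + 1 + N by ring, g1,
    show 2 * (N : ℝ) + γ + 2 * l + 2 = a + ((N + 1 : ℕ) : ℝ) by rw [ha]; push_cast; ring, g2]
  have p1 := (Real.Gamma_pos_of_pos hc0).ne'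
  have p2 := (Real.Gamma_pos_of_pos ha0).ne'
  have p3 := aux_pochpos N _ hc0
  have p4 := aux_pochpos (N + 1) _ ha0
  have f4 : (N.factorial : ℝ) ≠ 0 := by positivity
  field_simp

noncomputable def auxQ (γ : ℝ) (l N : ℕ) (t : ℝ) : ℝ :=
  ∑ i ∈ Finset.range (N + 1), auxCoef γ l N i * t ^ i

lemma aux_term (γ : ℝ) (hγ : -1 < γ) (l i s : ℕ) :
    IntervalIntegrable (fun t : ℝ => t ^ i * t ^ s * (t ^ (l : ℝ) * (1 - t) ^ (γ + l))) volume 0 1 ∧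
    ∫ t in (0:ℝ)..1, t ^ i * t ^ s * (t ^ (l : ℝ) * (1 - t) ^ (γ + l)) =
    Real.Gamma ((i : ℝ) + s + l + 1) * Real.Gamma (γ + l + 1) /
      Real.Gamma ((i : ℝ) + s + l + 1 + (γ + l + 1)) := by
  have hc0 : 0 < γ + l + 1 := by
    have : (0:ℝ) ≤ (l : ℝ) := by positivity
    linarith
  have h := aux_beta ((i : ℝ) + s + l + 1) (γ + l + 1) (by positivity) hc0
  have e : (fun t : ℝ => t ^ ((i : ℝ) + s + l + 1 - 1) * (1 - t) ^ (γ + l + 1 - 1))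
      = fun t : ℝ => t ^ i * t ^ s * (t ^ (l : ℝ) * (1 - t) ^ (γ + l)) := by
    funext t
    rw [add_sub_cancel_right, add_sub_cancel_right,
      show (i : ℝ) + s + l = ((i + s + l : ℕ) : ℝ) by push_cast; ring, Real.rpow_natCast,
      Real.rpow_natCast]
    ring
  rw [e] at h
  exact h

lemma aux_prod_le (γ : ℝ) (hγ : -1 < γ) (l N N' : ℕ) (hN : N' ≤ N) :
    ∫ t in (0:ℝ)..1, auxQ γ l N t * auxQ γ l N' t * (t ^ (l : ℝ) * (1 - t) ^ (γ + l)) =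
      if N = N' then Real.Gamma ((N : ℝ) + γ + 2 * l + 1) /
        ((2 * ((N : ℝ) + l) + γ + 1) * Real.Gamma ((N : ℝ) + l + γ + 1) * (N + l).factorial
          * N.factorial) else 0 := by
  have h1 : ∫ t in (0:ℝ)..1, auxQ γ l N t * auxQ γ l N' t * (t ^ (l : ℝ) * (1 - t) ^ (γ + l)) =
      ∑ s ∈ Finset.range (N' + 1), auxCoef γ l N' s * auxMom γ l N s := by
    have e : (fun t : ℝ => auxQ γ l N t * auxQ γ l N' t * (t ^ (l : ℝ) * (1 - t) ^ (γ + l))) =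
      fun t => ∑ s ∈ Finset.range (N' + 1), ∑ i ∈ Finset.range (N + 1),
        (auxCoef γ l N' s * auxCoef γ l N i) *
          (t ^ i * t ^ s * (t ^ (l : ℝ) * (1 - t) ^ (γ + l))) := by
      funext t
      rw [auxQ, auxQ, Finset.sum_mul_sum, Finset.sum_comm, Finset.sum_mul]
      refine Finset.sum_congr rfl fun s _ => ?_
      rw [Finset.sum_mul]
      refine Finset.sum_congr rfl fun i _ => ?_
      ring
    have hint : ∀ s i : ℕ, IntervalIntegrable (fun t : ℝ => (auxCoef γ l N' s * auxCoef γ l N i) *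
          (t ^ i * t ^ s * (t ^ (l : ℝ) * (1 - t) ^ (γ + l)))) volume 0 1 :=
      fun s i => (aux_term γ hγ l i s).1.const_mul _
    rw [e, intervalIntegral.integral_finsetSum (fun s _ => by
      have := IntervalIntegrable.sum (Finset.range (N + 1)) (fun i _ => hint s i)
      exact this.congr (fun t _ => by simp))]
    refine Finset.sum_congr rfl fun s _ => ?_
    rw [intervalIntegral.integral_finsetSum (fun i _ => hint s i), auxMom, Finset.mul_sum]
    refine Finset.sum_congr rfl fun i _ => ?_
    rw [intervalIntegral.integral_const_mul, (aux_term γ hγ l i s).2]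
    ring
  rw [h1]
  split_ifs with h
  · subst h
    rw [Finset.sum_range_succ, Finset.sum_eq_zero, zero_add, aux_mom_eq_self γ hγ, auxCoef]
    · have hp : (0:ℝ) < (N : ℝ) + l + γ + 1 := by
        have : (0:ℝ) ≤ (N : ℝ) + l := by positivity
        linarith
      have hp2 : (0:ℝ) < 2 * ((N : ℝ) + l) + γ + 1 := by
        have : (0:ℝ) ≤ (N : ℝ) + l := by positivity
        linarith
      have g1 := aux_gamma _ hp (N + l)
      rw [show (N : ℝ) + l + γ + 1 + ((N + l : ℕ) : ℝ) = 2 * ((N : ℝ) + l) + γ + 1 by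
        push_cast; ring] at g1
      rw [show 2 * (N : ℝ) + γ + 2 * l + 2 = 2 * ((N : ℝ) + l) + γ + 1 + 1 by ring,
        Real.Gamma_add_one hp2.ne', g1]
      have p1 := (Real.Gamma_pos_of_pos hp).ne'
      have p2 := aux_pochpos (N + l) _ hp
      have f1 : ((N + l).factorial : ℝ) ≠ 0 := by positivity
      have f4 : (N.factorial : ℝ) ≠ 0 := by positivity
      have q : ((-1 : ℝ) ^ N) * (-1) ^ N = 1 := by rw [← mul_pow]; simp
      generalize Real.Gamma ((N : ℝ) + γ + 2 * l + 1) = K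
      simp only [Nat.sub_self, Nat.factorial_zero, Nat.cast_one, mul_one]
      field_simp
      linear_combination (K * (2 * ((N : ℝ) + l) + γ + 1)⁻¹) * q
    · intro s hs
      rw [aux_mom_lt γ hγ l N s (by simpa using hs), mul_zero]
  · refine Finset.sum_eq_zero fun s hs => ?_
    have : s < N' + 1 := by simpa using hs
    rw [aux_mom_lt γ hγ l N s (by omega), mul_zero]

lemma aux_prod (γ : ℝ) (hγ : -1 < γ) (l N N' : ℕ) :
    ∫ t in (0:ℝ)..1, auxQ γ l N t * auxQ γ l N' t * (t ^ (l : ℝ) * (1 - t) ^ (γ + l)) =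
      if N = N' then Real.Gamma ((N : ℝ) + γ + 2 * l + 1) /
        ((2 * ((N : ℝ) + l) + γ + 1) * Real.Gamma ((N : ℝ) + l + γ + 1) * (N + l).factorial
          * N.factorial) else 0 := by
  rcases le_total N' N with h | h
  · exact aux_prod_le γ hγ l N N' h
  · have := aux_prod_le γ hγ l N' N h
    simp only [mul_comm (auxQ γ l N' _)] at this
    rw [this]
    by_cases hh : N = N'
    · subst hh; rfl
    · rw [if_neg hh, if_neg (Ne.symm hh)]

lemma aux_Iplus (α β : ℝ) (hα : 0 < α) (n m : ℕ) (hm : α < m) (x : ℝ) (hx : x < 1) :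
    Iplus ((m : ℝ) - α) (fun y => (1 - y) ^ α * jacobiP α β n y) x =
      ∑ j ∈ Finset.range (n + 1),
        (((ascPochhammer ℝ j).eval ((n : ℝ) + α + β + 1) / (Nat.factorial j : ℝ)) *
          (Real.Gamma ((n : ℝ) + α + 1) / (Nat.factorial (n - j) : ℝ)) * (-1 / 2) ^ j
            / ((m + j).factorial : ℝ)) * (1 - x) ^ (m + j) := by
  have hρ : 0 < (m : ℝ) - α := by linarith
  set c : ℕ → ℝ := fun j => ((ascPochhammer ℝ j).eval ((n : ℝ) + α + β + 1) / (Nat.factorial j : ℝ)) *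
      ((ascPochhammer ℝ (n - j)).eval (α + (j : ℝ) + 1) / (Nat.factorial (n - j) : ℝ)) *
      (-1 / 2) ^ j with hc
  have hfr := fun j : ℕ => aux_frac ((m : ℝ) - α) (α + j) x hρ
    (by have : (0:ℝ) ≤ j := by positivity
        linarith) hx
  have e : ∀ y ∈ Set.uIcc x 1, (y - x) ^ ((m : ℝ) - α - 1) * ((1 - y) ^ α * jacobiP α β n y)
      = ∑ j ∈ Finset.range (n + 1), c j * ((y - x) ^ ((m : ℝ) - α - 1) * (1 - y) ^ (α + j)) := by
    intro y hy
    rw [Set.uIcc_of_le hx.le] at hy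
    have hy0 : 0 ≤ 1 - y := by linarith [hy.2]
    rw [jacobiP, Finset.mul_sum, Finset.mul_sum]
    refine Finset.sum_congr rfl fun j _ => ?_
    rw [Real.rpow_add_natCast' hy0 (by positivity), hc,
      show (y - 1) / 2 = (-1 / 2) * (1 - y) by ring, mul_pow]
    ring
  rw [Iplus, intervalIntegral.integral_congr e,
    intervalIntegral.integral_finsetSum (fun j _ => (hfr j).1.const_mul _), Finset.mul_sum]
  refine Finset.sum_congr rfl fun j hj => ?_
  have hj : j ≤ n := by simpa [Nat.lt_succ_iff] using hj
  rw [intervalIntegral.integral_const_mul, (hfr j).2]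
  rw [show α + (j : ℝ) + ((m : ℝ) - α) = ((m + j : ℕ) : ℝ) by push_cast; ring, Real.rpow_natCast,
    show α + (j : ℝ) + 1 + ((m : ℝ) - α) = ((m + j : ℕ) : ℝ) + 1 by push_cast; ring,
    Real.Gamma_nat_eq_factorial]
  have hp : 0 < α + (j : ℝ) + 1 := by positivity
  have g := aux_gamma _ hp (n - j)
  rw [show α + (j : ℝ) + 1 + ((n - j : ℕ) : ℝ) = (n : ℝ) + α + 1 by
    rw [Nat.cast_sub hj]; ring] at g
  have p1 := (Real.Gamma_pos_of_pos hρ).ne'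
  rw [g, hc]
  field_simp

lemma aux_Dplus (α β : ℝ) (hα : 0 < α) (l N m : ℕ) (hm : α < m) (x : ℝ) (hx : x < 1) :
    Dplus (α + l) (m + l) (fun y => (1 - y) ^ α * jacobiP α β (N + l) y) x =
      Real.Gamma (((N + l : ℕ) : ℝ) + α + 1) * (-1 / 2) ^ l * auxQ (α + β) l N ((1 - x) / 2) := by
  rw [Dplus, show ((m + l : ℕ) : ℝ) - (α + l) = (m : ℝ) - α by push_cast; ring]
  have hev : Iplus ((m : ℝ) - α) (fun y => (1 - y) ^ α * jacobiP α β (N + l) y) =ᶠ[nhds x] _ :=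
    Filter.eventually_of_mem (Iio_mem_nhds hx)
      (fun y hy => aux_Iplus α β hα (N + l) m hm y hy)
  rw [hev.iteratedDeriv_eq, iteratedDeriv_fun_sum (fun j _ => by fun_prop), Finset.mul_sum]
  have hd : ∀ (c : ℝ) (j : ℕ), (-1 : ℝ) ^ (m + l) *
      iteratedDeriv (m + l) (fun z : ℝ => c * (1 - z) ^ (m + j)) x
      = c * (((m + j).descFactorial (m + l) : ℝ) * (1 - x) ^ (m + j - (m + l))) := by
    intro c j
    rw [iteratedDeriv_const_mul_field,
      iteratedDeriv_comp_const_sub (m + l) (fun z : ℝ => z ^ (m + j)) 1]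
    simp only [iteratedDeriv_pow, smul_eq_mul]
    have q : ((-1 : ℝ) ^ (m + l)) * (-1) ^ (m + l) = 1 := by rw [← mul_pow]; simp
    linear_combination (c * (((m + j).descFactorial (m + l) : ℝ) * (1 - x) ^ (m + j - (m + l)))) * q
  simp only [hd]
  rw [show N + l + 1 = l + (N + 1) by ring, Finset.sum_range_add, Finset.sum_eq_zero, zero_add,
    auxQ, Finset.mul_sum]
  · refine Finset.sum_congr rfl fun i hi => ?_
    have hi : i ≤ N := by simpa [Nat.lt_succ_iff] using hi
    have hf : (i.factorial : ℝ) * ((m + (l + i)).descFactorial (m + l) : ℝ)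
        = ((m + (l + i)).factorial : ℝ) := by
      have := Nat.factorial_mul_descFactorial (n := m + (l + i)) (k := m + l) (by omega)
      rw [show m + (l + i) - (m + l) = i by omega] at this
      exact_mod_cast this
    rw [auxCoef, show m + (l + i) - (m + l) = i by omega, ← hf,
      show N + l - (l + i) = N - i by omega, add_comm l i]
    have f1 : ((i + l).factorial : ℝ) ≠ 0 := by positivity
    have f2 : (i.factorial : ℝ) ≠ 0 := by positivity
    have f3 : ((N - i).factorial : ℝ) ≠ 0 := by positivity
    have f4 : ((m + (i + l)).descFactorial (m + l) : ℝ) ≠ 0 := by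
      have : (m + (i + l)).descFactorial (m + l) ≠ 0 := by
        rw [Ne, Nat.descFactorial_eq_zero_iff_lt]; omega
      exact_mod_cast this
    rw [show ((N + l : ℕ) : ℝ) + α + β + 1 = (N : ℝ) + l + (α + β) + 1 by push_cast; ring,
      pow_add, show (-1 / 2 : ℝ) ^ i = (-1) ^ i * (1 / 2) ^ i by rw [← mul_pow]; norm_num,
      show (1 - x) / 2 = (1 / 2) * (1 - x) by ring, mul_pow]
    field_simp
  · intro j hj
    have hj : j < l := by simpa using hj
    have : (m + j).descFactorial (m + l) = 0 := by
      rw [Nat.descFactorial_eq_zero_iff_lt]; omega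
    rw [this]
    simp

lemma aux_DplusC (α β : ℝ) (hα : 0 < α) (l N : ℕ) (x : ℝ) (hx : x < 1) :
    DplusC (α + l) (fun y => (1 - y) ^ α * jacobiP α β (N + l) y) x =
      Real.Gamma (((N + l : ℕ) : ℝ) + α + 1) * (-1 / 2) ^ l * auxQ (α + β) l N ((1 - x) / 2) := by
  have h0 : 0 ≤ ⌊α⌋ := Int.floor_nonneg.mpr hα.le
  have hk : ⌊α + (l : ℝ)⌋.toNat + 1 = (⌊α⌋.toNat + 1) + l := by
    rw [Int.floor_add_natCast]; omega
  rw [DplusC, hk]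
  refine aux_Dplus α β hα l N _ ?_ x hx
  have h1 : ((⌊α⌋.toNat : ℤ) : ℝ) = (⌊α⌋ : ℝ) := by rw [Int.toNat_of_nonneg h0]
  have h2 := Int.lt_floor_add_one α
  push_cast at h1 ⊢
  rw [h1]; exact h2

/-- orthogonality (4.16)-(4.17) of fractional derivatives of GJFs. -/
theorem stmt12 (α β : ℝ) (hα : 0 < α) (hab : -1 < α + β) (l n n' : ℕ)
    (hn : l ≤ n) (hn' : l ≤ n') :
    ∫ x in (-1 : ℝ)..1,
        DplusC (α + (l : ℝ)) (fun y => (1 - y) ^ α * jacobiP α β n y) x *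
          DplusC (α + (l : ℝ)) (fun y => (1 - y) ^ α * jacobiP α β n' y) x *
          ((1 - x) ^ (l : ℝ) * (1 + x) ^ (α + β + (l : ℝ))) =
      (2 : ℝ) ^ (α + β + 1) * Real.Gamma ((n : ℝ) + α + 1) ^ 2 *
          Real.Gamma ((n : ℝ) + α + β + (l : ℝ) + 1) /
          ((2 * (n : ℝ) + α + β + 1) * (Nat.factorial n : ℝ) * (Nat.factorial (n - l) : ℝ) *
            Real.Gamma ((n : ℝ) + α + β + 1)) *
        (if n = n' then 1 else 0) := by

  obtain ⟨N, rfl⟩ := Nat.exists_eq_add_of_le' hn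
  obtain ⟨N', rfl⟩ := Nat.exists_eq_add_of_le' hn'
  set γ := α + β with hγ
  set G : ℝ := Real.Gamma (((N + l : ℕ) : ℝ) + α + 1) with hG
  set G' : ℝ := Real.Gamma (((N' + l : ℕ) : ℝ) + α + 1) with hG'
  set F : ℝ → ℝ := fun t => auxQ γ l N t * auxQ γ l N' t * (t ^ (l : ℝ) * (1 - t) ^ (γ + l)) with hF
  have hq : ((-1 / 2 : ℝ) ^ l) * (-1 / 2) ^ l * (2 ^ (l : ℝ) * 2 ^ (γ + l)) = 2 ^ γ := by
    rw [Real.rpow_add (by norm_num), Real.rpow_natCast]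
    have : ((-1 / 2 : ℝ) ^ l) * (-1 / 2) ^ l * (2 ^ l * 2 ^ l) = 1 := by
      rw [← mul_pow, ← mul_pow, ← mul_pow]; norm_num
    linear_combination (2 : ℝ) ^ γ * this
  have h1 : ∫ x in (-1 : ℝ)..1,
        DplusC (α + (l : ℝ)) (fun y => (1 - y) ^ α * jacobiP α β (N + l) y) x *
          DplusC (α + (l : ℝ)) (fun y => (1 - y) ^ α * jacobiP α β (N' + l) y) x *
          ((1 - x) ^ (l : ℝ) * (1 + x) ^ (γ + (l : ℝ)))
      = ∫ x in (-1 : ℝ)..1, (G * G' * 2 ^ γ) * F (1 / 2 - (1 / 2) * x) := by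
    rw [intervalIntegral.integral_of_le (by norm_num), intervalIntegral.integral_of_le (by norm_num),
      integral_Ioc_eq_integral_Ioo, integral_Ioc_eq_integral_Ioo]
    refine setIntegral_congr_fun measurableSet_Ioo fun x hx => ?_
    rw [aux_DplusC α β hα l N x hx.2, aux_DplusC α β hα l N' x hx.2, hF,
      show 1 / 2 - (1 / 2) * x = (1 - x) / 2 by ring]
    have hx1 : 0 ≤ (1 - x) / 2 := by linarith [hx.2]
    have hx2 : 0 ≤ 1 - (1 - x) / 2 := by linarith [hx.1]
    have e1 : (1 - x) ^ (l : ℝ) = 2 ^ (l : ℝ) * ((1 - x) / 2) ^ (l : ℝ) := by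
      rw [← Real.mul_rpow (by norm_num) hx1]; congr 1; ring
    have e2 : (1 + x) ^ (γ + (l : ℝ)) = 2 ^ (γ + (l : ℝ)) * (1 - (1 - x) / 2) ^ (γ + (l : ℝ)) := by
      rw [← Real.mul_rpow (by norm_num) hx2]; congr 1; ring
    rw [e1, e2, ← hq]
    ring
  rw [h1, intervalIntegral.integral_const_mul,
    intervalIntegral.integral_comp_sub_mul F (by norm_num : (1 / 2 : ℝ) ≠ 0)]
  norm_num only
  rw [hF, aux_prod γ hab l N N']
  by_cases h : N = N'
  · subst h
    rw [if_pos rfl, if_pos rfl, Real.rpow_add_one (by norm_num), Nat.add_sub_cancel, show G' = G from rfl, smul_eq_mul,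
      show ((N + l : ℕ) : ℝ) + α + β + l + 1 = (N : ℝ) + γ + 2 * l + 1 by
        rw [hγ]; push_cast; ring,
      show ((N + l : ℕ) : ℝ) + α + β + 1 = (N : ℝ) + l + γ + 1 by rw [hγ]; push_cast; ring,
      show 2 * ((N + l : ℕ) : ℝ) + α + β + 1 = 2 * ((N : ℝ) + l) + γ + 1 by
        rw [hγ]; push_cast; ring]
    ring
  · rw [if_neg h, if_neg (by omega)]
    simp
end

section
/- Let α > 0 and β > −1, and let l, m, N ∈ ℕ with 0 ≤ l ≤ m ≤ N and N ≥ 1. Let u ∈ L²_{ω^{(−α,β)}}(Λ) with generalized Jacobi coefficients û_n = (1/γ_n^{(α,β)}) ∫_{−1}^{1} u(x) ^+J_n^{(−α,β)}(x) ω^{(−α,β)}(x) dx, and set π_N u = Σ_{n=0}^{N} û_n ^+J_n^{(−α,β)}. Assume that for j = l and j = m the fractional derivative D_+^{α+j} u belongs to L²_{ω^{(j,α+β+j)}}(Λ) and equals the term-by-term differentiated series Σ_{n≥j} û_n D_+^{α+j}[^+J_n^{(−α,β)}], converging in L²_{ω^{(j,α+β+j)}}(Λ). Then ‖D_+^{α+l}(π_N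 u − u)‖_{ω^{(l,α+β+l)}} ≤ N^{(l−m)/2} · √((N−m+1)!/(N−l+1)!) · ‖D_+^{α+m} u‖_{ω^{(m,α+β+m)}}. -/
open MeasureTheory Filter Finset

/-- Normalization constant γ_n^{(a,b)}. -/
noncomputable def gammaJ (a b : ℝ) (n : ℕ) : ℝ :=
  (2 : ℝ) ^ (a + b + 1) * Real.Gamma ((n : ℝ) + a + 1) * Real.Gamma ((n : ℝ) + b + 1) /
    ((2 * (n : ℝ) + a + b + 1) * (Nat.factorial n : ℝ) * Real.Gamma ((n : ℝ) + a + b + 1))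


noncomputable def jd (a b : ℝ) (n i : ℕ) : ℝ :=
  if i ≤ n then ((ascPochhammer ℝ i).eval ((n : ℝ) + a + b + 1) / (Nat.factorial i : ℝ)) *
      ((ascPochhammer ℝ (n - i)).eval (a + (i : ℝ) + 1) / (Nat.factorial (n - i) : ℝ)) / 2 ^ i
  else 0

noncomputable def jq (a b : ℝ) (n : ℕ) : Polynomial ℝ :=
  ∑ i ∈ Finset.range (n + 1), Polynomial.monomial i (jd a b n i)

noncomputable def jp (a b : ℝ) (n : ℕ) : Polynomial ℝ :=
  (jq a b n).comp (Polynomial.X - Polynomial.C 1)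

lemma jq_coeff (a b : ℝ) (n i : ℕ) : (jq a b n).coeff i = jd a b n i := by
  unfold jq
  rw [Polynomial.finsetSum_coeff]
  simp only [Polynomial.coeff_monomial]
  rw [Finset.sum_ite_eq']
  split_ifs with h
  · rfl
  · simp at h
    rw [jd, if_neg (by omega)]

lemma jp_eval (a b : ℝ) (n : ℕ) (x : ℝ) : (jp a b n).eval x = jacobiP a b n x := by
  unfold jp jq jacobiP
  rw [Polynomial.eval_comp, Polynomial.eval_finsetSum]
  apply Finset.sum_congr rfl
  intro i hi
  have : i ≤ n := by simp at hi; omega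
  simp [jd, this, div_pow]
  ring

lemma jp_eval_sum (a b : ℝ) (n : ℕ) (x : ℝ) : (jp a b n).eval x =
    ∑ i ∈ Finset.range (n + 1), jd a b n i * (x - 1) ^ i := by
  unfold jp jq
  rw [Polynomial.eval_comp, Polynomial.eval_finsetSum]
  simp

lemma jd_rec (a b : ℝ) (ha : -1 < a) (n i : ℕ) :
    jd a b n (i + 1) * (2 * ((i : ℝ) + 1) * (i + a + 1)) =
      ((n : ℝ) - i) * (n + i + a + b + 1) * jd a b n i := by
  rcases lt_trichotomy i n with h | h | h
  · obtain ⟨k, rfl⟩ : ∃ k, n = i + 1 + k := ⟨n - (i + 1), by omega⟩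
    rw [jd, if_pos (by omega), jd, if_pos (by omega)]
    rw [show i + 1 + k - (i + 1) = k by omega, show i + 1 + k - i = k + 1 by omega]
    rw [ascPochhammer_succ_left ℝ k, ascPochhammer_succ_eval (n := i)]
    rw [Polynomial.eval_mul, Polynomial.eval_X, Polynomial.eval_comp]
    simp only [Polynomial.eval_add, Polynomial.eval_X, Polynomial.eval_one]
    have e : a + ((i + 1 : ℕ) : ℝ) + 1 = a + i + 1 + 1 := by push_cast; ring
    rw [e, Nat.factorial_succ, Nat.factorial_succ]
    have : (0:ℝ) < a + i + 1 := by have : (0:ℝ) ≤ i := by positivity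
                                   linarith
    push_cast
    field_simp
    ring
  · subst h
    rw [jd, if_neg (by omega)]; ring
  · rw [jd, if_neg (by omega), jd, if_neg (by omega)]; ring

/-- Sturm–Liouville equation for polynomials. -/
def SL (a b lam : ℝ) (p : Polynomial ℝ) : Prop :=
  ∀ x : ℝ, (1 - x ^ 2) * p.derivative.derivative.eval x +
    (b - a - (a + b + 2) * x) * p.derivative.eval x + lam * p.eval x = 0

lemma SL.deriv {a b lam : ℝ} {p : Polynomial ℝ} (h : SL a b lam p) :
    SL (a + 1) (b + 1) (lam - (a + b + 2)) p.derivative := by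
  have hp : (1 - Polynomial.X ^ 2) * p.derivative.derivative +
    (Polynomial.C (b - a) - Polynomial.C (a + b + 2) * Polynomial.X) * p.derivative
      + Polynomial.C lam * p = 0 := by
    apply Polynomial.funext
    intro x
    have := h x
    simpa using this
  intro x
  have h2 := congrArg (fun q : Polynomial ℝ => q.derivative.eval x) hp
  simp at h2
  linear_combination h2

lemma SL_jp (a b : ℝ) (ha : -1 < a) (n : ℕ) :
    SL a b ((n : ℝ) * (n + a + b + 1)) (jp a b n) := by
  have hq : Polynomial.C (-1) * (Polynomial.X * (Polynomial.X * (jq a b n).derivative.derivative))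
      - Polynomial.C 2 * (Polynomial.X * (jq a b n).derivative.derivative)
      - Polynomial.C (2 * (a + 1)) * (jq a b n).derivative
      - Polynomial.C (a + b + 2) * (Polynomial.X * (jq a b n).derivative)
      + Polynomial.C ((n : ℝ) * (n + a + b + 1)) * jq a b n = 0 := by
    ext i
    have r := jd_rec a b ha n i
    rw [Polynomial.coeff_add, Polynomial.coeff_sub, Polynomial.coeff_sub, Polynomial.coeff_sub]
    simp only [Polynomial.coeff_C_mul]
    rcases i with _ | _ | i
    · simp [Polynomial.coeff_derivative, jq_coeff] at r ⊢
      linear_combination -r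
    · simp [Polynomial.coeff_derivative, jq_coeff] at r ⊢
      linear_combination -r
    · simp only [Polynomial.coeff_derivative, jq_coeff, Polynomial.coeff_X_mul, Polynomial.coeff_zero] at r ⊢
      push_cast at r ⊢
      linear_combination -r
  intro x
  have h2 := congrArg (fun q : Polynomial ℝ => q.eval (x - 1)) hq
  simp [jp, Polynomial.derivative_comp] at h2 ⊢
  linear_combination h2

lemma SL_iter {a b lam : ℝ} {p : Polynomial ℝ} (h : SL a b lam p) (j : ℕ) :
    SL (a + j) (b + j) (lam - j * (a + b + 1 + j)) (Polynomial.derivative^[j] p) := by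
  induction j with
  | zero => simpa using h
  | succ j ih =>
    rw [Function.iterate_succ_apply']
    have := ih.deriv
    convert this using 1 <;> push_cast <;> ring

/-- eigenvalue -/
noncomputable def lamJ (c : ℝ) (n j : ℕ) : ℝ := ((n : ℝ) - j) * (n + j + c + 1)

lemma SL_jp_iter (a b : ℝ) (ha : -1 < a) (n j : ℕ) :
    SL (a + j) (b + j) (lamJ (a + b) n j) (Polynomial.derivative^[j] (jp a b n)) := by
  have := SL_iter (SL_jp a b ha n) j
  convert this using 1
  unfold lamJ
  ring

lemma jq_natDegree_le (a b : ℝ) (n : ℕ) : (jq a b n).natDegree ≤ n := by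
  rw [Polynomial.natDegree_le_iff_coeff_eq_zero]
  intro i hi
  rw [jq_coeff, jd, if_neg (by omega)]

lemma jp_natDegree_le (a b : ℝ) (n : ℕ) : (jp a b n).natDegree ≤ n := by
  unfold jp
  rw [Polynomial.natDegree_comp, Polynomial.natDegree_X_sub_C, mul_one]
  exact jq_natDegree_le a b n

lemma jp_iter_self (a b : ℝ) (n : ℕ) (x : ℝ) : (Polynomial.derivative^[n] (jp a b n)).eval x =
    (ascPochhammer ℝ n).eval ((n : ℝ) + a + b + 1) / 2 ^ n := by
  have h0 : jp a b n = ∑ i ∈ Finset.range (n + 1),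
      Polynomial.C (jd a b n i) * (Polynomial.X - Polynomial.C 1) ^ i := by
    unfold jp jq
    rw [← Polynomial.coe_compRingHom_apply, map_sum]
    simp [Polynomial.coe_compRingHom_apply]
  rw [h0, Polynomial.iterate_derivative_sum, Finset.sum_range_succ, Finset.sum_eq_zero]
  · rw [Polynomial.iterate_derivative_C_mul, Polynomial.iterate_derivative_X_sub_pow_self]
    have : (Nat.factorial n : ℝ) ≠ 0 := by positivity
    simp [jd]
    field_simp
  · intro i hi
    rw [Polynomial.iterate_derivative_C_mul, Polynomial.iterate_derivative_X_sub_pow,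
      Nat.descFactorial_eq_zero_iff_lt.2 (by simpa using hi)]
    simp

lemma jp_ne_zero (a b : ℝ) (h : -1 < a + b) (n : ℕ) : jp a b n ≠ 0 := by
  intro h0
  have h1 := jp_iter_self a b n 0
  rw [h0] at h1
  simp at h1
  have := ascPochhammer_pos n ((n : ℝ) + a + b + 1) (by
    have : (0:ℝ) ≤ n := by positivity
    linarith)
  have h2 : (0:ℝ) < 2 ^ n := by positivity
  have := div_pos this h2
  linarith

lemma gamma_poch (s : ℝ) (hs : 0 < s) (m : ℕ) :
    (ascPochhammer ℝ m).eval s = Real.Gamma (s + m) / Real.Gamma s := by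
  rw [eq_div_iff (Real.Gamma_pos_of_pos hs).ne']
  induction m with
  | zero => simp
  | succ m ih =>
    rw [ascPochhammer_succ_eval]
    have : (0:ℝ) < s + m := by positivity
    have e : s + ((m + 1 : ℕ) : ℝ) = (s + m) + 1 := by push_cast; ring
    rw [e, Real.Gamma_add_one this.ne', ← ih]
    ring

/-- common factor -/
noncomputable def jK (c : ℝ) (n i : ℕ) : ℝ :=
  (ascPochhammer ℝ i).eval ((n : ℝ) + c + 1) / (Nat.factorial i) / (Nat.factorial (n - i)) / 2 ^ i

lemma jd_eq (a b : ℝ) (ha : -1 < a) (n i : ℕ) (hi : i ≤ n) :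
    jd a b n i = jK (a + b) n i * (Real.Gamma (a + n + 1) / Real.Gamma (a + i + 1)) := by
  have h0 : (0:ℝ) < a + i + 1 := by
    have : (0:ℝ) ≤ i := by positivity
    linarith
  rw [jd, if_pos hi, gamma_poch (a + i + 1) h0, jK]
  have : a + (i:ℝ) + 1 + ((n - i : ℕ) : ℝ) = a + n + 1 := by
    rw [Nat.cast_sub hi]; ring
  rw [this, ← add_assoc (n : ℝ) a b]
  ring


lemma beta_int_zero (a s t : ℝ) (ha : 0 < a) (hs : 0 < s) (ht : 0 < t) :
    ∫ y in (0:ℝ)..a, y ^ (s - 1) * (a - y) ^ (t - 1) =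
      a ^ (s + t - 1) * (Real.Gamma s * Real.Gamma t / Real.Gamma (s + t)) := by
  have h := Complex.betaIntegral_scaled (s : ℂ) (t : ℂ) ha
  rw [Complex.betaIntegral_eq_Gamma_mul_div _ _ (by simpa) (by simpa)] at h
  have h1 : ∫ x in (0:ℝ)..a, (x:ℂ) ^ ((s:ℂ) - 1) * ((a:ℂ) - x) ^ ((t:ℂ) - 1) =
      ∫ x in (0:ℝ)..a, ((x ^ (s - 1) * (a - x) ^ (t - 1) : ℝ) : ℂ) := by
    apply intervalIntegral.integral_congr
    intro x hx
    rw [Set.uIcc_of_le ha.le] at hx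
    simp only
    rw [Complex.ofReal_mul, Complex.ofReal_cpow hx.1, Complex.ofReal_cpow (by linarith [hx.2])]
    push_cast
    rfl
  rw [h1, intervalIntegral.integral_ofReal] at h
  have h2 : ((a:ℂ) ^ ((s:ℂ) + t - 1) * (Complex.Gamma s * Complex.Gamma t / Complex.Gamma (s + t)))
     = ((a ^ (s + t - 1) * (Real.Gamma s * Real.Gamma t / Real.Gamma (s + t)) : ℝ) : ℂ) := by
    rw [← Complex.ofReal_add, Complex.Gamma_ofReal, Complex.Gamma_ofReal, Complex.Gamma_ofReal]
    push_cast
    rw [Complex.ofReal_cpow ha.le]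
    push_cast
    rfl
  rw [h2] at h
  exact_mod_cast h

lemma beta_int (c d s t : ℝ) (hcd : c < d) (hs : 0 < s) (ht : 0 < t) :
    ∫ y in c..d, (y - c) ^ (s - 1) * (d - y) ^ (t - 1) =
      (d - c) ^ (s + t - 1) * (Real.Gamma s * Real.Gamma t / Real.Gamma (s + t)) := by
  rw [← beta_int_zero (d - c) s t (by linarith) hs ht]
  have := intervalIntegral.integral_comp_sub_right (a := c) (b := d)
    (fun y => y ^ (s - 1) * ((d - c) - y) ^ (t - 1)) c
  simp only [sub_self] at this
  rw [← this]
  congr 1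
  ext y
  ring_nf

lemma beta_pos' (s t : ℝ) (hs : 0 < s) (ht : 0 < t) :
    0 < Real.Gamma s * Real.Gamma t / Real.Gamma (s + t) :=
  div_pos (mul_pos (Real.Gamma_pos_of_pos hs) (Real.Gamma_pos_of_pos ht))
    (Real.Gamma_pos_of_pos (by linarith))

lemma beta_ii (c d s t : ℝ) (hcd : c < d) (hs : 0 < s) (ht : 0 < t) :
    IntervalIntegrable (fun y => (y - c) ^ (s - 1) * (d - y) ^ (t - 1)) volume c d := by
  apply intervalIntegral.intervalIntegrable_of_integral_ne_zero
  rw [beta_int c d s t hcd hs ht]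
  exact (mul_pos (Real.rpow_pos_of_pos (by linarith) _) (beta_pos' s t hs ht)).ne'

/-- Jacobi weight -/
noncomputable def wJ (a b x : ℝ) : ℝ := (1 - x) ^ a * (1 + x) ^ b

lemma wJ_int (a b : ℝ) (ha : -1 < a) (hb : -1 < b) :
    ∫ x in (-1:ℝ)..1, wJ a b x =
      2 ^ (a + b + 1) * (Real.Gamma (a + 1) * Real.Gamma (b + 1) / Real.Gamma (a + b + 2)) := by
  have := beta_int (-1) 1 (b + 1) (a + 1) (by norm_num) (by linarith) (by linarith)
  rw [show (1:ℝ) - -1 = 2 by norm_num, show b + 1 + (a + 1) - 1 = a + b + 1 by ring,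
    show b + 1 + (a + 1) = a + b + 2 by ring, mul_comm (Real.Gamma (b + 1))] at this
  rw [← this]
  congr 1
  ext x
  unfold wJ
  rw [mul_comm]
  congr 2 <;> ring

lemma wJ_ii (a b : ℝ) (ha : -1 < a) (hb : -1 < b) :
    IntervalIntegrable (wJ a b) volume (-1) 1 := by
  have := beta_ii (-1) 1 (b + 1) (a + 1) (by norm_num) (by linarith) (by linarith)
  convert this using 1
  ext x
  unfold wJ
  rw [mul_comm]
  congr 2 <;> ring

lemma poly_ii (a b : ℝ) (ha : -1 < a) (hb : -1 < b) (p : Polynomial ℝ) :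
    IntervalIntegrable (fun x => p.eval x * wJ a b x) volume (-1) 1 :=
  (wJ_ii a b ha hb).continuousOn_mul p.continuous.continuousOn

lemma ibp (a b lam : ℝ) (ha : -1 < a) (hb : -1 < b) (p q : Polynomial ℝ) (h : SL a b lam p) :
    ∫ x in (-1:ℝ)..1, (p.derivative * q.derivative).eval x * wJ (a + 1) (b + 1) x =
      lam * ∫ x in (-1:ℝ)..1, (p * q).eval x * wJ a b x := by
  have key := intervalIntegral.integral_eq_sub_of_hasDerivAt_of_le (a := -1) (b := 1)
    (f := fun x => (1 - x) ^ (a + 1) * (1 + x) ^ (b + 1) * (p.derivative * q).eval x)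
    (f' := fun x => (p.derivative * q.derivative).eval x * wJ (a + 1) (b + 1) x -
      lam * ((p * q).eval x * wJ a b x)) (by norm_num) ?_ ?_ ?_
  · rw [intervalIntegral.integral_sub, intervalIntegral.integral_const_mul] at key
    · rw [show (1:ℝ) - 1 = 0 by norm_num, show (1:ℝ) + -1 = 0 by norm_num,
        Real.zero_rpow (by linarith), Real.zero_rpow (by linarith)] at key
      linarith
    · exact poly_ii _ _ (by linarith) (by linarith) _
    · exact (poly_ii _ _ ha hb _).const_mul _
  · apply ContinuousOn.mul
    · apply ContinuousOn.mul
      · exact (Continuous.rpow_const (by fun_prop) (fun x => Or.inr (by linarith))).continuousOn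
      · exact (Continuous.rpow_const (by fun_prop) (fun x => Or.inr (by linarith))).continuousOn
    · exact (Polynomial.continuous _).continuousOn
  · intro x hx
    have h1 : 0 < 1 - x := by linarith [hx.2]
    have h2 : 0 < 1 + x := by linarith [hx.1]
    have d1 : HasDerivAt (fun x : ℝ => (1 - x) ^ (a + 1)) (-1 * (a + 1) * (1 - x) ^ (a + 1 - 1)) x :=
      HasDerivAt.rpow_const (by simpa using (hasDerivAt_id x).const_sub 1) (Or.inl h1.ne')
    have d2 : HasDerivAt (fun x : ℝ => (1 + x) ^ (b + 1)) (1 * (b + 1) * (1 + x) ^ (b + 1 - 1)) x :=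
      HasDerivAt.rpow_const (by simpa using (hasDerivAt_id x).const_add 1) (Or.inl h2.ne')
    have d3 := (p.derivative * q).hasDerivAt x
    refine ((d1.fun_mul d2).fun_mul d3).congr_deriv ?_
    have hh := h x
    simp only [wJ, Polynomial.derivative_mul, Polynomial.eval_add, Polynomial.eval_mul,
      add_sub_cancel_right, Pi.mul_apply]
    rw [Real.rpow_add_one h1.ne', Real.rpow_add_one h2.ne']
    linear_combination ((1-x)^a * (1+x)^b * q.eval x) * hh
  · exact (poly_ii _ _ (by linarith) (by linarith) _).sub ((poly_ii _ _ ha hb _).const_mul _)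

/-- Inner products of derivatives of Jacobi polynomials. -/
noncomputable def ipJ (a b : ℝ) (j n m : ℕ) : ℝ :=
  ∫ x in (-1:ℝ)..1, (Polynomial.derivative^[j] (jp a b n) *
    Polynomial.derivative^[j] (jp a b m)).eval x * wJ (a + j) (b + j) x

lemma ipJ_succ (a b : ℝ) (ha : -1 < a) (hb : -1 < b) (j n m : ℕ) :
    ipJ a b (j + 1) n m = lamJ (a + b) n j * ipJ a b j n m := by
  unfold ipJ
  have hj : (0:ℝ) ≤ j := by positivity
  rw [Function.iterate_succ_apply', Function.iterate_succ_apply',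
    ← ibp (a + j) (b + j) _ (by linarith) (by linarith) _ _ (SL_jp_iter a b ha n j)]
  push_cast
  simp only [add_assoc]

lemma ipJ_symm (a b : ℝ) (j n m : ℕ) : ipJ a b j n m = ipJ a b j m n := by
  unfold ipJ
  simp only [mul_comm]

lemma ipJ_zero_ne (a b : ℝ) (ha : -1 < a) (hb : -1 < b) (hab : -1 < a + b) (n m : ℕ)
    (h : n ≠ m) : ipJ a b 0 n m = 0 := by
  have h1 := ipJ_succ a b ha hb 0 n m
  have h2 := ipJ_succ a b ha hb 0 m n
  rw [ipJ_symm a b 1 m n, ipJ_symm a b 0 m n, h1] at h2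
  have h3 : (lamJ (a + b) n 0 - lamJ (a + b) m 0) * ipJ a b 0 n m = 0 := by linarith
  rcases mul_eq_zero.1 h3 with h4 | h4
  · exfalso
    unfold lamJ at h4
    have h5 : ((n:ℝ) - m) * (n + m + (a + b) + 1) = 0 := by push_cast at h4; linear_combination h4
    rcases mul_eq_zero.1 h5 with h6 | h6
    · apply h; exact_mod_cast sub_eq_zero.1 h6
    · have : (0:ℝ) ≤ n := by positivity
      have : (0:ℝ) ≤ m := by positivity
      linarith
  · exact h4

lemma ipJ_ne (a b : ℝ) (ha : -1 < a) (hb : -1 < b) (hab : -1 < a + b) (j n m : ℕ)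
    (h : n ≠ m) : ipJ a b j n m = 0 := by
  induction j with
  | zero => exact ipJ_zero_ne a b ha hb hab n m h
  | succ j ih => rw [ipJ_succ a b ha hb, ih, mul_zero]

lemma ipJ_self_nonneg (a b : ℝ) (j n : ℕ) : 0 ≤ ipJ a b j n n := by
  unfold ipJ
  apply intervalIntegral.integral_nonneg (by norm_num)
  intro x hx
  rw [Polynomial.eval_mul]
  apply mul_nonneg (mul_self_nonneg _)
  exact mul_nonneg (Real.rpow_nonneg (by linarith [hx.2]) _) (Real.rpow_nonneg (by linarith [hx.1]) _)

lemma ipJ_iter (a b : ℝ) (ha : -1 < a) (hb : -1 < b) (j n : ℕ) (hj : j ≤ n) :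
    ipJ a b j n n = (n.descFactorial j : ℝ) *
      (ascPochhammer ℝ j).eval ((n:ℝ) + a + b + 1) * ipJ a b 0 n n := by
  induction j with
  | zero => simp
  | succ j ih =>
    rw [ipJ_succ a b ha hb, ih (by omega), Nat.descFactorial_succ, ascPochhammer_succ_eval, lamJ]
    rw [Nat.cast_mul, Nat.cast_sub (by omega)]
    ring

lemma ipJ_gamma (a b : ℝ) (ha : -1 < a) (hb : -1 < b) (hab : -1 < a + b) (n : ℕ) :
    ipJ a b 0 n n = gammaJ a b n := by
  have h1 := ipJ_iter a b ha hb n n le_rfl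
  have hn : (0:ℝ) ≤ n := by positivity
  have h2 : ipJ a b n n n = ((ascPochhammer ℝ n).eval ((n : ℝ) + a + b + 1) / 2 ^ n) ^ 2 *
    ∫ x in (-1:ℝ)..1, wJ (a + n) (b + n) x := by
    unfold ipJ
    rw [← intervalIntegral.integral_const_mul]
    congr 1
    ext x
    rw [Polynomial.eval_mul, jp_iter_self]
    ring
  rw [h2, wJ_int _ _ (by linarith) (by linarith), gamma_poch _ (by linarith),
    Nat.descFactorial_self] at h1
  unfold gammaJ
  have e1 : a + n + (b + n) + 2 = (2 * n + a + b + 1) + 1 := by ring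
  have e2 : (n:ℝ) + a + b + 1 + n = 2 * n + a + b + 1 := by ring
  have p1 : (0:ℝ) < 2 * n + a + b + 1 := by linarith
  rw [e1, e2, Real.Gamma_add_one p1.ne'] at h1
  have g1 := Real.Gamma_pos_of_pos p1
  have g2 : 0 < Real.Gamma ((n:ℝ) + a + b + 1) := Real.Gamma_pos_of_pos (by linarith)
  have e3 : (2:ℝ) ^ (a + n + (b + n) + 1) = 2 ^ (a + b + 1) * (2 ^ n * 2 ^ n) := by
    rw [show a + n + (b + n) + 1 = (a + b + 1) + n + n by ring, Real.rpow_add (by norm_num),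
      Real.rpow_add (by norm_num), Real.rpow_natCast]
    ring
  have f0 : (0:ℝ) < n.factorial := by positivity
  rw [e3, show a + (n:ℝ) + 1 = n + a + 1 by ring, show b + (n:ℝ) + 1 = n + b + 1 by ring] at h1
  rw [eq_div_iff (by positivity)]
  field_simp at h1
  linear_combination -h1


lemma Iplus_pow_ii (ρ t x : ℝ) (hρ : 0 < ρ) (ht : -1 < t) (hx : x < 1) :
    IntervalIntegrable (fun y => (y - x) ^ (ρ - 1) * (1 - y) ^ t) volume x 1 := by
  have := beta_ii x 1 ρ (t + 1) hx hρ (by linarith)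
  simpa using this

lemma Iplus_pow (ρ t x : ℝ) (hρ : 0 < ρ) (ht : -1 < t) (hx : x < 1) :
    Iplus ρ (fun y => (1 - y) ^ t) x =
      Real.Gamma (t + 1) / Real.Gamma (t + 1 + ρ) * (1 - x) ^ (t + ρ) := by
  have := beta_int x 1 ρ (t + 1) hx hρ (by linarith)
  simp only [add_sub_cancel_right] at this
  unfold Iplus
  rw [this]
  have := (Real.Gamma_pos_of_pos hρ).ne'
  rw [show ρ + (t + 1) - 1 = t + ρ by ring, show ρ + (t + 1) = t + 1 + ρ by ring]
  field_simp

lemma Iplus_congr (ρ x : ℝ) (hx : x ≤ 1) (f g : ℝ → ℝ)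
    (h : ∀ y ∈ Set.Icc x 1, f y = g y) : Iplus ρ f x = Iplus ρ g x := by
  unfold Iplus
  congr 1
  apply intervalIntegral.integral_congr
  intro y hy
  rw [Set.uIcc_of_le hx] at hy
  simp only [h y hy]

lemma Iplus_sum_ii (ρ t x : ℝ) (hρ : 0 < ρ) (ht : -1 < t) (hx : x < 1) (k : ℕ → ℝ) (s : Finset ℕ) :
    IntervalIntegrable (fun y => (y - x) ^ (ρ - 1) * ∑ i ∈ s, k i * (1 - y) ^ (t + i)) volume x 1 := by
  have : (fun y => (y - x) ^ (ρ - 1) * ∑ i ∈ s, k i * (1 - y) ^ (t + i)) =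
      ∑ i ∈ s, fun y => k i * ((y - x) ^ (ρ - 1) * (1 - y) ^ (t + i)) := by
    ext y
    rw [Finset.mul_sum, Finset.sum_apply]
    apply Finset.sum_congr rfl
    intro i _
    ring
  rw [this]
  apply IntervalIntegrable.sum
  intro i _
  apply IntervalIntegrable.const_mul
  apply Iplus_pow_ii ρ _ x hρ _ hx
  have : (0:ℝ) ≤ i := by positivity
  linarith

lemma Iplus_sum (ρ t x : ℝ) (hρ : 0 < ρ) (ht : -1 < t) (hx : x < 1) (k : ℕ → ℝ) (s : Finset ℕ) :
    Iplus ρ (fun y => ∑ i ∈ s, k i * (1 - y) ^ (t + i)) x =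
      ∑ i ∈ s, k i * (Real.Gamma (t + i + 1) / Real.Gamma (t + i + 1 + ρ) *
        (1 - x) ^ (t + i + ρ)) := by
  have hi : ∀ i : ℕ, -1 < t + i := fun i => by
    have : (0:ℝ) ≤ i := by positivity
    linarith
  have h1 : ∀ i ∈ s, k i * (Real.Gamma (t + i + 1) / Real.Gamma (t + i + 1 + ρ) *
        (1 - x) ^ (t + i + ρ)) = k i * Iplus ρ (fun y => (1 - y) ^ (t + i)) x := by
    intro i _
    rw [Iplus_pow ρ _ x hρ (hi i) hx]
  rw [Finset.sum_congr rfl h1]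
  unfold Iplus
  simp only [Finset.mul_sum]
  rw [intervalIntegral.integral_finsetSum]
  · rw [Finset.mul_sum]
    apply Finset.sum_congr rfl
    intro i _
    rw [mul_left_comm]
    congr 1
    rw [← intervalIntegral.integral_const_mul]
    congr 1
    ext y
    ring
  · intro i _
    have := (Iplus_pow_ii ρ _ x hρ (hi i) hx).const_mul (k i)
    convert this using 1
    ext y
    ring

/-- generalized Jacobi function -/
noncomputable def gJ (α β : ℝ) (n : ℕ) (y : ℝ) : ℝ := (1 - y) ^ α * jacobiP α β n y

lemma gJ_eq (α β : ℝ) (hα : 0 ≤ α) (n : ℕ) (y : ℝ) (hy : y ≤ 1) :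
    gJ α β n y = ∑ i ∈ Finset.range (n + 1), (jd α β n i * (-1) ^ i) * (1 - y) ^ (α + (i:ℝ)) := by
  unfold gJ
  rw [← jp_eval, jp_eval_sum, Finset.mul_sum]
  apply Finset.sum_congr rfl
  intro i _
  rw [Real.rpow_add_of_nonneg (by linarith) hα (by positivity), Real.rpow_natCast,
    show y - 1 = (-1) * (1 - y) by ring, mul_pow]
  ring

lemma jp_zero_eq (b : ℝ) (n : ℕ) (y : ℝ) :
    (jp 0 b n).eval y = ∑ i ∈ Finset.range (n + 1), (jd 0 b n i * (-1) ^ i) * (1 - y) ^ (0 + (i:ℝ)) := by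
  rw [jp_eval_sum]
  apply Finset.sum_congr rfl
  intro i _
  rw [zero_add, Real.rpow_natCast,
    show y - 1 = (-1) * (1 - y) by ring, mul_pow]
  ring

lemma gJ_ii (α β ρ x : ℝ) (hα : 0 ≤ α) (hρ : 0 < ρ) (hx : x < 1) (n : ℕ) :
    IntervalIntegrable (fun y => (y - x) ^ (ρ - 1) * gJ α β n y) volume x 1 := by
  apply (Iplus_sum_ii ρ α x hρ (by linarith) hx (fun i => jd α β n i * (-1) ^ i)
    (Finset.range (n + 1))).congr
  intro y hy
  rw [Set.uIoc_of_le hx.le] at hy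
  simp only [gJ_eq α β hα n y hy.2]

/-- normalisation `Γ(α+n+1)/n!` -/
noncomputable def cJ (α : ℝ) (n : ℕ) : ℝ := Real.Gamma (α + n + 1) / n.factorial

lemma cJ_pos (α : ℝ) (hα : 0 < α) (n : ℕ) : 0 < cJ α n :=
  div_pos (Real.Gamma_pos_of_pos (by positivity)) (by positivity)

/-- `I_+^α` of the Jacobi polynomial with parameters `(0,α+β)`. -/
lemma Iplus_jp (α β x : ℝ) (hα : 0 < α) (hx : x < 1) (n : ℕ) :
    cJ α n * Iplus α (fun y => (jp 0 (α + β) n).eval y) x = gJ α β n x := by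
  simp only [jp_zero_eq]
  rw [Iplus_sum α 0 x hα (by norm_num) hx, gJ_eq α β hα.le n x hx.le, Finset.mul_sum]
  apply Finset.sum_congr rfl
  intro i hi
  have hi' : i ≤ n := by simp at hi; omega
  rw [jd_eq α β (by linarith) n i hi', jd_eq 0 (α + β) (by norm_num) n i hi', cJ]
  simp only [zero_add]
  rw [Real.Gamma_nat_eq_factorial, Real.Gamma_nat_eq_factorial,
    show (i:ℝ) + 1 + α = α + i + 1 by ring, add_comm (i:ℝ) α]
  have : 0 < Real.Gamma (α + i + 1) := Real.Gamma_pos_of_pos (by positivity)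
  field_simp

/-- Polynomial representing `I_+^{k-α} J_n`. -/
noncomputable def QJ (α β : ℝ) (k n : ℕ) : Polynomial ℝ :=
  ∑ i ∈ Finset.range (n + 1), Polynomial.C (jK (α + β) n i * Real.Gamma (α + n + 1) /
    (k + i).factorial * (-1) ^ k) * (Polynomial.X - Polynomial.C 1) ^ (k + i)

lemma Iplus_gJ (α β x : ℝ) (hα : 0 < α) (hx : x < 1) (n k : ℕ) (hk : α < k) :
    Iplus (k - α) (gJ α β n) x = (QJ α β k n).eval x := by
  rw [Iplus_congr _ x hx.le _ _ (fun y hy => gJ_eq α β hα.le n y hy.2),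
    Iplus_sum _ α x (by linarith) (by linarith) hx, QJ, Polynomial.eval_finsetSum]
  apply Finset.sum_congr rfl
  intro i hi
  have hi' : i ≤ n := by simp at hi; omega
  rw [jd_eq α β (by linarith) n i hi']
  have e1 : α + (i:ℝ) + 1 + (k - α) = ((k + i : ℕ) : ℝ) + 1 := by push_cast; ring
  have e2 : α + (i:ℝ) + (k - α) = ((k + i : ℕ) : ℝ) := by push_cast; ring
  rw [e1, e2, Real.Gamma_nat_eq_factorial, Real.rpow_natCast]
  have : 0 < Real.Gamma (α + i + 1) := Real.Gamma_pos_of_pos (by positivity)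
  simp only [Polynomial.eval_mul, Polynomial.eval_C, Polynomial.eval_pow, Polynomial.eval_sub,
    Polynomial.eval_X]
  rw [show x - 1 = (-1) * (1 - x) by ring, mul_pow, pow_add (-1:ℝ) k i]
  have e3 : ((-1:ℝ) ^ k) * (-1) ^ k = 1 := by rw [← mul_pow]; simp
  field_simp
  linear_combination (-(jK (α + β) n i * (1 - x) ^ k * (1 - x) ^ i)) * e3

lemma QJ_deriv (α β : ℝ) (hα : 0 < α) (n k j : ℕ) :
    Polynomial.derivative^[k + j] (QJ α β k n) =
      Polynomial.C ((-1) ^ k * cJ α n) * Polynomial.derivative^[j] (jp 0 (α + β) n) := by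
  rw [add_comm k j, Function.iterate_add_apply, ← Polynomial.iterate_derivative_C_mul]
  congr 1
  have h0 : jp 0 (α + β) n = ∑ i ∈ Finset.range (n + 1),
      Polynomial.C (jd 0 (α + β) n i) * (Polynomial.X - Polynomial.C 1) ^ i := by
    unfold jp jq
    rw [← Polynomial.coe_compRingHom_apply, map_sum]
    simp [Polynomial.coe_compRingHom_apply]
  rw [h0, QJ, Polynomial.iterate_derivative_sum, Finset.mul_sum]
  apply Finset.sum_congr rfl
  intro i hi
  have hi' : i ≤ n := by simp at hi; omega
  rw [Polynomial.iterate_derivative_C_mul, Polynomial.iterate_derivative_X_sub_pow,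
    Nat.add_sub_cancel_left, jd_eq 0 (α + β) (by norm_num) n i hi', cJ]
  have hd := Nat.factorial_mul_descFactorial (show k ≤ k + i by omega)
  rw [Nat.add_sub_cancel_left] at hd
  have hd' : (i.factorial : ℝ) * ((k + i).descFactorial k : ℝ) = (k + i).factorial := by
    exact_mod_cast hd
  rw [nsmul_eq_mul, ← mul_assoc, ← mul_assoc, ← Polynomial.C_eq_natCast, ← Polynomial.C_mul,
    ← Polynomial.C_mul]
  congr 2
  simp only [zero_add]
  rw [Real.Gamma_nat_eq_factorial, Real.Gamma_nat_eq_factorial, ← hd']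
  have : (0:ℝ) < ((k + i).descFactorial k : ℝ) := by
    have := Nat.descFactorial_pos.2 (show k ≤ k + i by omega)
    exact_mod_cast this
  field_simp

noncomputable def k0 (α : ℝ) : ℕ := ⌊α⌋.toNat + 1

lemma k0_gt (α : ℝ) (hα : 0 < α) : α < k0 α := by
  unfold k0
  have h1 : (⌊α⌋.toNat : ℤ) = ⌊α⌋ := Int.toNat_of_nonneg (Int.floor_nonneg.2 hα.le)
  have h2 : ((⌊α⌋.toNat : ℕ) : ℝ) = (⌊α⌋ : ℝ) := by exact_mod_cast h1
  push_cast
  rw [h2]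
  exact Int.lt_floor_add_one α

lemma DplusC_eq (α : ℝ) (hα : 0 < α) (j : ℕ) (v : ℝ → ℝ) (x : ℝ) :
    DplusC (α + j) v x = (-1) ^ (k0 α + j) * iteratedDeriv (k0 α + j) (Iplus (k0 α - α) v) x := by
  unfold DplusC Dplus
  have h0 : 0 ≤ ⌊α⌋ := Int.floor_nonneg.2 hα.le
  have e : ⌊α + (j:ℝ)⌋.toNat + 1 = k0 α + j := by
    rw [Int.floor_add_natCast]
    unfold k0
    omega
  rw [e]
  push_cast
  rw [show (k0 α : ℝ) + j - (α + j) = k0 α - α by ring]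

lemma poly_iteratedDeriv (p : Polynomial ℝ) (k : ℕ) (x : ℝ) :
    iteratedDeriv k (fun y => p.eval y) x = (Polynomial.derivative^[k] p).eval x := by
  induction k generalizing p with
  | zero => simp
  | succ k ih =>
    rw [iteratedDeriv_succ']
    have : deriv (fun y => p.eval y) = fun y => p.derivative.eval y := by
      ext y; simp
    rw [this, ih, Function.iterate_succ_apply]

lemma DplusC_gJ (α β x : ℝ) (hα : 0 < α) (hx : x < 1) (n j : ℕ) :
    DplusC (α + j) (gJ α β n) x =
      (-1) ^ j * cJ α n * (Polynomial.derivative^[j] (jp 0 (α + β) n)).eval x := by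
  rw [DplusC_eq α hα]
  have : Iplus (k0 α - α) (gJ α β n) =ᶠ[nhds x] fun y => (QJ α β (k0 α) n).eval y := by
    filter_upwards [Iio_mem_nhds hx] with y hy
    exact Iplus_gJ α β y hα hy n _ (k0_gt α hα)
  rw [this.iteratedDeriv_eq, poly_iteratedDeriv, QJ_deriv α β hα]
  rw [Polynomial.eval_mul, Polynomial.eval_C, pow_add]
  have e3 : ((-1:ℝ) ^ (k0 α)) * (-1) ^ (k0 α) = 1 := by rw [← mul_pow]; simp
  linear_combination ((-1)^j * cJ α n * (Polynomial.derivative^[j] (jp 0 (α + β) n)).eval x) * e3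


noncomputable def kerF (c σ α : ℝ) (h : ℝ → ℝ) (q : ℝ × ℝ) : ℝ :=
  if q.1 < q.2 then (q.1 - c) ^ (σ - 1) * ((q.2 - q.1) ^ (α - 1) * h q.2) else 0

lemma kerF_meas (c σ α : ℝ) (h : ℝ → ℝ) (hm : Measurable h) : Measurable (kerF c σ α h) := by
  unfold kerF
  apply Measurable.ite (measurableSet_lt measurable_fst measurable_snd)
  · fun_prop
  · exact measurable_const

lemma kerF_sec_y (c σ α z : ℝ) (h : ℝ → ℝ) (hz : z ∈ Set.Ioo c 1) (hσ : 0 < σ) (hα : 0 < α) :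
    IntegrableOn (fun y => kerF c σ α h (y, z)) (Set.Ioo c 1) ∧
    (∫ y in Set.Ioo c 1, kerF c σ α h (y, z)) =
      (Real.Gamma σ * Real.Gamma α / Real.Gamma (σ + α)) * ((z - c) ^ (σ + α - 1) * h z) := by
  have e : (fun y => kerF c σ α h (y, z)) = (Set.Iio z).indicator
      (fun y => ((y - c) ^ (σ - 1) * (z - y) ^ (α - 1)) * h z) := by
    ext y
    unfold kerF
    by_cases hy : y < z
    · simp [hy]; ring
    · simp [hy]
  have hs : Set.Iio z ∩ Set.Ioo c 1 = Set.Ioo c z := by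
    ext y; simp only [Set.mem_inter_iff, Set.mem_Iio, Set.mem_Ioo]
    constructor
    · rintro ⟨h1, h2, h3⟩; exact ⟨h2, h1⟩
    · rintro ⟨h1, h2⟩; exact ⟨h2, h1, h2.trans hz.2⟩
  have hb := beta_ii c z σ α hz.1 hσ hα
  rw [intervalIntegrable_iff_integrableOn_Ioo_of_le hz.1.le] at hb
  have hb2 := beta_int c z σ α hz.1 hσ hα
  rw [intervalIntegral.integral_of_le hz.1.le, integral_Ioc_eq_integral_Ioo] at hb2
  rw [e]
  constructor
  · rw [IntegrableOn, integrable_indicator_iff measurableSet_Iio, IntegrableOn,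
      Measure.restrict_restrict measurableSet_Iio, hs]
    exact hb.mul_const _
  · rw [integral_indicator measurableSet_Iio, Measure.restrict_restrict measurableSet_Iio, hs,
      integral_mul_const, hb2]
    ring

lemma kerF_norm (c σ α : ℝ) (h : ℝ → ℝ) (y z : ℝ) (hy : c < y) :
    ‖kerF c σ α h (y, z)‖ = kerF c σ α (fun z => |h z|) (y, z) := by
  unfold kerF
  split_ifs with h1
  · simp only at h1 ⊢
    rw [Real.norm_eq_abs, abs_mul, abs_mul, abs_of_nonneg (Real.rpow_nonneg (by linarith) _),
      abs_of_nonneg (Real.rpow_nonneg (by linarith) _)]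
  · simp

lemma kerF_int (c σ α : ℝ) (h : ℝ → ℝ) (hm : Measurable h) (hσ : 0 < σ) (hα : 0 < α)
    (hi : IntegrableOn (fun z => (z - c) ^ (σ + α - 1) * h z) (Set.Ioo c 1)) :
    Integrable (kerF c σ α h)
      ((volume.restrict (Set.Ioo c 1)).prod (volume.restrict (Set.Ioo c 1))) := by
  rw [integrable_prod_iff' (kerF_meas c σ α h hm).aestronglyMeasurable]
  constructor
  · filter_upwards [ae_restrict_mem measurableSet_Ioo] with z hz
    exact (kerF_sec_y c σ α z h hz hσ hα).1
  · have : (fun z => (Real.Gamma σ * Real.Gamma α / Real.Gamma (σ + α)) *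
        ‖(z - c) ^ (σ + α - 1) * h z‖) =ᵐ[volume.restrict (Set.Ioo c 1)]
        (fun z => ∫ y in Set.Ioo c 1, ‖kerF c σ α h (y, z)‖) := by
      filter_upwards [ae_restrict_mem measurableSet_Ioo] with z hz
      rw [setIntegral_congr_fun measurableSet_Ioo
        (fun y hy => kerF_norm c σ α h y z hy.1), (kerF_sec_y c σ α z _ hz hσ hα).2, norm_mul,
        Real.norm_of_nonneg (Real.rpow_nonneg (by linarith [hz.1]) _), Real.norm_eq_abs]
    exact Integrable.congr (hi.norm.const_mul _) this

lemma kerF_sec_z (c σ α y : ℝ) (h : ℝ → ℝ) (hy : y ∈ Set.Ioo c 1) (hα : 0 < α) :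
    (∫ z in Set.Ioo c 1, kerF c σ α h (y, z)) =
      Real.Gamma α * ((y - c) ^ (σ - 1) * Iplus α h y) := by
  have e : (fun z => kerF c σ α h (y, z)) = (Set.Ioi y).indicator
      (fun z => (y - c) ^ (σ - 1) * ((z - y) ^ (α - 1) * h z)) := by
    ext z
    unfold kerF
    by_cases hz : y < z
    · simp [hz]
    · simp [hz]
  have hs : Set.Ioi y ∩ Set.Ioo c 1 = Set.Ioo y 1 := by
    ext z; simp only [Set.mem_inter_iff, Set.mem_Ioi, Set.mem_Ioo]
    constructor
    · rintro ⟨h1, h2, h3⟩; exact ⟨h1, h3⟩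
    · rintro ⟨h1, h2⟩; exact ⟨h1, hy.1.trans h1, h2⟩
  rw [e, integral_indicator measurableSet_Ioi, Measure.restrict_restrict measurableSet_Ioi, hs,
      integral_const_mul]
  unfold Iplus
  rw [intervalIntegral.integral_of_le hy.2.le, integral_Ioc_eq_integral_Ioo]
  have := (Real.Gamma_pos_of_pos hα).ne'
  field_simp

lemma frac_int_s13 (c σ α : ℝ) (h : ℝ → ℝ) (hm : Measurable h) (hσ : 0 < σ) (hα : 0 < α)
    (hi : IntegrableOn (fun z => (z - c) ^ (σ + α - 1) * h z) (Set.Ioo c 1)) :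
    IntegrableOn (fun y => (y - c) ^ (σ - 1) * Iplus α h y) (Set.Ioo c 1) := by
  have h1 := (kerF_int c σ α h hm hσ hα hi).integral_prod_left
  have h2 := h1.const_mul (Real.Gamma α)⁻¹
  refine Integrable.congr h2 ?_
  filter_upwards [ae_restrict_mem measurableSet_Ioo] with y hy
  rw [kerF_sec_z c σ α y h hy hα]
  have := (Real.Gamma_pos_of_pos hα).ne'
  field_simp

lemma frac_eq (c σ α : ℝ) (h : ℝ → ℝ) (hm : Measurable h) (hσ : 0 < σ) (hα : 0 < α)
    (hi : IntegrableOn (fun z => (z - c) ^ (σ + α - 1) * h z) (Set.Ioo c 1)) :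
    ∫ y in Set.Ioo c 1, (y - c) ^ (σ - 1) * Iplus α h y =
      Real.Gamma σ / Real.Gamma (σ + α) * ∫ z in Set.Ioo c 1, (z - c) ^ (σ + α - 1) * h z := by
  have h1 := integral_integral_swap (f := fun y z => kerF c σ α h (y, z))
    (kerF_int c σ α h hm hσ hα hi)
  rw [setIntegral_congr_fun measurableSet_Ioo (fun y hy => kerF_sec_z c σ α y h hy hα),
    setIntegral_congr_fun measurableSet_Ioo (fun z hz => (kerF_sec_y c σ α z h hz hσ hα).2),
    integral_const_mul, integral_const_mul] at h1
  have := (Real.Gamma_pos_of_pos hα)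
  have : 0 < Real.Gamma (σ + α) := Real.Gamma_pos_of_pos (by linarith)
  field_simp at h1 ⊢
  linear_combination h1

lemma Iplus_abs (α y : ℝ) (h : ℝ → ℝ) (hα : 0 < α) (hy : y ≤ 1) :
    |Iplus α h y| ≤ Iplus α (fun z => |h z|) y := by
  unfold Iplus
  have g := (Real.Gamma_pos_of_pos hα)
  rw [abs_mul, abs_of_pos (by positivity)]
  apply mul_le_mul_of_nonneg_left _ (by positivity)
  rw [← Real.norm_eq_abs, intervalIntegral.integral_of_le hy, intervalIntegral.integral_of_le hy]
  refine (norm_integral_le_integral_norm _).trans (le_of_eq ?_)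
  apply setIntegral_congr_fun measurableSet_Ioc
  intro z hz
  simp only
  rw [norm_mul, Real.norm_of_nonneg (Real.rpow_nonneg (by linarith [hz.1]) _), Real.norm_eq_abs]

lemma frac_le (c σ α : ℝ) (h : ℝ → ℝ) (hm : Measurable h) (hσ : 0 < σ) (hα : 0 < α)
    (hi : IntegrableOn (fun z => (z - c) ^ (σ + α - 1) * h z) (Set.Ioo c 1)) :
    ∫ y in Set.Ioo c 1, |(y - c) ^ (σ - 1) * Iplus α h y| ≤
      Real.Gamma σ / Real.Gamma (σ + α) * ∫ z in Set.Ioo c 1, |(z - c) ^ (σ + α - 1) * h z| := by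
  have e : ∀ z ∈ Set.Ioo c 1, |(z - c) ^ (σ + α - 1) * h z| =
      (z - c) ^ (σ + α - 1) * |h z| := by
    intro z hz
    rw [abs_mul, abs_of_nonneg (Real.rpow_nonneg (by linarith [hz.1]) _)]
  have hi' : IntegrableOn (fun z => (z - c) ^ (σ + α - 1) * |h z|) (Set.Ioo c 1) :=
    (integrableOn_congr_fun e measurableSet_Ioo).1 hi.abs
  have hm' : Measurable (fun z => |h z|) := hm.abs
  rw [setIntegral_congr_fun measurableSet_Ioo e, ← frac_eq c σ α _ hm' hσ hα hi']
  apply setIntegral_mono_on (frac_int_s13 c σ α h hm hσ hα hi).abs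
    (frac_int_s13 c σ α _ hm' hσ hα hi') measurableSet_Ioo
  intro y hy
  rw [abs_mul, abs_of_nonneg (Real.rpow_nonneg (by linarith [hy.1]) _)]
  apply mul_le_mul_of_nonneg_left (Iplus_abs α y h hα hy.2.le)
  exact Real.rpow_nonneg (by linarith [hy.1]) _


noncomputable def Int0 (g : ℝ → ℝ) (x : ℝ) : ℝ := ∫ t in (0:ℝ)..x, g t

def LI (g : ℝ → ℝ) : Prop := ∀ x ∈ Set.Ioo (-1:ℝ) 1, IntervalIntegrable g volume 0 x

lemma LI_cont {g : ℝ → ℝ} (hg : LI g) : ContinuousOn (Int0 g) (Set.Ioo (-1:ℝ) 1) := by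
  intro x hx
  obtain ⟨r, hr1, hr2⟩ : ∃ r, |x| < r ∧ r < 1 := exists_between (abs_lt.2 hx)
  have h0 : 0 ≤ |x| := abs_nonneg x
  have hi : IntervalIntegrable g volume (-r) r :=
    (hg (-r) ⟨by linarith, by linarith⟩).symm.trans (hg r ⟨by linarith, hr2⟩)
  have := intervalIntegral.continuousOn_primitive_interval' hi
    (a := 0) (by rw [Set.uIcc_of_le (by linarith)]; exact ⟨by linarith, by linarith⟩)
  rw [Set.uIcc_of_le (by linarith)] at this
  have hxr := abs_lt.1 hr1
  exact (this.continuousAt (Icc_mem_nhds hxr.1 hxr.2)).continuousWithinAt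

lemma cont_LI {g : ℝ → ℝ} (hg : ContinuousOn g (Set.Ioo (-1:ℝ) 1)) : LI g := by
  intro x hx
  apply ContinuousOn.intervalIntegrable
  apply hg.mono
  have : Set.OrdConnected (Set.Ioo (-1:ℝ) 1) := Set.ordConnected_Ioo
  exact this.uIcc_subset ⟨by norm_num, by norm_num⟩ hx

lemma Int0_iter_cont {g : ℝ → ℝ} (hg : LI g) (k : ℕ) :
    ContinuousOn (Int0^[k + 1] g) (Set.Ioo (-1:ℝ) 1) := by
  induction k with
  | zero => simpa using LI_cont hg
  | succ k ih =>
    rw [Function.iterate_succ_apply']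
    exact LI_cont (cont_LI ih)

lemma LI_iter {g : ℝ → ℝ} (hg : LI g) (k : ℕ) : LI (Int0^[k] g) := by
  cases k with
  | zero => simpa using hg
  | succ k => exact cont_LI (Int0_iter_cont hg k)

lemma Int0_deriv {g : ℝ → ℝ} (hg : ContinuousOn g (Set.Ioo (-1:ℝ) 1)) (x : ℝ)
    (hx : x ∈ Set.Ioo (-1:ℝ) 1) : HasDerivAt (Int0 g) (g x) x := by
  apply intervalIntegral.integral_hasDerivAt_right (cont_LI hg x hx)
  · exact hg.stronglyMeasurableAtFilter isOpen_Ioo x hx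
  · exact hg.continuousAt (isOpen_Ioo.mem_nhds hx)

lemma Int0_ae_diff {g : ℝ → ℝ} (hg : LI g) :
    ∀ᵐ x ∂(volume.restrict (Set.Ioo (-1:ℝ) 1)), DifferentiableAt ℝ (Int0 g) x := by
  have h1 : ∀ n : ℕ, ∀ᵐ x : ℝ, x ∈ Set.Icc (-(1 - 1 / ((n:ℝ) + 1))) (1 - 1 / ((n:ℝ) + 1)) →
      DifferentiableAt ℝ (Int0 g) x := by
    intro n
    have hn : 0 < 1 / ((n:ℝ) + 1) := by positivity
    have hn2 : 1 / ((n:ℝ) + 1) ≤ 1 := by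
      rw [div_le_one (by positivity)]; linarith [show (0:ℝ) ≤ n by positivity]
    have hi : IntervalIntegrable g volume (-(1 - 1 / ((n:ℝ) + 1))) (1 - 1 / ((n:ℝ) + 1)) :=
      (hg _ ⟨by linarith, by linarith⟩).symm.trans (hg _ ⟨by linarith, by linarith⟩)
    have h2 := hi.ae_hasDerivAt_integral
    rw [Set.uIcc_of_le (by linarith)] at h2
    filter_upwards [h2] with x hx hx2
    exact (hx hx2 0 ⟨by linarith, by linarith⟩).differentiableAt
  rw [ae_restrict_iff' measurableSet_Ioo]
  filter_upwards [ae_all_iff.2 h1] with x hx hx2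
  obtain ⟨n, hn⟩ := exists_nat_one_div_lt (show 0 < 1 - |x| by linarith [abs_lt.2 hx2])
  exact hx n (abs_le.1 (by linarith))

lemma iter_sub (g : ℝ → ℝ) (hg : LI g) (k : ℕ) : ∀ (p T : Polynomial ℝ) (G : ℝ → ℝ),
    (∀ x ∈ Set.Ioo (-1:ℝ) 1, G x = T.eval x + Int0^[k + 1] g x) →
    ∀ᵐ x ∂(volume.restrict (Set.Ioo (-1:ℝ) 1)),
      iteratedDeriv (k + 1) (fun y => p.eval y - G y) x =
        iteratedDeriv (k + 1) (fun y => p.eval y) x - iteratedDeriv (k + 1) G x := by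
  induction k with
  | zero =>
    intro p T G hG
    filter_upwards [Int0_ae_diff hg, ae_restrict_mem measurableSet_Ioo] with x hx hxI
    have : G =ᶠ[nhds x] fun y => T.eval y + Int0 g y := by
      filter_upwards [isOpen_Ioo.mem_nhds hxI] with y hy
      simpa using hG y hy
    have hd : DifferentiableAt ℝ G x :=
      (T.differentiableAt.add hx).congr_of_eventuallyEq this
    simp only [zero_add, iteratedDeriv_one]
    exact deriv_fun_sub p.differentiableAt hd
  | succ k ih =>
    intro p T G hG
    have hD : ∀ x ∈ Set.Ioo (-1:ℝ) 1, HasDerivAt G (T.derivative.eval x + Int0^[k + 1] g x) x := by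
      intro x hx
      have : G =ᶠ[nhds x] fun y => T.eval y + Int0 (Int0^[k + 1] g) y := by
        filter_upwards [isOpen_Ioo.mem_nhds hx] with y hy
        rw [hG y hy, Function.iterate_succ_apply']
      exact ((T.hasDerivAt x).add (Int0_deriv (Int0_iter_cont hg k) x hx)).congr_of_eventuallyEq this
    have hI := ih p.derivative T.derivative (deriv G) (fun x hx => (hD x hx).deriv)
    filter_upwards [hI, ae_restrict_mem measurableSet_Ioo] with x hx hxI
    rw [iteratedDeriv_succ' (f := G), iteratedDeriv_succ' (f := fun y => p.eval y),
      iteratedDeriv_succ' (f := fun y => p.eval y - G y)]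
    have e1 : deriv (fun y => p.eval y) = fun y => p.derivative.eval y := by
      ext y; simp
    rw [e1, ← hx]
    apply Filter.EventuallyEq.iteratedDeriv_eq
    filter_upwards [isOpen_Ioo.mem_nhds hxI] with y hy
    rw [deriv_fun_sub p.differentiableAt (hD y hy).differentiableAt]
    simp

lemma uIoc_sub {x : ℝ} (hx : x ∈ Set.Ioo (-1:ℝ) 1) : Set.uIoc 0 x ⊆ Set.Ioo (-1:ℝ) 1 := by
  intro t ht
  have : Set.OrdConnected (Set.Ioo (-1:ℝ) 1) := Set.ordConnected_Ioo
  exact this.uIcc_subset ⟨by norm_num, by norm_num⟩ hx (Set.uIoc_subset_uIcc ht)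

lemma Int0_iter_sub {f g : ℝ → ℝ} (hf : LI f) (hg : LI g) (k : ℕ) :
    ∀ x ∈ Set.Ioo (-1:ℝ) 1, Int0^[k] (fun y => f y - g y) x = Int0^[k] f x - Int0^[k] g x := by
  induction k with
  | zero => intro x hx; simp
  | succ k ih =>
    intro x hx
    rw [Function.iterate_succ_apply', Function.iterate_succ_apply', Function.iterate_succ_apply']
    change ∫ t in (0:ℝ)..x, Int0^[k] (fun y => f y - g y) t =
      (∫ t in (0:ℝ)..x, Int0^[k] f t) - ∫ t in (0:ℝ)..x, Int0^[k] g t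
    rw [← intervalIntegral.integral_sub (LI_iter hf k x hx) (LI_iter hg k x hx)]
    apply intervalIntegral.integral_congr
    intro t ht
    apply ih t
    have : Set.OrdConnected (Set.Ioo (-1:ℝ) 1) := Set.ordConnected_Ioo
    exact this.uIcc_subset ⟨by norm_num, by norm_num⟩ hx ht

lemma Int0_iter_bound {d : ℝ → ℝ} (hd : LI d) (k : ℕ) :
    ∀ x ∈ Set.Ioo (-1:ℝ) 1, |Int0^[k + 1] d x| ≤ ∫ t in Set.uIoc 0 x, |d t| := by
  induction k with
  | zero =>
    intro x hx
    simpa [Int0] using intervalIntegral.norm_integral_le_integral_norm_uIoc (f := d) (a := 0) (b := x)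
  | succ k ih =>
    intro x hx
    rw [Function.iterate_succ_apply']
    have := intervalIntegral.norm_integral_le_of_norm_le_const (a := 0) (b := x)
      (f := Int0^[k + 1] d) (C := ∫ t in Set.uIoc 0 x, |d t|) ?_
    · refine this.trans ?_
      have h0 : 0 ≤ ∫ t in Set.uIoc 0 x, |d t| := integral_nonneg (fun t => abs_nonneg _)
      have h1 : |x - 0| ≤ 1 := by rw [sub_zero]; exact (abs_lt.2 hx).le
      nlinarith
    · intro t ht
      refine (ih t (uIoc_sub hx ht)).trans ?_
      apply setIntegral_mono_set
      · exact (intervalIntegrable_iff.1 (hd x hx)).abs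
      · exact Eventually.of_forall (fun t => abs_nonneg _)
      · apply Filter.Eventually.of_forall
        intro s hs
        rw [Set.mem_uIoc] at ht
        have hs' := Set.mem_uIoc.1 hs
        refine Set.mem_uIoc.2 ?_
        rcases ht with ht | ht <;> rcases hs' with hs' | hs'
        · left; constructor <;> linarith
        · exfalso; linarith
        · exfalso; linarith
        · right; constructor <;> linarith

lemma poly_LI (p : Polynomial ℝ) : LI (fun y => p.eval y) :=
  cont_LI p.continuous.continuousOn

lemma taylor_exists (k : ℕ) : ∀ F : Polynomial ℝ, ∃ t : ℕ → ℝ, ∀ x : ℝ,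
    F.eval x - Int0^[k] (fun y => (Polynomial.derivative^[k] F).eval y) x =
      ∑ i ∈ Finset.range k, t i * x ^ i := by
  induction k with
  | zero => intro F; exact ⟨0, by simp⟩
  | succ k ih =>
    intro F
    obtain ⟨t, ht⟩ := ih F.derivative
    refine ⟨fun i => if i = 0 then F.eval 0 else t (i - 1) / i, fun x => ?_⟩
    rw [Function.iterate_succ_apply', Function.iterate_succ_apply]
    have e : Int0^[k] (fun y => (Polynomial.derivative^[k] F.derivative).eval y) =
        fun y => F.derivative.eval y - ∑ i ∈ Finset.range k, t i * y ^ i := by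
      ext y; linarith [ht y]
    rw [e]
    unfold Int0
    rw [intervalIntegral.integral_sub, intervalIntegral.integral_finsetSum, Finset.sum_range_succ']
    · have h1 : ∫ y in (0:ℝ)..x, F.derivative.eval y = F.eval x - F.eval 0 := by
        apply intervalIntegral.integral_eq_sub_of_hasDerivAt
        · intro y _; exact F.hasDerivAt y
        · exact F.derivative.continuous.intervalIntegrable _ _
      rw [h1]
      have h2 : ∀ i ∈ Finset.range k, ∫ y in (0:ℝ)..x, t i * y ^ i =
          t i / ((i:ℝ) + 1) * x ^ (i + 1) := by
        intro i _
        rw [intervalIntegral.integral_const_mul, integral_pow]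
        simp
        ring
      rw [Finset.sum_congr rfl h2]
      simp
      ring
    · intro i _
      exact (by fun_prop : Continuous fun y : ℝ => t i * y ^ i).intervalIntegrable _ _
    · exact F.derivative.continuous.intervalIntegrable _ _
    · exact (by fun_prop : Continuous fun y : ℝ => ∑ i ∈ Finset.range k, t i * y ^ i).intervalIntegrable _ _

lemma limit_repr (k : ℕ) (F : ℕ → Polynomial ℝ) (G g : ℝ → ℝ) (hg : LI g)
    (hF : ∀ x ∈ Set.Ioo (-1:ℝ) 1, Tendsto (fun M => (F M).eval x) atTop (nhds (G x)))
    (hd : ∀ x ∈ Set.Ioo (-1:ℝ) 1, Tendsto (fun M => ∫ t in Set.uIoc 0 x,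
      |(Polynomial.derivative^[k + 1] (F M)).eval t - g t|) atTop (nhds 0)) :
    ∃ T : Polynomial ℝ, ∀ x ∈ Set.Ioo (-1:ℝ) 1, G x = T.eval x + Int0^[k + 1] g x := by
  let v : Fin (k + 1) → (Set.Ioo (-1:ℝ) 1 → ℝ) := fun i x => (x : ℝ) ^ (i : ℕ)
  let V : Submodule ℝ (Set.Ioo (-1:ℝ) 1 → ℝ) := Submodule.span ℝ (Set.range v)
  have hfin : FiniteDimensional ℝ V := FiniteDimensional.span_of_finite ℝ (Set.finite_range v)
  have hcl : IsClosed (V : Set (Set.Ioo (-1:ℝ) 1 → ℝ)) := V.closed_of_finiteDimensional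
  let Tm : ℕ → (Set.Ioo (-1:ℝ) 1 → ℝ) := fun M x => (F M).eval (x:ℝ) -
    Int0^[k + 1] (fun y => (Polynomial.derivative^[k + 1] (F M)).eval y) x
  have hmem : ∀ M, Tm M ∈ V := by
    intro M
    obtain ⟨t, ht⟩ := taylor_exists (k + 1) (F M)
    rw [Submodule.mem_span_range_iff_exists_fun]
    refine ⟨fun i => t i, ?_⟩
    ext x
    simp only [Tm, v, ht, Finset.sum_apply, Pi.smul_apply, smul_eq_mul]
    rw [Finset.sum_range]
  have hlim : Tendsto Tm atTop (nhds (fun x => G x - Int0^[k + 1] g x)) := by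
    rw [tendsto_pi_nhds]
    intro x
    apply (hF x x.2).sub
    rw [tendsto_iff_norm_sub_tendsto_zero]
    refine squeeze_zero (fun _ => norm_nonneg _) (fun M => ?_) (hd x x.2)
    rw [← Int0_iter_sub (poly_LI _) hg (k + 1) x x.2]
    apply Int0_iter_bound _ k x x.2
    intro y hy
    exact (poly_LI _ y hy).sub (hg y hy)
  have := hcl.mem_of_tendsto hlim (Eventually.of_forall hmem)
  obtain ⟨c, hc⟩ := (Submodule.mem_span_range_iff_exists_fun ℝ).1 this
  refine ⟨∑ i : Fin (k + 1), Polynomial.C (c i) * Polynomial.X ^ (i : ℕ), fun x hx => ?_⟩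
  have h2 := congrFun hc ⟨x, hx⟩
  simp only [v, Finset.sum_apply, Pi.smul_apply, smul_eq_mul] at h2
  rw [Polynomial.eval_finsetSum]
  simp only [Polynomial.eval_mul, Polynomial.eval_C, Polynomial.eval_pow, Polynomial.eval_X]
  linarith


/-- Weighted measure on `(-1,1)`. -/
noncomputable def muJ (a b : ℝ) : Measure ℝ :=
  (volume.restrict (Set.Ioo (-1:ℝ) 1)).withDensity (fun x => ENNReal.ofReal (wJ a b x))

lemma wJ_meas (a b : ℝ) : Measurable (wJ a b) := by unfold wJ; fun_prop

lemma wJ_pos (a b x : ℝ) (hx : x ∈ Set.Ioo (-1:ℝ) 1) : 0 < wJ a b x :=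
  mul_pos (Real.rpow_pos_of_pos (by linarith [hx.2]) _) (Real.rpow_pos_of_pos (by linarith [hx.1]) _)

lemma muJ_integral (a b : ℝ) (f : ℝ → ℝ) :
    ∫ x, f x ∂(muJ a b) = ∫ x in (-1:ℝ)..1, f x * wJ a b x := by
  unfold muJ
  rw [integral_withDensity_eq_integral_toReal_smul (wJ_meas a b).ennreal_ofReal
    (Eventually.of_forall fun x => ENNReal.ofReal_lt_top),
    intervalIntegral.integral_of_le (by norm_num), integral_Ioc_eq_integral_Ioo]
  apply setIntegral_congr_fun measurableSet_Ioo
  intro x hx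
  simp only [smul_eq_mul]
  rw [ENNReal.toReal_ofReal (wJ_pos a b x hx).le, mul_comm]

lemma muJ_integrable (a b : ℝ) (f : ℝ → ℝ) :
    Integrable f (muJ a b) ↔ IntegrableOn (fun x => f x * wJ a b x) (Set.Ioo (-1:ℝ) 1) := by
  unfold muJ
  rw [integrable_withDensity_iff_integrable_smul' (wJ_meas a b).ennreal_ofReal
    (Eventually.of_forall fun x => ENNReal.ofReal_lt_top)]
  apply integrable_congr
  filter_upwards [ae_restrict_mem measurableSet_Ioo] with x hx
  rw [smul_eq_mul, ENNReal.toReal_ofReal (wJ_pos a b x hx).le, mul_comm]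

lemma muJ_memLp (a b : ℝ) (f : ℝ → ℝ) (hf : Measurable f)
    (hi : IntegrableOn (fun x => f x ^ 2 * wJ a b x) (Set.Ioo (-1:ℝ) 1)) :
    MemLp f 2 (muJ a b) := by
  rw [memLp_two_iff_integrable_sq hf.aestronglyMeasurable, muJ_integrable]
  exact hi

lemma poly_memLp (a b : ℝ) (ha : -1 < a) (hb : -1 < b) (p : Polynomial ℝ) :
    MemLp (fun x => p.eval x) 2 (muJ a b) := by
  apply muJ_memLp _ _ _ p.continuous.measurable
  have := poly_ii a b ha hb (p ^ 2)
  rw [intervalIntegrable_iff_integrableOn_Ioo_of_le (by norm_num)] at this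
  simpa using this

noncomputable def PL (a b : ℝ) (ha : -1 < a) (hb : -1 < b) :
    Polynomial ℝ →ₗ[ℝ] Lp ℝ 2 (muJ a b) where
  toFun p := (poly_memLp a b ha hb p).toLp _
  map_add' p q := by
    rw [← MemLp.toLp_add]
    congr 1
    ext x
    simp
  map_smul' c p := by
    rw [RingHom.id_apply, ← MemLp.toLp_const_smul]
    congr 1
    ext x
    simp

lemma toLp_inner (μ : Measure ℝ) (f g : ℝ → ℝ) (hf : MemLp f 2 μ) (hg : MemLp g 2 μ) :
    inner ℝ (hf.toLp f) (hg.toLp g) = ∫ x, f x * g x ∂μ := by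
  rw [L2.inner_def]
  apply integral_congr_ae
  filter_upwards [hf.coeFn_toLp, hg.coeFn_toLp] with x h1 h2
  rw [h1, h2]
  simp [mul_comm]

lemma toLp_norm_sq (μ : Measure ℝ) (f : ℝ → ℝ) (hf : MemLp f 2 μ) :
    ‖hf.toLp f‖ ^ 2 = ∫ x, f x ^ 2 ∂μ := by
  rw [← real_inner_self_eq_norm_sq, toLp_inner]
  simp only [sq]

lemma PL_inner (a b : ℝ) (ha : -1 < a) (hb : -1 < b) (p q : Polynomial ℝ) :
    inner ℝ (PL a b ha hb p) (PL a b ha hb q) =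
      ∫ x in (-1:ℝ)..1, (p * q).eval x * wJ a b x := by
  have := toLp_inner _ _ _ (poly_memLp a b ha hb p) (poly_memLp a b ha hb q)
  rw [muJ_integral] at this
  simp only [Polynomial.eval_mul]
  exact this

lemma PL_sub_norm_sq (a b : ℝ) (ha : -1 < a) (hb : -1 < b) (p : Polynomial ℝ) (f : ℝ → ℝ)
    (hf : MemLp f 2 (muJ a b)) :
    ‖PL a b ha hb p - hf.toLp f‖ ^ 2 = ∫ x in (-1:ℝ)..1, (p.eval x - f x) ^ 2 * wJ a b x := by
  have h1 : PL a b ha hb p - hf.toLp f = ((poly_memLp a b ha hb p).sub hf).toLp _ := by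
    rw [MemLp.toLp_sub (poly_memLp a b ha hb p) hf]
    rfl
  rw [h1, toLp_norm_sq, muJ_integral]
  rfl

/-- L¹ control by L² norm. -/
lemma PL_L1 (a b : ℝ) (ha : -1 < a) (hb : -1 < b) (p : Polynomial ℝ) (f : ℝ → ℝ)
    (hf : MemLp f 2 (muJ a b)) :
    IntegrableOn (fun x => (p.eval x - f x) * wJ a b x) (Set.Ioo (-1:ℝ) 1) ∧
    ∫ x in Set.Ioo (-1:ℝ) 1, |p.eval x - f x| * wJ a b x ≤
      ‖PL a b ha hb 1‖ * ‖PL a b ha hb p - hf.toLp f‖ := by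
  have h1 : PL a b ha hb p - hf.toLp f = ((poly_memLp a b ha hb p).sub hf).toLp _ := by
    rw [MemLp.toLp_sub (poly_memLp a b ha hb p) hf]
    rfl
  have hd := (poly_memLp a b ha hb p).sub hf
  have hone := poly_memLp a b ha hb 1
  constructor
  · rw [← muJ_integrable]
    have := hone.integrable_mul hd
    refine this.congr (Eventually.of_forall fun x => ?_)
    simp
  · have h2 := real_inner_le_norm (hone.toLp _) (hd.abs.toLp _)
    rw [toLp_inner, muJ_integral] at h2
    have h3 : ‖hd.abs.toLp _‖ = ‖hd.toLp _‖ := by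
      rw [← sq_eq_sq₀ (norm_nonneg _) (norm_nonneg _), toLp_norm_sq, toLp_norm_sq]
      simp
    rw [h3, intervalIntegral.integral_of_le (by norm_num), integral_Ioc_eq_integral_Ioo] at h2
    rw [h1]
    refine le_trans (le_of_eq ?_) h2
    simp

section abstract_part
variable {H H' : Type*} [NormedAddCommGroup H] [InnerProductSpace ℝ H]
  [NormedAddCommGroup H'] [InnerProductSpace ℝ H']

lemma orth_norm (x : ℕ → H) (hx : ∀ i j, i ≠ j → inner ℝ (x i) (x j) = 0) (s : Finset ℕ) :
    ‖∑ n ∈ s, x n‖ ^ 2 = ∑ n ∈ s, ‖x n‖ ^ 2 := by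
  rw [← real_inner_self_eq_norm_sq, sum_inner]
  apply Finset.sum_congr rfl
  intro i hi
  rw [inner_sum, Finset.sum_eq_single i]
  · exact real_inner_self_eq_norm_sq _
  · intro j _ hj; exact hx i j hj.symm
  · intro h; exact absurd hi h

lemma Icc_sum_sub {G : Type*} [AddCommGroup G] (x : ℕ → G) (l N M : ℕ) (hl : l ≤ N) (hM : N ≤ M) :
    ∑ n ∈ Finset.Icc l M, x n - ∑ n ∈ Finset.Icc l N, x n = ∑ n ∈ Finset.Ioc N M, x n := by
  rw [sub_eq_iff_eq_add, add_comm, ← Finset.sum_union]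
  · congr 1
    ext i; simp; omega
  · rw [Finset.disjoint_left]
    intro i; simp; omega

lemma abs_est (x : ℕ → H) (y : ℕ → H') (hx : ∀ i j, i ≠ j → inner ℝ (x i) (x j) = 0)
    (hy : ∀ i j, i ≠ j → inner ℝ (y i) (y j) = 0) (l m N : ℕ) (hlm : l ≤ m) (hmN : m ≤ N)
    (F : H) (F' : H') (hF : Tendsto (fun M => ∑ n ∈ Finset.Icc l M, x n) atTop (nhds F))
    (hF' : Tendsto (fun M => ∑ n ∈ Finset.Icc m M, y n) atTop (nhds F')) (K : ℝ) (hK : 0 ≤ K)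
    (hle : ∀ n, N < n → ‖x n‖ ^ 2 ≤ K * ‖y n‖ ^ 2) :
    ‖∑ n ∈ Finset.Icc l N, x n - F‖ ^ 2 ≤ K * ‖F'‖ ^ 2 := by
  have h1 : Tendsto (fun M => ‖∑ n ∈ Finset.Icc l N, x n - ∑ n ∈ Finset.Icc l M, x n‖ ^ 2) atTop
      (nhds (‖∑ n ∈ Finset.Icc l N, x n - F‖ ^ 2)) := ((hF.const_sub _).norm).pow 2
  have h2 : Tendsto (fun M => K * ‖∑ n ∈ Finset.Icc m M, y n‖ ^ 2) atTop
      (nhds (K * ‖F'‖ ^ 2)) := ((hF'.norm).pow 2).const_mul K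
  refine le_of_tendsto_of_tendsto h1 h2 ?_
  filter_upwards [eventually_ge_atTop N] with M hM
  rw [norm_sub_rev, Icc_sum_sub x l N M (by omega) hM, orth_norm x hx, orth_norm y hy,
    Finset.mul_sum]
  refine (Finset.sum_le_sum (g := fun n => K * ‖y n‖ ^ 2) ?_).trans ?_
  · intro n hn; simp at hn; exact hle n hn.1
  · apply Finset.sum_le_sum_of_subset_of_nonneg
    · intro n; simp; omega
    · intro n _ _; positivity

lemma abs_cauchy [CompleteSpace H'] (x : ℕ → H) (y : ℕ → H')
    (hx : ∀ i j, i ≠ j → inner ℝ (x i) (x j) = 0)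
    (hy : ∀ i j, i ≠ j → inner ℝ (y i) (y j) = 0) (l : ℕ)
    (F : H) (hF : Tendsto (fun M => ∑ n ∈ Finset.Icc l M, x n) atTop (nhds F))
    (hle : ∀ n, l ≤ n → ‖y n‖ ^ 2 ≤ ‖x n‖ ^ 2) :
    ∃ f : H', Tendsto (fun M => ∑ n ∈ Finset.Icc 0 M, y n) atTop (nhds f) := by
  apply cauchySeq_tendsto_of_complete
  rw [Metric.cauchySeq_iff']
  intro ε hε
  have hc := Metric.cauchySeq_iff.1 hF.cauchySeq ε hε
  obtain ⟨N, hN⟩ := hc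
  refine ⟨max N l, fun M hM => ?_⟩
  have hM1 : N ≤ M := (le_max_left _ _).trans hM
  have h1 := hN M hM1 (max N l) (le_max_left _ _)
  refine lt_of_le_of_lt ?_ h1
  rw [dist_eq_norm, dist_eq_norm, Icc_sum_sub _ _ _ _ (Nat.zero_le _) hM,
    Icc_sum_sub _ _ _ _ (le_max_right _ _) hM, ← sq_le_sq₀ (norm_nonneg _) (norm_nonneg _),
    orth_norm x hx, orth_norm y hy]
  apply Finset.sum_le_sum
  intro n hn
  simp at hn
  exact hle n (by omega)

end abstract_part

lemma lamJ_ge (b : ℝ) (hb : -1 < b) (N n j : ℕ) (hj : j ≤ N) (hn : N < n) :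
    (N : ℝ) * ((N + 1 - j : ℕ) : ℝ) ≤ lamJ b n j := by
  unfold lamJ
  have h1 : ((N + 1 - j : ℕ) : ℝ) = (N:ℝ) + 1 - j := by
    rw [Nat.cast_sub (by omega)]; push_cast; ring
  have h2 : (N:ℝ) + 1 ≤ n := by exact_mod_cast hn
  have h3 : (j:ℝ) ≤ N := by exact_mod_cast hj
  have h4 : (0:ℝ) ≤ j := by positivity
  rw [h1, mul_comm]
  apply mul_le_mul <;> linarith

lemma ipJ_growth (b : ℝ) (hb : -1 < b) (N n l d : ℕ) (hj : l + d ≤ N) (hn : N < n) :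
    (N : ℝ) ^ d * ((N + 1 - l).descFactorial d : ℝ) * ipJ 0 b l n n ≤ ipJ 0 b (l + d) n n := by
  induction d with
  | zero => simp
  | succ d ih =>
    rw [← add_assoc, ipJ_succ 0 b (by norm_num) hb, zero_add, Nat.descFactorial_succ]
    have h1 := lamJ_ge b hb N n (l + d) (by omega) hn
    have h2 := ih (by omega)
    have h3 := ipJ_self_nonneg 0 b (l + d) n
    rw [show N + 1 - (l + d) = N + 1 - l - d by omega] at h1
    calc (N : ℝ) ^ (d + 1) * (((N + 1 - l - d) * (N + 1 - l).descFactorial d : ℕ) : ℝ) * ipJ 0 b l n n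
        = ((N : ℝ) * ((N + 1 - l - d : ℕ) : ℝ)) *
          ((N : ℝ) ^ d * ((N + 1 - l).descFactorial d : ℝ) * ipJ 0 b l n n) := by
          push_cast; ring
      _ ≤ ((N : ℝ) * ((N + 1 - l - d : ℕ) : ℝ)) * ipJ 0 b (l + d) n n :=
          mul_le_mul_of_nonneg_left h2 (by positivity)
      _ ≤ _ := mul_le_mul_of_nonneg_right h1 h3

lemma ipJ_mono (b : ℝ) (hb : -1 < b) (n l : ℕ) (hl : l ≤ n) :
    ipJ 0 b 0 n n ≤ ipJ 0 b l n n := by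
  induction l with
  | zero => exact le_rfl
  | succ l ih =>
    rw [ipJ_succ 0 b (by norm_num) hb, zero_add]
    refine (ih (by omega)).trans ?_
    apply le_mul_of_one_le_left (ipJ_self_nonneg 0 b l n)
    unfold lamJ
    have h2 : (l:ℝ) + 1 ≤ n := by exact_mod_cast hl
    have h4 : (0:ℝ) ≤ l := by positivity
    nlinarith


lemma cont_mul_int (w f : ℝ → ℝ) (hw : IntegrableOn w (Set.Ioo (-1:ℝ) 1)) (hf : Continuous f) :
    IntegrableOn (fun x => f x * w x) (Set.Ioo (-1:ℝ) 1) := by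
  rw [← integrableOn_Icc_iff_integrableOn_Ioo] at hw ⊢
  exact hw.continuousOn_mul hf.continuousOn isCompact_Icc

lemma moments_zero (w : ℝ → ℝ) (hw : IntegrableOn w (Set.Ioo (-1:ℝ) 1))
    (h : ∀ p : Polynomial ℝ, ∫ x in Set.Ioo (-1:ℝ) 1, p.eval x * w x = 0) :
    ∀ᵐ x ∂(volume.restrict (Set.Ioo (-1:ℝ) 1)), w x = 0 := by
  rw [ae_restrict_iff' measurableSet_Ioo]
  apply isOpen_Ioo.ae_eq_zero_of_integral_contDiff_smul_eq_zero hw.locallyIntegrableOn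
  intro g hg _ hs
  have h0 : ∫ x, g x • w x = ∫ x in Set.Ioo (-1:ℝ) 1, g x * w x := by
    symm
    apply setIntegral_eq_integral_of_forall_compl_eq_zero
    intro x hx
    have : g x = 0 := by
      by_contra hne
      exact hx (hs (subset_tsupport g hne))
    simp [this]
  rw [h0]
  have hC : 0 ≤ ∫ x in Set.Ioo (-1:ℝ) 1, ‖w x‖ := integral_nonneg fun x => norm_nonneg _
  set C := ∫ x in Set.Ioo (-1:ℝ) 1, ‖w x‖ with hCd
  rw [← norm_le_zero_iff]
  apply le_of_forall_pos_le_add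
  intro ε hε
  rw [zero_add]
  obtain ⟨p, hp⟩ := exists_polynomial_near_of_continuousOn (-1) 1 g hg.continuous.continuousOn
    (ε / (C + 1)) (by positivity)
  have h1 : ∫ x in Set.Ioo (-1:ℝ) 1, g x * w x =
      ∫ x in Set.Ioo (-1:ℝ) 1, (g x * w x - p.eval x * w x) := by
    rw [integral_sub (cont_mul_int w g hw hg.continuous) (cont_mul_int w _ hw p.continuous), h p,
      sub_zero]
  rw [h1]
  have h2 : ∀ᵐ x ∂(volume.restrict (Set.Ioo (-1:ℝ) 1)),
      ‖g x * w x - p.eval x * w x‖ ≤ ε / (C + 1) * ‖w x‖ := by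
    filter_upwards [ae_restrict_mem measurableSet_Ioo] with x hx
    rw [← sub_mul, norm_mul]
    apply mul_le_mul_of_nonneg_right _ (norm_nonneg _)
    rw [norm_sub_rev]
    exact (hp x ⟨hx.1.le, hx.2.le⟩).le
  refine (norm_integral_le_of_norm_le (hw.norm.const_mul _) h2).trans ?_
  rw [integral_const_mul, ← hCd, div_mul_eq_mul_div, div_le_iff₀ (by positivity)]
  nlinarith

lemma jp_coeff_ne (a b : ℝ) (h : -1 < a + b) (n : ℕ) : (jp a b n).coeff n ≠ 0 := by
  intro h0
  have h1 := jp_iter_self a b n 0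
  rw [← Polynomial.coeff_zero_eq_eval_zero, Polynomial.coeff_iterate_derivative] at h1
  simp [h0] at h1
  have := ascPochhammer_pos n ((n : ℝ) + a + b + 1) (by
    have : (0:ℝ) ≤ n := by positivity
    linarith)
  have h2 : (0:ℝ) < 2 ^ n := by positivity
  have := div_pos this h2
  linarith

lemma jp_span (a b : ℝ) (h : -1 < a + b) (w : ℝ → ℝ) (hw : IntegrableOn w (Set.Ioo (-1:ℝ) 1))
    (hj : ∀ n, ∫ x in Set.Ioo (-1:ℝ) 1, (jp a b n).eval x * w x = 0) (p : Polynomial ℝ) :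
    ∫ x in Set.Ioo (-1:ℝ) 1, p.eval x * w x = 0 := by
  have key : ∀ d : ℕ, ∀ p : Polynomial ℝ, p.degree < d →
      ∫ x in Set.Ioo (-1:ℝ) 1, p.eval x * w x = 0 := by
    intro d
    induction d with
    | zero =>
      intro p hp
      have : p = 0 := by
        rw [← Polynomial.degree_eq_bot]
        simpa using hp
      simp [this]
    | succ d ih =>
      intro p hp
      set c := p.coeff d / (jp a b d).coeff d with hc
      have hq : (p - Polynomial.C c * jp a b d).degree < d := by
        rw [Polynomial.degree_lt_iff_coeff_zero]
        intro k hk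
        rw [Polynomial.coeff_sub, Polynomial.coeff_C_mul]
        rcases hk.eq_or_lt with rfl | hk
        · rw [hc, div_mul_cancel₀ _ (jp_coeff_ne a b h _), sub_self]
        · rw [(Polynomial.degree_lt_iff_coeff_zero _ _).1 hp k (by omega),
            Polynomial.coeff_eq_zero_of_natDegree_lt ((jp_natDegree_le a b d).trans_lt hk)]
          simp
      have h1 := ih _ hq
      simp only [Polynomial.eval_sub, Polynomial.eval_mul, Polynomial.eval_C, sub_mul] at h1
      simp only [mul_assoc] at h1
      rw [integral_sub (cont_mul_int w _ hw p.continuous)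
        ((cont_mul_int w _ hw (jp a b d).continuous).const_mul c), integral_const_mul, hj d,
        mul_zero, sub_zero] at h1
      exact h1
  exact key (p.natDegree + 1) p (lt_of_le_of_lt p.degree_le_natDegree (by exact_mod_cast Nat.lt_succ_self _))

lemma Iplus_lin (ρ x : ℝ) (s : Finset ℕ) (c : ℕ → ℝ) (f : ℕ → ℝ → ℝ)
    (hf : ∀ n, IntervalIntegrable (fun y => (y - x) ^ (ρ - 1) * f n y) volume x 1) :
    IntervalIntegrable (fun y => (y - x) ^ (ρ - 1) * ∑ n ∈ s, c n * f n y) volume x 1 ∧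
    Iplus ρ (fun y => ∑ n ∈ s, c n * f n y) x = ∑ n ∈ s, c n * Iplus ρ (f n) x := by
  have e : (fun y => (y - x) ^ (ρ - 1) * ∑ n ∈ s, c n * f n y) =
      fun y => ∑ n ∈ s, c n * ((y - x) ^ (ρ - 1) * f n y) := by
    ext y
    rw [Finset.mul_sum]
    exact Finset.sum_congr rfl fun n _ => by ring
  constructor
  · rw [e]
    have := IntervalIntegrable.sum s (f := fun n y => c n * ((y - x) ^ (ρ - 1) * f n y))
      (μ := volume) (a := x) (b := 1) fun n _ => (hf n).const_mul (c n)
    rw [show (fun y => ∑ n ∈ s, c n * ((y - x) ^ (ρ - 1) * f n y)) =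
      ∑ n ∈ s, fun y => c n * ((y - x) ^ (ρ - 1) * f n y) by ext y; simp]
    exact this
  · unfold Iplus
    rw [e, intervalIntegral.integral_finsetSum fun n _ => (hf n).const_mul (c n), Finset.mul_sum]
    apply Finset.sum_congr rfl
    intro n _
    rw [intervalIntegral.integral_const_mul]
    ring

lemma Iplus_sub (ρ x : ℝ) (f g : ℝ → ℝ)
    (hf : IntervalIntegrable (fun y => (y - x) ^ (ρ - 1) * f y) volume x 1)
    (hg : IntervalIntegrable (fun y => (y - x) ^ (ρ - 1) * g y) volume x 1) :
    Iplus ρ (fun y => f y - g y) x = Iplus ρ f x - Iplus ρ g x := by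
  unfold Iplus
  simp only [mul_sub]
  rw [intervalIntegral.integral_sub hf hg]
  ring

lemma Iplus_ae_congr (ρ x : ℝ) (hx : x ∈ Set.Ioo (-1:ℝ) 1) (f g : ℝ → ℝ)
    (h : ∀ᵐ y ∂(volume.restrict (Set.Ioo (-1:ℝ) 1)), f y = g y) :
    (fun y => (y - x) ^ (ρ - 1) * f y) =ᵐ[volume.restrict (Set.Ioo x 1)]
      (fun y => (y - x) ^ (ρ - 1) * g y) ∧ Iplus ρ f x = Iplus ρ g x := by
  have h1 : (fun y => (y - x) ^ (ρ - 1) * f y) =ᵐ[volume.restrict (Set.Ioo x 1)]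
      (fun y => (y - x) ^ (ρ - 1) * g y) := by
    have := ae_mono (Measure.restrict_mono (Set.Ioo_subset_Ioo_left hx.1.le) le_rfl) h
    filter_upwards [this] with y hy
    rw [hy]
  refine ⟨h1, ?_⟩
  unfold Iplus
  rw [intervalIntegral.integral_of_le hx.2.le, intervalIntegral.integral_of_le hx.2.le,
    integral_Ioc_eq_integral_Ioo, integral_Ioc_eq_integral_Ioo, integral_congr_ae h1]

lemma poly_Iplus_ii (ρ x : ℝ) (hρ : 0 < ρ) (hx : x < 1) (p : Polynomial ℝ) :
    IntervalIntegrable (fun y => (y - x) ^ (ρ - 1) * p.eval y) volume x 1 := by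
  have h0 := Iplus_pow_ii ρ 0 x hρ (by norm_num) hx
  simp only [Real.rpow_zero, mul_one] at h0
  exact h0.mul_continuousOn p.continuous.continuousOn

lemma Iplus_ae_ii (c σ α : ℝ) (h : ℝ → ℝ) (hm : Measurable h) (hσ : 0 < σ) (hα : 0 < α)
    (hi : IntegrableOn (fun z => (z - c) ^ (σ + α - 1) * h z) (Set.Ioo c 1)) :
    ∀ᵐ y ∂(volume.restrict (Set.Ioo c 1)),
      IntervalIntegrable (fun z => (z - y) ^ (α - 1) * h z) volume y 1 := by
  filter_upwards [(kerF_int c σ α h hm hσ hα hi).prod_right_ae, ae_restrict_mem measurableSet_Ioo]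
    with y hy hy2
  rw [intervalIntegrable_iff_integrableOn_Ioo_of_le hy2.2.le]
  have h1 : IntegrableOn (fun z => kerF c σ α h (y, z)) (Set.Ioo y 1) :=
    IntegrableOn.mono_set hy (Set.Ioo_subset_Ioo_left hy2.1.le)
  have h2 := h1.const_mul ((y - c) ^ (σ - 1))⁻¹
  refine (integrableOn_congr_fun ?_ measurableSet_Ioo).1 h2
  intro z hz
  have : (y - c) ^ (σ - 1) ≠ 0 := (Real.rpow_pos_of_pos (by linarith [hy2.1]) _).ne'
  simp only [kerF, hz.1, if_true]
  field_simp


noncomputable def fP (α β : ℝ) (uhat : ℕ → ℝ) (M : ℕ) : Polynomial ℝ :=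
  ∑ n ∈ Finset.range (M + 1), Polynomial.C (uhat n * cJ α n) * jp 0 (α + β) n

lemma Iplus_fP (α β x : ℝ) (hα : 0 < α) (hx : x < 1) (uhat : ℕ → ℝ) (M : ℕ) :
    Iplus α (fun y => (fP α β uhat M).eval y) x =
      ∑ n ∈ Finset.range (M + 1), uhat n * gJ α β n x := by
  have e : (fun y => (fP α β uhat M).eval y) = fun y => ∑ n ∈ Finset.range (M + 1),
      (uhat n * cJ α n) * (jp 0 (α + β) n).eval y := by
    ext y
    simp [fP, Polynomial.eval_finsetSum]
  rw [e, (Iplus_lin α x _ _ (fun n y => (jp 0 (α + β) n).eval y)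
    (fun n => poly_Iplus_ii α x hα hx _)).2]
  apply Finset.sum_congr rfl
  intro n _
  rw [mul_assoc, Iplus_jp α β x hα hx n]

lemma h_int (b : ℝ) (hb : -1 < b) (h : ℝ → ℝ) (hL : MemLp h 2 (muJ 0 b)) :
    IntegrableOn (fun z => (1 + z) ^ b * h z) (Set.Ioo (-1:ℝ) 1) := by
  have h1 := (PL_L1 0 b (by norm_num) hb 0 h hL).1
  have h2 := h1.neg
  refine h2.congr (Eventually.of_forall fun x => ?_)
  simp [wJ]
  ring

lemma v_int (α β : ℝ) (hα : 0 < α) (hβ : -1 < β) (h : ℝ → ℝ) (hm : Measurable h)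
    (hL : MemLp h 2 (muJ 0 (α + β))) :
    IntegrableOn (fun y => (1 + y) ^ β * Iplus α h y) (Set.Ioo (-1:ℝ) 1) := by
  have h1 := h_int (α + β) (by linarith) h hL
  have h2 := frac_int_s13 (-1) (β + 1) α h hm (by linarith) hα (by
    refine h1.congr (Eventually.of_forall fun x => ?_)
    simp only
    congr 2 <;> ring)
  refine h2.congr (Eventually.of_forall fun x => ?_)
  simp only
  congr 2 <;> ring

lemma v_diff (α β : ℝ) (hα : 0 < α) (hβ : -1 < β) (h : ℝ → ℝ) (hm : Measurable h)
    (hL : MemLp h 2 (muJ 0 (α + β))) (hb : -1 < α + β) (p : Polynomial ℝ) :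
    ∫ y in Set.Ioo (-1:ℝ) 1, |(1 + y) ^ β * (Iplus α (fun z => p.eval z) y - Iplus α h y)| ≤
      Real.Gamma (β + 1) / Real.Gamma (β + 1 + α) *
        (‖PL 0 (α + β) (by norm_num) hb 1‖ * ‖PL 0 (α + β) (by norm_num) hb p - hL.toLp h‖) := by
  have h1 := PL_L1 0 (α + β) (by norm_num) hb p h hL
  have hmd : Measurable (fun z => p.eval z - h z) := p.continuous.measurable.sub hm
  have e : ∀ (f : ℝ → ℝ) (z : ℝ), (z - -1) ^ (β + 1 + α - 1) * f z = f z * wJ 0 (α + β) z := by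
    intro f z
    simp only [wJ, Real.rpow_zero, one_mul]
    rw [mul_comm]
    congr 2 <;> ring
  have hi : IntegrableOn (fun z => (z - -1) ^ (β + 1 + α - 1) * (p.eval z - h z)) (Set.Ioo (-1:ℝ) 1) := by
    refine h1.1.congr (Eventually.of_forall fun x => ?_)
    exact (e (fun z => p.eval z - h z) x).symm
  have hih : IntegrableOn (fun z => (z - -1) ^ (β + 1 + α - 1) * h z) (Set.Ioo (-1:ℝ) 1) := by
    refine (h_int (α + β) hb h hL).congr (Eventually.of_forall fun x => ?_)
    simp only
    congr 2 <;> ring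
  have h2 := frac_le (-1) (β + 1) α _ hmd (by linarith) hα hi
  have h3 := Iplus_ae_ii (-1) (β + 1) α h hm (by linarith) hα hih
  have h4 : ∫ y in Set.Ioo (-1:ℝ) 1, |(1 + y) ^ β * (Iplus α (fun z => p.eval z) y - Iplus α h y)| =
      ∫ y in Set.Ioo (-1:ℝ) 1, |(y - -1) ^ (β + 1 - 1) * Iplus α (fun z => p.eval z - h z) y| := by
    apply integral_congr_ae
    filter_upwards [h3, ae_restrict_mem measurableSet_Ioo] with y hy hy2
    rw [Iplus_sub α y _ _ (poly_Iplus_ii α y hα hy2.2 p) hy]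
    congr 3 <;> ring
  rw [h4]
  refine h2.trans ?_
  apply mul_le_mul_of_nonneg_left
  · refine le_trans (le_of_eq ?_) h1.2
    apply setIntegral_congr_fun measurableSet_Ioo
    intro z hz
    simp only
    rw [e (fun z => p.eval z - h z) z, abs_mul, abs_of_pos (wJ_pos _ _ z hz)]
  · have := Real.Gamma_pos_of_pos (show 0 < β + 1 by linarith)
    have := Real.Gamma_pos_of_pos (show 0 < β + 1 + α by linarith)
    positivity

lemma gammaJ_pos (α β : ℝ) (hα : 0 < α) (hβ : -1 < β) (n : ℕ) : 0 < gammaJ α β n := by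
  unfold gammaJ
  have : (0:ℝ) ≤ n := by positivity
  have := Real.Gamma_pos_of_pos (show 0 < (n:ℝ) + α + 1 by linarith)
  have := Real.Gamma_pos_of_pos (show 0 < (n:ℝ) + β + 1 by linarith)
  have := Real.Gamma_pos_of_pos (show 0 < (n:ℝ) + α + β + 1 by linarith)
  have : 0 < 2 * (n:ℝ) + α + β + 1 := by linarith
  positivity

/-- moments of the truncated expansion -/
lemma uM_mom (α β : ℝ) (hα : 0 < α) (hβ : -1 < β) (uhat : ℕ → ℝ) (n M : ℕ) (hM : n ≤ M) :
    IntegrableOn (fun x => (1 + x) ^ β * Iplus α (fun y => (fP α β uhat M).eval y) x)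
      (Set.Ioo (-1:ℝ) 1) ∧
    ∫ x in Set.Ioo (-1:ℝ) 1, (jp α β n).eval x *
      ((1 + x) ^ β * Iplus α (fun y => (fP α β uhat M).eval y) x) = uhat n * gammaJ α β n := by
  have e : ∀ x ∈ Set.Ioo (-1:ℝ) 1, (∑ k ∈ Finset.range (M + 1), Polynomial.C (uhat k) * jp α β k).eval x
      * wJ α β x = (1 + x) ^ β * Iplus α (fun y => (fP α β uhat M).eval y) x := by
    intro x hx
    rw [Iplus_fP α β x hα hx.2]
    simp only [Polynomial.eval_finsetSum, Polynomial.eval_mul, Polynomial.eval_C, jp_eval, gJ, wJ,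
      Finset.mul_sum, Finset.sum_mul]
    apply Finset.sum_congr rfl
    intro k _
    ring
  constructor
  · have := poly_ii α β (by linarith) hβ (∑ k ∈ Finset.range (M + 1), Polynomial.C (uhat k) * jp α β k)
    rw [intervalIntegrable_iff_integrableOn_Ioo_of_le (by norm_num)] at this
    exact (integrableOn_congr_fun e measurableSet_Ioo).1 this
  · have e2 : ∀ x ∈ Set.Ioo (-1:ℝ) 1, (jp α β n).eval x *
      ((1 + x) ^ β * Iplus α (fun y => (fP α β uhat M).eval y) x) =
        ∑ k ∈ Finset.range (M + 1), uhat k * ((jp α β n * jp α β k).eval x * wJ α β x) := by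
      intro x hx
      rw [← e x hx]
      simp only [Polynomial.eval_finsetSum, Polynomial.eval_mul, Polynomial.eval_C, Finset.mul_sum, Finset.sum_mul]
      apply Finset.sum_congr rfl
      intro k _
      ring
    have hii : ∀ k, IntegrableOn (fun x => (jp α β n * jp α β k).eval x * wJ α β x) (Set.Ioo (-1:ℝ) 1) := by
      intro k
      have := poly_ii α β (by linarith) hβ (jp α β n * jp α β k)
      rwa [intervalIntegrable_iff_integrableOn_Ioo_of_le (by norm_num)] at this
    have hip : ∀ k, ∫ x in Set.Ioo (-1:ℝ) 1, (jp α β n * jp α β k).eval x * wJ α β x = ipJ α β 0 n k := by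
      intro k
      unfold ipJ
      rw [intervalIntegral.integral_of_le (by norm_num), integral_Ioc_eq_integral_Ioo]
      simp
    rw [setIntegral_congr_fun measurableSet_Ioo e2,
      integral_finsetSum _ (fun k _ => (hii k).const_mul _), Finset.sum_eq_single n]
    · rw [integral_const_mul, hip, ipJ_gamma α β (by linarith) hβ (by linarith)]
    · intro k _ hk
      rw [integral_const_mul, hip, ipJ_ne α β (by linarith) hβ (by linarith) _ _ _ hk.symm, mul_zero]
    · intro hn
      simp at hn
      omega

lemma v_mom (α β : ℝ) (hα : 0 < α) (hβ : -1 < β) (h : ℝ → ℝ) (hm : Measurable h)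
    (hL : MemLp h 2 (muJ 0 (α + β))) (hb : -1 < α + β) (uhat : ℕ → ℝ)
    (ht : Tendsto (fun M => PL 0 (α + β) (by norm_num) hb (fP α β uhat M)) atTop
      (nhds (hL.toLp h))) (n : ℕ) :
    ∫ x in Set.Ioo (-1:ℝ) 1, (jp α β n).eval x * ((1 + x) ^ β * Iplus α h x) =
      uhat n * gammaJ α β n := by
  obtain ⟨B, hB⟩ := isCompact_Icc.exists_bound_of_continuousOn
    (s := Set.Icc (-1:ℝ) 1) (f := fun x => (jp α β n).eval x) (jp α β n).continuous.continuousOn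
  set I := ∫ x in Set.Ioo (-1:ℝ) 1, (jp α β n).eval x * ((1 + x) ^ β * Iplus α h x) with hI
  set CC := Real.Gamma (β + 1) / Real.Gamma (β + 1 + α) with hCC
  have hB0 : 0 ≤ B := (norm_nonneg _).trans (hB 0 (by norm_num))
  have h1 : Tendsto (fun M => B * (CC * (‖PL 0 (α + β) (by norm_num) hb 1‖ *
      ‖PL 0 (α + β) (by norm_num) hb (fP α β uhat M) - hL.toLp h‖))) atTop (nhds 0) := by
    have := (ht.sub_const (hL.toLp h)).norm
    simp only [sub_self, norm_zero] at this
    have := ((this.const_mul ‖PL 0 (α + β) (by norm_num) hb 1‖).const_mul CC).const_mul B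
    simpa using this
  have h2 : ∀ᶠ M in atTop, |uhat n * gammaJ α β n - I| ≤ B * (CC * (‖PL 0 (α + β) (by norm_num) hb 1‖ *
      ‖PL 0 (α + β) (by norm_num) hb (fP α β uhat M) - hL.toLp h‖)) := by
    filter_upwards [eventually_ge_atTop n] with M hM
    have h3 := uM_mom α β hα hβ uhat n M hM
    have h4 := v_int α β hα hβ h hm hL
    rw [← h3.2, hI, ← integral_sub (cont_mul_int _ _ h3.1 (jp α β n).continuous)
      (cont_mul_int _ _ h4 (jp α β n).continuous)]
    refine le_trans ?_ (mul_le_mul_of_nonneg_left (v_diff α β hα hβ h hm hL hb (fP α β uhat M)) hB0)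
    rw [← integral_const_mul, ← Real.norm_eq_abs]
    apply norm_integral_le_of_norm_le
    · refine Integrable.const_mul ?_ B
      refine ((h3.1.sub h4).abs).congr (Eventually.of_forall fun x => ?_)
      simp [mul_sub]
    · filter_upwards [ae_restrict_mem measurableSet_Ioo] with x hx
      rw [← mul_sub, ← mul_sub, norm_mul, Real.norm_eq_abs ((1 + x) ^ β * _)]
      exact mul_le_mul_of_nonneg_right (hB x ⟨hx.1.le, hx.2.le⟩) (abs_nonneg _)
  have h5 := ge_of_tendsto h1 h2
  have := abs_nonpos_iff.1 h5
  linarith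

lemma u_int (α β : ℝ) (hα : 0 < α) (hβ : -1 < β) (u : ℝ → ℝ)
    (hum : AEStronglyMeasurable u (volume.restrict (Set.Ioo (-1:ℝ) 1)))
    (hu : IntegrableOn (fun x => (u x) ^ 2 * ((1 - x) ^ (-α) * (1 + x) ^ β))
      (Set.Ioo (-1 : ℝ) 1)) :
    IntegrableOn (fun x => (1 + x) ^ β * u x) (Set.Ioo (-1:ℝ) 1) := by
  have h1 := wJ_ii α β (by linarith) hβ
  rw [intervalIntegrable_iff_integrableOn_Ioo_of_le (by norm_num)] at h1
  refine (hu.add h1).mono' ?_ ?_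
  · apply AEStronglyMeasurable.mul _ hum
    exact (by fun_prop : Measurable fun x : ℝ => (1 + x) ^ β).aestronglyMeasurable
  · filter_upwards [ae_restrict_mem measurableSet_Ioo] with x hx
    have hx1 : 0 < 1 - x := by linarith [hx.2]
    have hx2 : 0 < 1 + x := by linarith [hx.1]
    have p1 : 0 < (1 - x) ^ α := Real.rpow_pos_of_pos hx1 _
    have p2 : 0 < (1 + x) ^ β := Real.rpow_pos_of_pos hx2 _
    rw [norm_mul, Real.norm_of_nonneg p2.le, Real.norm_eq_abs]
    simp only [Pi.add_apply, wJ]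
    rw [Real.rpow_neg hx1.le]
    set s := (1 - x) ^ α
    set t := (1 + x) ^ β
    have : |u x| ≤ u x ^ 2 * s⁻¹ + s := by
      have h3 : u x ^ 2 * s⁻¹ + s - |u x| = ((|u x| - s / 2) ^ 2 + 3 / 4 * s ^ 2) * s⁻¹ := by
        field_simp
        rw [← sq_abs (u x)]
        ring
      have : 0 ≤ ((|u x| - s / 2) ^ 2 + 3 / 4 * s ^ 2) * s⁻¹ := by positivity
      linarith
    calc t * |u x| ≤ t * (u x ^ 2 * s⁻¹ + s) := mul_le_mul_of_nonneg_left this p2.le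
      _ = _ := by ring

lemma u_eq_v (α β : ℝ) (hα : 0 < α) (hβ : -1 < β) (u : ℝ → ℝ)
    (hum : AEStronglyMeasurable u (volume.restrict (Set.Ioo (-1:ℝ) 1)))
    (hu : IntegrableOn (fun x => (u x) ^ 2 * ((1 - x) ^ (-α) * (1 + x) ^ β))
      (Set.Ioo (-1 : ℝ) 1)) (uhat : ℕ → ℝ)
    (huhat : ∀ n : ℕ, uhat n = (1 / gammaJ α β n) *
      ∫ x in (-1 : ℝ)..1,
        u x * ((1 - x) ^ α * jacobiP α β n x) * ((1 - x) ^ (-α) * (1 + x) ^ β))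
    (h : ℝ → ℝ) (hm : Measurable h)
    (hL : MemLp h 2 (muJ 0 (α + β))) (hb : -1 < α + β)
    (ht : Tendsto (fun M => PL 0 (α + β) (by norm_num) hb (fP α β uhat M)) atTop
      (nhds (hL.toLp h))) :
    ∀ᵐ x ∂(volume.restrict (Set.Ioo (-1:ℝ) 1)), u x = Iplus α h x := by
  have h1 := u_int α β hα hβ u hum hu
  have h2 := v_int α β hα hβ h hm hL
  have h3 : ∀ n, ∫ x in Set.Ioo (-1:ℝ) 1, (jp α β n).eval x * ((1 + x) ^ β * u x) =
      uhat n * gammaJ α β n := by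
    intro n
    have hg := gammaJ_pos α β hα hβ n
    rw [huhat n, intervalIntegral.integral_of_le (by norm_num), integral_Ioc_eq_integral_Ioo]
    field_simp
    apply setIntegral_congr_fun measurableSet_Ioo
    intro x hx
    have hx1 : 0 < 1 - x := by linarith [hx.2]
    have p1 : 0 < (1 - x) ^ α := Real.rpow_pos_of_pos hx1 _
    simp only [jp_eval]
    rw [Real.rpow_neg hx1.le]
    field_simp
  have h4 := moments_zero (fun x => (1 + x) ^ β * u x - (1 + x) ^ β * Iplus α h x) (h1.sub h2)
    (jp_span α β hb _ (h1.sub h2) fun n => by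
      simp only [Pi.sub_apply, mul_sub]
      rw [integral_sub (cont_mul_int _ _ h1 (jp α β n).continuous)
        (cont_mul_int _ _ h2 (jp α β n).continuous), h3, v_mom α β hα hβ h hm hL hb uhat ht, sub_self])
  filter_upwards [h4, ae_restrict_mem measurableSet_Ioo] with x hx hx2
  have p2 : 0 < (1 + x) ^ β := Real.rpow_pos_of_pos (by linarith [hx2.1]) _
  have : (1 + x) ^ β * (u x - Iplus α h x) = 0 := by rw [mul_sub]; exact hx
  have := (mul_eq_zero.1 this).resolve_left p2.ne'
  linarith


lemma gen_bnd (s K : Set ℝ) (hs : MeasurableSet s) (hsI : s ⊆ Set.Ioo (-1:ℝ) 1) (hK : IsCompact K)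
    (hsK : s ⊆ K) (φ : ℝ → ℝ) (hφ : ContinuousOn φ K) :
    ∃ B : ℝ, 0 ≤ B ∧ ∀ w : ℝ → ℝ, IntegrableOn w (Set.Ioo (-1:ℝ) 1) →
      IntegrableOn (fun z => φ z * w z) s ∧
      ∫ z in s, |φ z * w z| ≤ B * ∫ z in Set.Ioo (-1:ℝ) 1, |w z| := by
  obtain ⟨B, hB⟩ := hK.exists_bound_of_continuousOn hφ
  refine ⟨max B 0, le_max_right _ _, fun w hw => ?_⟩
  have hws : IntegrableOn w s := hw.mono_set hsI
  have h1 : IntegrableOn (fun z => φ z * w z) s := by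
    refine (hws.norm.const_mul (max B 0)).mono' ?_ ?_
    · exact ((hφ.mono hsK).aestronglyMeasurable hs).mul hws.aestronglyMeasurable
    · filter_upwards [ae_restrict_mem hs] with z hz
      rw [norm_mul]
      exact mul_le_mul_of_nonneg_right ((hB z (hsK hz)).trans (le_max_left _ _)) (norm_nonneg _)
  refine ⟨h1, ?_⟩
  calc ∫ z in s, |φ z * w z| ≤ ∫ z in s, max B 0 * |w z| := by
        apply setIntegral_mono_on h1.abs (hws.abs.const_mul _) hs
        intro z hz
        rw [abs_mul]
        exact mul_le_mul_of_nonneg_right ((hB z (hsK hz)).trans (le_max_left _ _)) (abs_nonneg _)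
    _ = max B 0 * ∫ z in s, |w z| := integral_const_mul _ _
    _ ≤ _ := by
        apply mul_le_mul_of_nonneg_left _ (le_max_right _ _)
        exact setIntegral_mono_set hw.abs (Eventually.of_forall fun z => abs_nonneg _)
          (LE.le.eventuallyLE hsI)

lemma bnd_right (b κ x : ℝ) (hκ : 1 ≤ κ) (hx : x ∈ Set.Ioo (-1:ℝ) 1) :
    ∃ B : ℝ, 0 ≤ B ∧ ∀ d : ℝ → ℝ, IntegrableOn (fun z => (1 + z) ^ b * d z) (Set.Ioo (-1:ℝ) 1) →
      IntegrableOn (fun z => (z - x) ^ (κ - 1) * d z) (Set.Ioo x 1) ∧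
      ∫ z in Set.Ioo x 1, |(z - x) ^ (κ - 1) * d z| ≤
        B * ∫ z in Set.Ioo (-1:ℝ) 1, |(1 + z) ^ b * d z| := by
  obtain ⟨B, hB, H⟩ := gen_bnd (Set.Ioo x 1) (Set.Icc x 1) measurableSet_Ioo
    (Set.Ioo_subset_Ioo_left hx.1.le) isCompact_Icc Set.Ioo_subset_Icc_self
    (fun z => (z - x) ^ (κ - 1) * (1 + z) ^ (-b)) (by
      apply ContinuousOn.mul
      · apply ContinuousOn.rpow_const (by fun_prop)
        intro z _; right; linarith
      · apply ContinuousOn.rpow_const (by fun_prop)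
        intro z hz; left; have := hz.1; have := hx.1; linarith)
  refine ⟨B, hB, fun d hd => ?_⟩
  have h1 := H _ hd
  have e : ∀ z ∈ Set.Ioo x 1, (z - x) ^ (κ - 1) * (1 + z) ^ (-b) * ((1 + z) ^ b * d z) =
      (z - x) ^ (κ - 1) * d z := by
    intro z hz
    have hz' : 0 < 1 + z := by have := hz.1; have := hx.1; linarith
    have : 0 < (1 + z) ^ b := Real.rpow_pos_of_pos hz' _
    rw [Real.rpow_neg hz'.le]
    field_simp
  refine ⟨(integrableOn_congr_fun e measurableSet_Ioo).1 h1.1, ?_⟩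
  refine le_trans (le_of_eq ?_) h1.2
  apply setIntegral_congr_fun measurableSet_Ioo
  intro z hz
  simp only
  rw [e z hz]

lemma bnd_loc (a b x : ℝ) (hx : x ∈ Set.Ioo (-1:ℝ) 1) :
    ∃ B : ℝ, 0 ≤ B ∧ ∀ d : ℝ → ℝ, IntegrableOn (fun z => d z * wJ a b z) (Set.Ioo (-1:ℝ) 1) →
      IntegrableOn d (Set.uIoc 0 x) ∧
      ∫ z in Set.uIoc 0 x, |d z| ≤ B * ∫ z in Set.Ioo (-1:ℝ) 1, |d z| * wJ a b z := by
  have hsub : Set.uIcc 0 x ⊆ Set.Ioo (-1:ℝ) 1 :=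
    Set.ordConnected_Ioo.uIcc_subset (by norm_num) hx
  obtain ⟨B, hB, H⟩ := gen_bnd (Set.uIoc 0 x) (Set.uIcc 0 x) measurableSet_uIoc
    (uIoc_sub hx) isCompact_uIcc Set.uIoc_subset_uIcc
    (fun z => (wJ a b z)⁻¹) (by
      apply ContinuousOn.inv₀
      · unfold wJ
        apply ContinuousOn.mul
        · apply ContinuousOn.rpow_const (by fun_prop)
          intro z hz; left; have := (hsub hz).2; linarith
        · apply ContinuousOn.rpow_const (by fun_prop)
          intro z hz; left; have := (hsub hz).1; linarith
      · intro z hz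
        exact (wJ_pos a b z (hsub hz)).ne')
  refine ⟨B, hB, fun d hd => ?_⟩
  have h1 := H _ hd
  have e : ∀ z ∈ Set.uIoc 0 x, (wJ a b z)⁻¹ * (d z * wJ a b z) = d z := by
    intro z hz
    have := wJ_pos a b z (uIoc_sub hx hz)
    field_simp
  refine ⟨(integrableOn_congr_fun e measurableSet_uIoc).1 h1.1, ?_⟩
  have e1 : ∫ z in Set.uIoc 0 x, |d z| = ∫ z in Set.uIoc 0 x, |(wJ a b z)⁻¹ * (d z * wJ a b z)| := by
    apply setIntegral_congr_fun measurableSet_uIoc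
    intro z hz
    simp only
    rw [e z hz]
  rw [e1]
  refine h1.2.trans (le_of_eq ?_)
  congr 1
  apply setIntegral_congr_fun measurableSet_Ioo
  intro z hz
  simp only
  rw [abs_mul, abs_of_pos (wJ_pos a b z hz)]

lemma semigroup (α b ρ x : ℝ) (hα : 0 < α) (hρ : 0 < ρ) (hκ : 1 ≤ ρ + α)
    (hx : x ∈ Set.Ioo (-1:ℝ) 1) (h : ℝ → ℝ) (hm : Measurable h)
    (hi : IntegrableOn (fun z => (1 + z) ^ b * h z) (Set.Ioo (-1:ℝ) 1)) :
    IntervalIntegrable (fun y => (y - x) ^ (ρ - 1) * Iplus α h y) volume x 1 ∧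
    Iplus ρ (Iplus α h) x = Iplus (ρ + α) h x := by
  obtain ⟨B, hB, H⟩ := bnd_right b (ρ + α) x hκ hx
  have h1 := (H h hi).1
  constructor
  · rw [intervalIntegrable_iff_integrableOn_Ioo_of_le hx.2.le]
    exact frac_int_s13 x ρ α h hm hρ hα h1
  · have h2 := frac_eq x ρ α h hm hρ hα h1
    rw [Iplus, intervalIntegral.integral_of_le hx.2.le, integral_Ioc_eq_integral_Ioo, h2, Iplus,
      intervalIntegral.integral_of_le hx.2.le, integral_Ioc_eq_integral_Ioo]
    have := (Real.Gamma_pos_of_pos hρ).ne'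
    field_simp

noncomputable def FQ (α β : ℝ) (uhat : ℕ → ℝ) (M : ℕ) : Polynomial ℝ :=
  ∑ n ∈ Finset.range (M + 1), Polynomial.C (uhat n) * QJ α β (k0 α) n

noncomputable def SP (α β : ℝ) (uhat : ℕ → ℝ) (j M : ℕ) : Polynomial ℝ :=
  ∑ n ∈ Finset.Icc j M,
    Polynomial.C (uhat n * ((-1) ^ j * cJ α n)) * Polynomial.derivative^[j] (jp 0 (α + β) n)

lemma FQ_eval (α β x : ℝ) (hα : 0 < α) (hx : x < 1) (uhat : ℕ → ℝ) (M : ℕ) :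
    IntervalIntegrable (fun y => (y - x) ^ ((k0 α - α) - 1) *
      ∑ n ∈ Finset.range (M + 1), uhat n * gJ α β n y) volume x 1 ∧
    Iplus (k0 α - α) (fun y => ∑ n ∈ Finset.range (M + 1), uhat n * gJ α β n y) x =
      (FQ α β uhat M).eval x := by
  have hk := k0_gt α hα
  have h := Iplus_lin (k0 α - α) x (Finset.range (M + 1)) uhat (gJ α β)
    (fun n => gJ_ii α β (k0 α - α) x hα.le (by linarith) hx n)
  refine ⟨h.1, ?_⟩
  rw [h.2, FQ, Polynomial.eval_finsetSum]
  apply Finset.sum_congr rfl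
  intro n _
  rw [Iplus_gJ α β x hα hx n (k0 α) hk]
  simp

lemma FQ_deriv (α β : ℝ) (hα : 0 < α) (uhat : ℕ → ℝ) (l M : ℕ) :
    Polynomial.derivative^[k0 α + l] (FQ α β uhat M) =
      Polynomial.C ((-1) ^ (k0 α + l)) * SP α β uhat l M := by
  unfold FQ SP
  rw [Polynomial.iterate_derivative_sum, Finset.mul_sum]
  have hs : Finset.Icc l M ⊆ Finset.range (M + 1) := by
    intro i hi; simp at hi ⊢; omega
  have e : ∀ n, Polynomial.derivative^[k0 α + l] (Polynomial.C (uhat n) * QJ α β (k0 α) n) =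
      Polynomial.C ((-1) ^ (k0 α + l)) * (Polynomial.C (uhat n * ((-1) ^ l * cJ α n)) *
        Polynomial.derivative^[l] (jp 0 (α + β) n)) := by
    intro n
    rw [Polynomial.iterate_derivative_C_mul, QJ_deriv α β hα, ← mul_assoc, ← mul_assoc,
      ← Polynomial.C_mul, ← Polynomial.C_mul]
    congr 2
    rw [pow_add]
    have : ((-1:ℝ) ^ l) * (-1) ^ l = 1 := by rw [← mul_pow]; simp
    linear_combination (-(uhat n * (-1) ^ k0 α * cJ α n)) * this
  rw [← Finset.sum_subset hs]
  · exact Finset.sum_congr rfl fun n _ => e n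
  · intro n hn1 hn2
    rw [e n, Polynomial.iterate_derivative_eq_zero]
    · simp
    · have := jp_natDegree_le 0 (α + β) n
      simp at hn1 hn2
      omega

lemma FQ_tendsto (α β : ℝ) (hα : 0 < α) (u : ℝ → ℝ) (uhat : ℕ → ℝ)
    (h : ℝ → ℝ) (hm : Measurable h)
    (hL : MemLp h 2 (muJ 0 (α + β))) (hb : -1 < α + β)
    (ht : Tendsto (fun M => PL 0 (α + β) (by norm_num) hb (fP α β uhat M)) atTop
      (nhds (hL.toLp h)))
    (huv : ∀ᵐ x ∂(volume.restrict (Set.Ioo (-1:ℝ) 1)), u x = Iplus α h x)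
    (x : ℝ) (hx : x ∈ Set.Ioo (-1:ℝ) 1) :
    IntervalIntegrable (fun y => (y - x) ^ ((k0 α - α) - 1) * u y) volume x 1 ∧
    Tendsto (fun M => (FQ α β uhat M).eval x) atTop (nhds (Iplus (k0 α - α) u x)) := by
  have hk := k0_gt α hα
  have hk1 : (1:ℝ) ≤ k0 α := by
    have : 1 ≤ k0 α := by unfold k0; omega
    exact_mod_cast this
  have hr : (0:ℝ) < k0 α - α := by linarith
  have hs : (k0 α - α : ℝ) + α = k0 α := by ring
  have hhi := h_int (α + β) hb h hL
  have hc := Iplus_ae_congr (k0 α - α) x hx u (Iplus α h) huv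
  have hsg := semigroup α (α + β) (k0 α - α) x hα hr (by linarith) hx h hm hhi
  constructor
  · have h1 := hsg.1
    rw [intervalIntegrable_iff_integrableOn_Ioo_of_le hx.2.le] at h1 ⊢
    exact h1.congr hc.1.symm
  · rw [hc.2, hsg.2, hs]
    have hF : ∀ M, (FQ α β uhat M).eval x = Iplus (k0 α) (fun y => (fP α β uhat M).eval y) x := by
      intro M
      have hpi := h_int (α + β) hb _ (poly_memLp 0 (α + β) (by norm_num) hb (fP α β uhat M))
      have := semigroup α (α + β) (k0 α - α) x hα hr (by linarith) hx _
        (fP α β uhat M).continuous.measurable hpi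
      rw [hs] at this
      rw [← this.2, ← (FQ_eval α β x hα hx.2 uhat M).2]
      apply (Iplus_ae_congr (k0 α - α) x hx _ _ _).2
      filter_upwards [ae_restrict_mem measurableSet_Ioo] with y hy
      rw [Iplus_fP α β y hα hy.2]
    simp only [hF]
    obtain ⟨B, hB, H⟩ := bnd_right (α + β) (k0 α) x hk1 hx
    rw [tendsto_iff_norm_sub_tendsto_zero]
    have hg : 0 < Real.Gamma (k0 α) := Real.Gamma_pos_of_pos (by linarith)
    have h1 : Tendsto (fun M => (1 / Real.Gamma (k0 α)) * (B * (‖PL 0 (α + β) (by norm_num) hb 1‖ *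
        ‖PL 0 (α + β) (by norm_num) hb (fP α β uhat M) - hL.toLp h‖))) atTop (nhds 0) := by
      have := (ht.sub_const (hL.toLp h)).norm
      simp only [sub_self, norm_zero] at this
      have := ((this.const_mul ‖PL 0 (α + β) (by norm_num) hb 1‖).const_mul B).const_mul
        (1 / Real.Gamma (k0 α))
      simpa using this
    refine squeeze_zero (fun _ => norm_nonneg _) (fun M => ?_) h1
    have hp := (H _ (h_int (α + β) hb _ (poly_memLp 0 (α + β) (by norm_num) hb (fP α β uhat M)))).1
    have hh := (H _ hhi).1
    have hL1 := PL_L1 0 (α + β) (by norm_num) hb (fP α β uhat M) h hL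
    have hd : IntegrableOn (fun z => (1 + z) ^ (α + β) * ((fP α β uhat M).eval z - h z))
        (Set.Ioo (-1:ℝ) 1) := by
      refine hL1.1.congr (Eventually.of_forall fun z => ?_)
      simp [wJ]; ring
    have hd2 := (H _ hd).2
    rw [← Iplus_sub _ _ _ _ (by rwa [intervalIntegrable_iff_integrableOn_Ioo_of_le hx.2.le])
      (by rwa [intervalIntegrable_iff_integrableOn_Ioo_of_le hx.2.le]), Iplus, norm_mul,
      Real.norm_of_nonneg (by positivity), intervalIntegral.integral_of_le hx.2.le,
      integral_Ioc_eq_integral_Ioo]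
    apply mul_le_mul_of_nonneg_left _ (by positivity)
    refine (norm_integral_le_integral_norm _).trans (hd2.trans ?_)
    apply mul_le_mul_of_nonneg_left _ hB
    refine le_trans (le_of_eq ?_) hL1.2
    apply setIntegral_congr_fun measurableSet_Ioo
    intro z hz
    have : 0 < (1 + z) ^ (α + β) := Real.rpow_pos_of_pos (by linarith [hz.1]) _
    simp only [wJ, Real.rpow_zero, one_mul]
    rw [abs_mul, abs_of_pos this, mul_comm]

/-- Key identity, measurable case. -/
lemma key_meas (α β : ℝ) (hα : 0 < α) (u : ℝ → ℝ) (uhat : ℕ → ℝ)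
    (h : ℝ → ℝ) (hm : Measurable h)
    (hL : MemLp h 2 (muJ 0 (α + β))) (hb : -1 < α + β)
    (ht : Tendsto (fun M => PL 0 (α + β) (by norm_num) hb (fP α β uhat M)) atTop
      (nhds (hL.toLp h)))
    (huv : ∀ᵐ x ∂(volume.restrict (Set.Ioo (-1:ℝ) 1)), u x = Iplus α h x)
    (l N : ℕ) (a' b' : ℝ) (ha' : -1 < a') (hb' : -1 < b')
    (hD : MemLp (DplusC (α + l) u) 2 (muJ a' b'))
    (htD : Tendsto (fun M => PL a' b' ha' hb' (SP α β uhat l M)) atTop (nhds (hD.toLp _))) :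
    ∀ᵐ x ∂(volume.restrict (Set.Ioo (-1:ℝ) 1)),
      DplusC (α + l) (fun y => (∑ n ∈ Finset.range (N + 1), uhat n * gJ α β n y) - u y) x =
        (SP α β uhat l N).eval x - DplusC (α + l) u x := by
  have hk : k0 α + l = (⌊α⌋.toNat + l) + 1 := by unfold k0; omega
  set g : ℝ → ℝ := fun x => (-1) ^ (k0 α + l) * DplusC (α + l) u x with hgdef
  have hsq : ((-1:ℝ) ^ (k0 α + l)) * (-1) ^ (k0 α + l) = 1 := by rw [← mul_pow]; simp
  have hDi : IntegrableOn (fun z => DplusC (α + l) u z * wJ a' b' z) (Set.Ioo (-1:ℝ) 1) := by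
    have := (PL_L1 a' b' ha' hb' 0 _ hD).1.neg
    refine this.congr (Eventually.of_forall fun z => ?_)
    simp
  have hg : LI g := by
    intro x hx
    obtain ⟨B, hB, H⟩ := bnd_loc a' b' x hx
    rw [intervalIntegrable_iff]
    exact (H _ hDi).1.const_mul _
  have hF : ∀ x ∈ Set.Ioo (-1:ℝ) 1, Tendsto (fun M => (FQ α β uhat M).eval x) atTop
      (nhds (Iplus (k0 α - α) u x)) := fun x hx =>
    (FQ_tendsto α β hα u uhat h hm hL hb ht huv x hx).2
  have hd : ∀ x ∈ Set.Ioo (-1:ℝ) 1, Tendsto (fun M => ∫ t in Set.uIoc 0 x,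
      |(Polynomial.derivative^[(⌊α⌋.toNat + l) + 1] (FQ α β uhat M)).eval t - g t|) atTop (nhds 0) := by
    intro x hx
    obtain ⟨B, hB, H⟩ := bnd_loc a' b' x hx
    have h1 : Tendsto (fun M => B * (‖PL a' b' ha' hb' 1‖ *
        ‖PL a' b' ha' hb' (SP α β uhat l M) - hD.toLp _‖)) atTop (nhds 0) := by
      have := (htD.sub_const (hD.toLp _)).norm
      simp only [sub_self, norm_zero] at this
      have := (this.const_mul ‖PL a' b' ha' hb' 1‖).const_mul B
      simpa using this
    refine squeeze_zero (fun _ => integral_nonneg fun _ => abs_nonneg _) (fun M => ?_) h1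
    have hL1 := PL_L1 a' b' ha' hb' (SP α β uhat l M) _ hD
    refine le_trans (le_of_eq ?_) (((H _ hL1.1).2).trans (mul_le_mul_of_nonneg_left hL1.2 hB))
    apply integral_congr_ae
    refine Eventually.of_forall fun t => ?_
    simp only
    rw [← hk, FQ_deriv α β hα, Polynomial.eval_mul, Polynomial.eval_C, hgdef]
    simp only
    rw [← mul_sub, abs_mul, abs_pow]
    simp
  obtain ⟨T, hT⟩ := limit_repr _ (FQ α β uhat) (Iplus (k0 α - α) u) g hg hF hd
  have h3 := iter_sub g hg _ (FQ α β uhat N) T (Iplus (k0 α - α) u) hT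
  filter_upwards [h3, ae_restrict_mem measurableSet_Ioo] with x hx hx2
  rw [DplusC_eq α hα, DplusC_eq α hα]
  have he : Iplus (k0 α - α) (fun y => (∑ n ∈ Finset.range (N + 1), uhat n * gJ α β n y) - u y)
      =ᶠ[nhds x] fun y => (FQ α β uhat N).eval y - Iplus (k0 α - α) u y := by
    filter_upwards [isOpen_Ioo.mem_nhds hx2] with y hy
    rw [Iplus_sub _ _ _ _ (FQ_eval α β y hα hy.2 uhat N).1
      (FQ_tendsto α β hα u uhat h hm hL hb ht huv y hy).1, (FQ_eval α β y hα hy.2 uhat N).2]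
  rw [he.iteratedDeriv_eq, hk, hx, ← hk, poly_iteratedDeriv, FQ_deriv α β hα, Polynomial.eval_mul,
    Polynomial.eval_C]
  linear_combination (SP α β uhat l N).eval x * hsq


lemma uhat_zero (α β : ℝ) (hα : 0 < α) (hβ : -1 < β) (u : ℝ → ℝ)
    (hum : ¬ AEStronglyMeasurable u (volume.restrict (Set.Ioo (-1:ℝ) 1))) (n : ℕ) :
    ∫ x in (-1 : ℝ)..1,
        u x * ((1 - x) ^ α * jacobiP α β n x) * ((1 - x) ^ (-α) * (1 + x) ^ β) = 0 := by
  by_contra hne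
  apply hum
  have h1 := not_imp_comm.1 intervalIntegral.integral_undef hne
  rw [intervalIntegrable_iff_integrableOn_Ioo_of_le (by norm_num)] at h1
  have h2 : AEStronglyMeasurable (fun x => ((((1 - x) ^ α * (jp α β n).eval x) *
      ((1 - x) ^ (-α) * (1 + x) ^ β)) : ℝ)⁻¹) (volume.restrict (Set.Ioo (-1:ℝ) 1)) := by
    apply Measurable.aestronglyMeasurable
    have := (jp α β n).continuous.measurable
    fun_prop
  refine (h1.aestronglyMeasurable.mul h2).congr ?_
  have h3 : ∀ᵐ x ∂(volume.restrict (Set.Ioo (-1:ℝ) 1)), (jp α β n).eval x ≠ 0 := by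
    apply ae_restrict_of_ae
    have hfin : ((jp α β n).roots.toFinset : Set ℝ).Finite := Finset.finite_toSet _
    have := hfin.measure_zero volume
    rw [ae_iff]
    refine measure_mono_null ?_ this
    intro x hx
    simp only [ne_eq, not_not, Set.mem_setOf_eq] at hx
    simp [jp_ne_zero α β (by linarith) n, hx]
  filter_upwards [h3, ae_restrict_mem measurableSet_Ioo] with x hx hx2
  have p1 : 0 < (1 - x) ^ α := Real.rpow_pos_of_pos (by linarith [hx2.2]) _
  have p2 : 0 < (1 - x) ^ (-α) := Real.rpow_pos_of_pos (by linarith [hx2.2]) _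
  have p3 : 0 < (1 + x) ^ β := Real.rpow_pos_of_pos (by linarith [hx2.1]) _
  simp only [Pi.mul_apply]
  rw [← jp_eval]
  field_simp

lemma Dplus_meas (α : ℝ) (hα : 0 < α) (j : ℕ) (v : ℝ → ℝ) : Measurable (DplusC (α + j) v) := by
  have e : DplusC (α + j) v = fun x => (-1) ^ (k0 α + j) *
      deriv (iteratedDeriv (⌊α⌋.toNat + j) (Iplus (k0 α - α) v)) x := by
    ext x
    rw [DplusC_eq α hα, show k0 α + j = (⌊α⌋.toNat + j) + 1 by unfold k0; omega, iteratedDeriv_succ]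
  rw [e]
  exact (measurable_deriv _).const_mul _

lemma Dplus_neg (α : ℝ) (hα : 0 < α) (j : ℕ) (v : ℝ → ℝ) (x : ℝ) :
    DplusC (α + j) (fun y => - v y) x = - DplusC (α + j) v x := by
  rw [DplusC_eq α hα, DplusC_eq α hα]
  have e : Iplus (k0 α - α) (fun y => - v y) = fun x => - Iplus (k0 α - α) v x := by
    ext x
    simp [Iplus, intervalIntegral.integral_neg]
  rw [e, iteratedDeriv_fun_neg]
  ring

noncomputable def ep (α β : ℝ) (uhat : ℕ → ℝ) (j n : ℕ) : Polynomial ℝ :=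
  Polynomial.C (uhat n * ((-1) ^ j * cJ α n)) * Polynomial.derivative^[j] (jp 0 (α + β) n)

lemma ep_inner (α β : ℝ) (uhat : ℕ → ℝ) (j i k : ℕ) (a' b' : ℝ) (ha : -1 < a') (hb : -1 < b')
    (ea : a' = j) (eb : b' = α + β + j) :
    inner ℝ (PL a' b' ha hb (ep α β uhat j i)) (PL a' b' ha hb (ep α β uhat j k)) =
      (uhat i * cJ α i) * (uhat k * cJ α k) * ipJ 0 (α + β) j i k := by
  rw [PL_inner]
  unfold ipJ
  rw [← intervalIntegral.integral_const_mul]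
  apply intervalIntegral.integral_congr
  intro x _
  subst ea eb
  have : ((-1:ℝ) ^ j) * (-1) ^ j = 1 := by rw [← mul_pow]; simp
  simp only [ep, Polynomial.eval_mul, Polynomial.eval_C, zero_add]
  linear_combination ((uhat i * cJ α i) * (uhat k * cJ α k) *
    (Polynomial.derivative^[j] (jp 0 (α + β) i)).eval x *
    (Polynomial.derivative^[j] (jp 0 (α + β) k)).eval x * wJ j (α + β + j) x) * this

lemma ep_norm (α β : ℝ) (uhat : ℕ → ℝ) (j i : ℕ) (a' b' : ℝ) (ha : -1 < a') (hb : -1 < b')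
    (ea : a' = j) (eb : b' = α + β + j) :
    ‖PL a' b' ha hb (ep α β uhat j i)‖ ^ 2 = (uhat i * cJ α i) ^ 2 * ipJ 0 (α + β) j i i := by
  rw [← real_inner_self_eq_norm_sq, ep_inner α β uhat j i i a' b' ha hb ea eb]
  ring

lemma ep_orth (α β : ℝ) (uhat : ℕ → ℝ) (j : ℕ) (a' b' : ℝ) (ha : -1 < a') (hb : -1 < b')
    (ea : a' = j) (eb : b' = α + β + j) (hab : -1 < α + β) (i k : ℕ) (hik : i ≠ k) :
    inner ℝ (PL a' b' ha hb (ep α β uhat j i)) (PL a' b' ha hb (ep α β uhat j k)) = 0 := by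
  rw [ep_inner α β uhat j i k a' b' ha hb ea eb, ipJ_ne 0 (α + β) (by norm_num) hab (by linarith) _ _ _ hik,
    mul_zero]

/-- Key identity. -/
lemma key_all (α β : ℝ) (hα : 0 < α) (hβ : -1 < β) (u : ℝ → ℝ)
    (hu : IntegrableOn (fun x => (u x) ^ 2 * ((1 - x) ^ (-α) * (1 + x) ^ β))
      (Set.Ioo (-1 : ℝ) 1)) (uhat : ℕ → ℝ)
    (huhat : ∀ n : ℕ, uhat n = (1 / gammaJ α β n) *
      ∫ x in (-1 : ℝ)..1,
        u x * ((1 - x) ^ α * jacobiP α β n x) * ((1 - x) ^ (-α) * (1 + x) ^ β))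
    (hb : -1 < α + β) (l N : ℕ) (ha' : -1 < (l:ℝ)) (hb' : -1 < α + β + l)
    (hD : MemLp (DplusC (α + l) u) 2 (muJ l (α + β + l)))
    (htD : Tendsto (fun M => PL l (α + β + l) ha' hb' (SP α β uhat l M)) atTop (nhds (hD.toLp _))) :
    ∀ᵐ x ∂(volume.restrict (Set.Ioo (-1:ℝ) 1)),
      DplusC (α + l) (fun y => (∑ n ∈ Finset.range (N + 1), uhat n * gJ α β n y) - u y) x =
        (SP α β uhat l N).eval x - DplusC (α + l) u x := by
  by_cases hum : AEStronglyMeasurable u (volume.restrict (Set.Ioo (-1:ℝ) 1))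
  · have hz : (-1:ℝ) < 0 := by norm_num
    have htD' : Tendsto (fun M => ∑ n ∈ Finset.Icc l M, PL l (α + β + l) ha' hb' (ep α β uhat l n))
        atTop (nhds (hD.toLp _)) := by
      refine htD.congr fun M => ?_
      rw [SP, map_sum]
      rfl
    obtain ⟨f, hf⟩ := abs_cauchy (fun n => PL l (α + β + l) ha' hb' (ep α β uhat l n))
      (fun n => PL 0 (α + β) hz hb (ep α β uhat 0 n))
      (ep_orth α β uhat l _ _ ha' hb' rfl rfl hb)
      (ep_orth α β uhat 0 _ _ hz hb (by simp) (by simp) hb) l _ htD' (by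
        intro n hn
        rw [ep_norm α β uhat 0 n _ _ hz hb (by simp) (by simp),
          ep_norm α β uhat l n _ _ ha' hb' rfl rfl]
        exact mul_le_mul_of_nonneg_left (ipJ_mono _ hb n l hn) (sq_nonneg _))
    have hm : Measurable (f : ℝ → ℝ) := (Lp.stronglyMeasurable f).measurable
    have hL : MemLp (f : ℝ → ℝ) 2 (muJ 0 (α + β)) := Lp.memLp f
    have ht : Tendsto (fun M => PL 0 (α + β) hz hb (fP α β uhat M)) atTop (nhds (hL.toLp f)) := by
      rw [Lp.toLp_coeFn]
      refine hf.congr fun M => ?_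
      rw [fP, map_sum, Nat.range_succ_eq_Icc_zero]
      apply Finset.sum_congr rfl
      intro n _
      simp [ep]
    have huv := u_eq_v α β hα hβ u hum hu uhat huhat f hm hL hb ht
    exact key_meas α β hα u uhat f hm hL hb ht huv l N _ _ ha' hb' hD htD
  · have h0 : ∀ n, uhat n = 0 := by
      intro n
      rw [huhat n, uhat_zero α β hα hβ u hum n, mul_zero]
    refine Eventually.of_forall fun x => ?_
    simp only [h0, zero_mul, Finset.sum_const_zero, zero_sub, SP, Polynomial.C_0, Polynomial.eval_zero]
    exact Dplus_neg α hα l u x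

/-- Theorem 4.1, estimate (4.28): error of the GJF orthogonal
projection in the fractional Sobolev-type seminorm. -/
theorem stmt13 (α β : ℝ) (hα : 0 < α) (hβ : -1 < β) (l m N : ℕ)
    (hlm : l ≤ m) (hmN : m ≤ N) (hN : 1 ≤ N)
    (u : ℝ → ℝ)
    (hu : IntegrableOn (fun x => (u x) ^ 2 * ((1 - x) ^ (-α) * (1 + x) ^ β))
      (Set.Ioo (-1 : ℝ) 1))
    (uhat : ℕ → ℝ)
    (huhat : ∀ n : ℕ, uhat n = (1 / gammaJ α β n) *
      ∫ x in (-1 : ℝ)..1,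
        u x * ((1 - x) ^ α * jacobiP α β n x) * ((1 - x) ^ (-α) * (1 + x) ^ β))
    (Du : ℕ → ℝ → ℝ)
    (hDu : ∀ j : ℕ, Du j = DplusC (α + (j : ℝ)) u)
    (hmem : ∀ j : ℕ, (j = l ∨ j = m) →
      IntegrableOn (fun x => (Du j x) ^ 2 * ((1 - x) ^ (j : ℝ) * (1 + x) ^ (α + β + (j : ℝ))))
          (Set.Ioo (-1 : ℝ) 1) ∧
        Filter.Tendsto (fun M : ℕ => ∫ x in (-1 : ℝ)..1,
            ((∑ n ∈ Finset.Icc j M,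
                uhat n * DplusC (α + (j : ℝ)) (fun y => (1 - y) ^ α * jacobiP α β n y) x) -
              Du j x) ^ 2 * ((1 - x) ^ (j : ℝ) * (1 + x) ^ (α + β + (j : ℝ))))
          Filter.atTop (nhds 0)) :
    Real.sqrt (∫ x in (-1 : ℝ)..1,
        (DplusC (α + (l : ℝ))
            (fun y => (∑ n ∈ Finset.range (N + 1), uhat n * ((1 - y) ^ α * jacobiP α β n y)) -
              u y) x) ^ 2 *
          ((1 - x) ^ (l : ℝ) * (1 + x) ^ (α + β + (l : ℝ)))) ≤
      (N : ℝ) ^ (((l : ℝ) - (m : ℝ)) / 2) *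
        Real.sqrt ((Nat.factorial (N - m + 1) : ℝ) / (Nat.factorial (N - l + 1) : ℝ)) *
        Real.sqrt (∫ x in (-1 : ℝ)..1,
          (Du m x) ^ 2 * ((1 - x) ^ (m : ℝ) * (1 + x) ^ (α + β + (m : ℝ)))) := by
  have hb : -1 < α + β := by linarith
  have ha' : ∀ j : ℕ, (-1:ℝ) < (j:ℝ) := fun j => by
    have : (0:ℝ) ≤ j := by positivity
    linarith
  have hb' : ∀ j : ℕ, (-1:ℝ) < α + β + j := fun j => by
    have : (0:ℝ) ≤ j := by positivity
    linarith
  have hD : ∀ j : ℕ, (j = l ∨ j = m) → MemLp (DplusC (α + j) u) 2 (muJ j (α + β + j)) := by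
    intro j hj
    apply muJ_memLp _ _ _ (Dplus_meas α hα j u)
    rw [← hDu j]
    exact (hmem j hj).1
  have hT : ∀ (j : ℕ) (hj : j = l ∨ j = m),
      Tendsto (fun M => PL j (α + β + j) (ha' j) (hb' j) (SP α β uhat j M)) atTop
        (nhds ((hD j hj).toLp _)) := by
    intro j hj
    rw [tendsto_iff_norm_sub_tendsto_zero]
    have h1 := (hmem j hj).2
    have h2 := (Real.continuous_sqrt.tendsto 0).comp h1
    rw [Real.sqrt_zero] at h2
    refine h2.congr fun M => ?_
    simp only [Function.comp]
    rw [← Real.sqrt_sq (norm_nonneg _), PL_sub_norm_sq]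
    congr 1
    rw [intervalIntegral.integral_of_le (by norm_num), intervalIntegral.integral_of_le (by norm_num),
      integral_Ioc_eq_integral_Ioo, integral_Ioc_eq_integral_Ioo]
    apply setIntegral_congr_fun measurableSet_Ioo
    intro x hx
    simp only
    have e : ∑ n ∈ Finset.Icc j M, uhat n * DplusC (α + (j : ℝ))
        (fun y => (1 - y) ^ α * jacobiP α β n y) x = (SP α β uhat j M).eval x := by
      rw [SP, Polynomial.eval_finsetSum]
      apply Finset.sum_congr rfl
      intro n _
      have := DplusC_gJ α β x hα hx.2 n j
      rw [show (fun y => (1 - y) ^ α * jacobiP α β n y) = gJ α β n from rfl, this]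
      simp only [Polynomial.eval_mul, Polynomial.eval_C]
      ring
    rw [e, hDu j]
    rfl
  have hTe : ∀ (j : ℕ) (hj : j = l ∨ j = m),
      Tendsto (fun M => ∑ n ∈ Finset.Icc j M,
        PL j (α + β + j) (ha' j) (hb' j) (ep α β uhat j n)) atTop
        (nhds ((hD j hj).toLp _)) := by
    intro j hj
    refine (hT j hj).congr fun M => ?_
    rw [SP, map_sum]
    rfl
  have hkey := key_all α β hα hβ u hu uhat huhat hb l N (ha' l) (hb' l) (hD l (Or.inl rfl))
    (hT l (Or.inl rfl))
  have hN0 : (0:ℝ) < N := by exact_mod_cast hN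
  set K : ℝ := (N : ℝ) ^ ((l : ℝ) - (m : ℝ)) *
    ((Nat.factorial (N - m + 1) : ℝ) / (Nat.factorial (N - l + 1) : ℝ)) with hK
  have hK0 : 0 ≤ K := by positivity
  have hKd : K * ((N : ℝ) ^ (m - l) * ((N + 1 - l).descFactorial (m - l) : ℝ)) = 1 := by
    have h1 := Nat.factorial_mul_descFactorial (show m - l ≤ N + 1 - l by omega)
    rw [show N + 1 - l - (m - l) = N - m + 1 by omega] at h1
    rw [show N - l + 1 = N + 1 - l by omega] at hK
    have h2 : (Nat.factorial (N - m + 1) : ℝ) * ((N + 1 - l).descFactorial (m - l) : ℝ) =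
      (Nat.factorial (N + 1 - l) : ℝ) := by exact_mod_cast h1
    have h3 : (N : ℝ) ^ ((l : ℝ) - (m : ℝ)) * (N : ℝ) ^ (m - l) = 1 := by
      rw [← Real.rpow_natCast, ← Real.rpow_add hN0, Nat.cast_sub hlm]
      simp
    have h4 : (Nat.factorial (N + 1 - l) : ℝ) ≠ 0 := by positivity
    calc K * ((N : ℝ) ^ (m - l) * ((N + 1 - l).descFactorial (m - l) : ℝ))
        = ((N : ℝ) ^ ((l : ℝ) - (m : ℝ)) * (N : ℝ) ^ (m - l)) *
          (((Nat.factorial (N - m + 1) : ℝ) * ((N + 1 - l).descFactorial (m - l) : ℝ)) /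
            (Nat.factorial (N + 1 - l) : ℝ)) := by rw [hK]; ring
      _ = 1 := by rw [h2, h3, div_self h4, mul_one]
  have hest := abs_est
    (fun n => PL l (α + β + l) (ha' l) (hb' l) (ep α β uhat l n))
    (fun n => PL m (α + β + m) (ha' m) (hb' m) (ep α β uhat m n))
    (ep_orth α β uhat l _ _ (ha' l) (hb' l) rfl rfl hb)
    (ep_orth α β uhat m _ _ (ha' m) (hb' m) rfl rfl hb) l m N hlm hmN _ _
    (hTe l (Or.inl rfl)) (hTe m (Or.inr rfl)) K hK0 (by
      intro n hn
      rw [ep_norm α β uhat l n _ _ (ha' l) (hb' l) rfl rfl,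
        ep_norm α β uhat m n _ _ (ha' m) (hb' m) rfl rfl]
      have h1 := ipJ_growth (α + β) hb N n l (m - l) (by omega) hn
      rw [show l + (m - l) = m by omega] at h1
      have h2 := mul_le_mul_of_nonneg_left h1 (mul_nonneg hK0 (sq_nonneg (uhat n * cJ α n)))
      calc (uhat n * cJ α n) ^ 2 * ipJ 0 (α + β) l n n
          = (K * ((N : ℝ) ^ (m - l) * ((N + 1 - l).descFactorial (m - l) : ℝ))) *
            ((uhat n * cJ α n) ^ 2 * ipJ 0 (α + β) l n n) := by rw [hKd, one_mul]
        _ = K * (uhat n * cJ α n) ^ 2 *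
            ((N : ℝ) ^ (m - l) * ((N + 1 - l).descFactorial (m - l) : ℝ) *
              ipJ 0 (α + β) l n n) := by ring
        _ ≤ _ := h2
        _ = _ := by ring)
  have hA : ∫ x in (-1 : ℝ)..1,
        (DplusC (α + (l : ℝ))
            (fun y => (∑ n ∈ Finset.range (N + 1), uhat n * ((1 - y) ^ α * jacobiP α β n y)) -
              u y) x) ^ 2 *
          ((1 - x) ^ (l : ℝ) * (1 + x) ^ (α + β + (l : ℝ))) =
      ‖∑ n ∈ Finset.Icc l N, PL l (α + β + l) (ha' l) (hb' l) (ep α β uhat l n) -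
        (hD l (Or.inl rfl)).toLp _‖ ^ 2 := by
    rw [← map_sum, PL_sub_norm_sq, intervalIntegral.integral_of_le (by norm_num),
      intervalIntegral.integral_of_le (by norm_num),
      integral_Ioc_eq_integral_Ioo, integral_Ioc_eq_integral_Ioo]
    apply integral_congr_ae
    filter_upwards [hkey] with x hx
    have hx' : DplusC (α + (l : ℝ))
            (fun y => (∑ n ∈ Finset.range (N + 1), uhat n * ((1 - y) ^ α * jacobiP α β n y)) -
              u y) x = (∑ n ∈ Finset.Icc l N, ep α β uhat l n).eval x - DplusC (α + l) u x := hx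
    rw [hx']
    rfl
  have hB : ∫ x in (-1 : ℝ)..1,
          (Du m x) ^ 2 * ((1 - x) ^ (m : ℝ) * (1 + x) ^ (α + β + (m : ℝ))) =
      ‖(hD m (Or.inr rfl)).toLp _‖ ^ 2 := by
    rw [toLp_norm_sq, muJ_integral, hDu m]
    rfl
  rw [hA, hB, Real.sqrt_sq (norm_nonneg _), Real.sqrt_sq (norm_nonneg _)]
  rw [← sq_le_sq₀ (norm_nonneg _) (by positivity)]
  refine hest.trans (le_of_eq ?_)
  rw [mul_pow, mul_pow, Real.sq_sqrt (by positivity), hK]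
  congr 2
  rw [← Real.rpow_natCast, ← Real.rpow_mul hN0.le]
  congr 1
  push_cast
  ring
end
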